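/- Let δ ∈ (0, 1/2) satisfy 12·10^{2δ} < ln(1/(2δ)) and ln(1/(2δ)) ≤ 1000. Then there exist reals M > 6, ξ > 1, ε > 0, an integer K ≥ 2, a constant C > 0 and x₀ such that for every x ≥ x₀ and every positive integer N there exist an integer b, sets U' ⊆ ⋃_{H∈𝔥₁} Q_H and V' ⊆ ⋃_{H∈𝔥₂} Q_H, sets 𝒩 ⊆ S_z(b) ∩ [1,y] and 𝒩* ⊆ S_z(−N−b) ∩ [−y,−1], and reals C₂, C₃ ∈ [10^{2δ}, 100], satisfying: (i) #(S_z(b) ∩ [1,y]) ≤ 2σ_z y and #(S_z(−N−b) ∩ [−y,−1]) ≤ 2σ_z y; (ii) for all q ∈ U', |∑_{−Ky < n ≤ y} λ_b(H_q; q, n) − (K+1)y| ≤ C·(K+1)y/(ln x)^{δ(1+ε)}; (iii) for all q ∈ V', |∑_{−y ≤ n < Ky} λ*_b(H_q; q, n) − (K+1)y| ≤ C·(K+1)y/(ln x)^{δ(1+ε)}; (iv) #((S_z(b) ∩ [1,y]) \ 𝒩) ≤ x/(10 ln x) and for every n ∈ 𝒩, |∑_{q ∈ U'} ∑_{1 ≤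 h ≤ K·H_q} λ_b(H_q; q, n − qh) − C₂·(K+1)y| ≤ C·(K+1)y/(ln x)^{δ(1+ε)}; (v) #((S_z(−N−b) ∩ [−y,−1]) \ 𝒩*) ≤ x/(10 ln x) and for every n ∈ 𝒩*, |∑_{q ∈ V'} ∑_{1 ≤ h ≤ K·H_q} λ*_b(H_q; q, n + qh) − C₃·(K+1)y| ≤ C·(K+1)y/(ln x)^{δ(1+ε)}. -/

import Mathlib

open scoped Classical

noncomputable def yy (δ x : ℝ) : ℕ := ⌈x * Real.log x ^ δ⌉₊

noncomputable def zz (δ x : ℝ) : ℝ :=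
  (yy δ x : ℝ) * Real.log (Real.log x) ^ 2 / Real.log x ^ (1/2 : ℝ)

noncomputable def primesUpTo (t : ℝ) : Finset ℕ :=
  (Finset.range (⌊t⌋₊ + 1)).filter fun p => p.Prime ∧ (p : ℝ) ≤ t

noncomputable def PP (t : ℝ) : ℕ := ∏ p ∈ primesUpTo t, p

noncomputable def sigUpTo (t : ℝ) : ℝ := ∏ p ∈ primesUpTo t, (1 - 1 / (p : ℝ))

noncomputable def primesBetween (w t : ℝ) : Finset ℕ :=
  (Finset.range (⌊t⌋₊ + 1)).filter fun p => p.Prime ∧ w < (p : ℝ) ∧ (p : ℝ) ≤ t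

noncomputable def sigBetween (w t : ℝ) : ℝ := ∏ p ∈ primesBetween w t, (1 - 1 / (p : ℝ))

def inS (t : ℝ) (b n : ℤ) : Prop :=
  ∀ p : ℕ, p.Prime → (p : ℝ) ≤ t → ¬ ((p : ℤ) ∣ (n - b))

def inSBetween (w t : ℝ) (b n : ℤ) : Prop :=
  ∀ p : ℕ, p.Prime → w < (p : ℝ) → (p : ℝ) ≤ t → ¬ ((p : ℤ) ∣ (n - b))

noncomputable def countS (t : ℝ) (b lo hi : ℤ) : ℕ :=
  ((Finset.Icc lo hi).filter (inS t b)).card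

noncomputable def EE (δ x : ℝ) (g : ℤ → ℝ) : ℝ :=
  (1 / (PP (zz δ x) : ℝ)) * ∑ b ∈ Finset.range (PP (zz δ x)), g (b : ℤ)

def frakH (δ ξ x : ℝ) : Set ℝ :=
  {H | ∃ j : ℕ, H = ξ ^ j ∧ 2 * (yy δ x : ℝ) / x ≤ H ∧ H ≤ (yy δ x : ℝ) / (ξ * zz δ x)}

def frakH1 (δ ξ x : ℝ) : Set ℝ :=
  {H | ∃ j : ℕ, Even j ∧ H = ξ ^ j ∧ 2 * (yy δ x : ℝ) / x ≤ H ∧ H ≤ (yy δ x : ℝ) / (ξ * zz δ x)}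

def frakH2 (δ ξ x : ℝ) : Set ℝ :=
  {H | ∃ j : ℕ, Odd j ∧ H = ξ ^ j ∧ 2 * (yy δ x : ℝ) / x ≤ H ∧ H ≤ (yy δ x : ℝ) / (ξ * zz δ x)}

noncomputable def QH (δ ξ x H : ℝ) : Finset ℕ :=
  (Finset.range (⌊(yy δ x : ℝ) / H⌋₊ + 1)).filter fun q =>
    q.Prime ∧ (yy δ x : ℝ) / (ξ * H) < (q : ℝ) ∧ (q : ℝ) ≤ (yy δ x : ℝ) / H

noncomputable def Hq (δ ξ x : ℝ) (q : ℕ) : ℝ :=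
  if h : ∃ H ∈ frakH δ ξ x, (yy δ x : ℝ) / (ξ * H) < (q : ℝ) ∧ (q : ℝ) ≤ (yy δ x : ℝ) / H
  then h.choose else 1

noncomputable def APset (M : ℝ) (K : ℕ) (b : ℤ) (H : ℝ) (q : ℕ) (n : ℤ) : Finset ℤ :=
  ((Finset.Icc 1 ⌊(K : ℝ) * H⌋₊).image fun h : ℕ => n + (q : ℤ) * (h : ℤ)).filter (inS (H ^ M) b)

noncomputable def lam (M zv : ℝ) (K : ℕ) (b : ℤ) (H : ℝ) (q : ℕ) (n : ℤ) : ℝ :=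
  if ∀ m ∈ APset M K b H q n, inSBetween (H ^ M) zv b m
  then sigBetween (H ^ M) zv ^ (-((APset M K b H q n).card : ℤ))
  else 0

noncomputable def APsetStar (M : ℝ) (K : ℕ) (N b : ℤ) (H : ℝ) (q : ℕ) (n : ℤ) : Finset ℤ :=
  ((Finset.Icc 1 ⌊(K : ℝ) * H⌋₊).image fun h : ℕ => n - (q : ℤ) * (h : ℤ)).filter (inS (H ^ M) (-N - b))

noncomputable def lamStar (M zv : ℝ) (K : ℕ) (N b : ℤ) (H : ℝ) (q : ℕ) (n : ℤ) : ℝ :=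
  if ∀ m ∈ APsetStar M K N b H q n, inSBetween (H ^ M) zv (-N - b) m
  then sigBetween (H ^ M) zv ^ (-((APsetStar M K N b H q n).card : ℤ))
  else 0

namespace SievedGaps
open Finset ArithmeticFunction

theorem exists_abs_sum_vonMangoldt_div_sub_log_le :
    ∃ C : ℝ, 0 < C ∧ ∀ N : ℕ, 1 ≤ N →
      |∑ n ∈ Ioc 0 N, vonMangoldt n / n - Real.log N| ≤ C := by
  refine ⟨Real.log 4 + 4, by positivity, fun N hN => ?_⟩
  have hN0 : (0 : ℝ) < N := by exact_mod_cast hN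
  have hfac : Real.log (N.factorial) = ∑ n ∈ Ioc 0 N, vonMangoldt n * ((N / n : ℕ) : ℝ) := by
    rw [← sum_Ioc_mul_zeta_eq_sum vonMangoldt N, vonMangoldt_mul_zeta,
      ← Finset.prod_range_add_one_eq_factorial, Nat.cast_prod, Real.log_prod]
    · clear hN hN0
      induction N with
      | zero => simp
      | succ k ih => rw [Finset.sum_Ioc_succ_top (by omega), Finset.sum_range_succ, ih]; simp
    · intro i _
      positivity
  have hpsi : ∑ n ∈ Ioc 0 N, vonMangoldt n ≤ (Real.log 4 + 4) * N := by
    have := Chebyshev.psi_le_const_mul_self (x := N) (by positivity)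
    simpa [Chebyshev.psi] using this
  have hup : Real.log (N.factorial) ≤ N * ∑ n ∈ Ioc 0 N, vonMangoldt n / n := by
    rw [hfac, mul_sum]
    refine sum_le_sum fun n hn => ?_
    have := Nat.cast_div_le (α := ℝ) (m := N) (n := n)
    calc vonMangoldt n * ((N / n : ℕ) : ℝ) ≤ vonMangoldt n * (N / n) :=
          mul_le_mul_of_nonneg_left this vonMangoldt_nonneg
      _ = _ := by ring
  have hlo : N * ∑ n ∈ Ioc 0 N, vonMangoldt n / n - ∑ n ∈ Ioc 0 N, vonMangoldt n
      ≤ Real.log (N.factorial) := by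
    rw [hfac, mul_sum, ← sum_sub_distrib]
    refine sum_le_sum fun n hn => ?_
    have h0 : 0 < n := (mem_Ioc.1 hn).1
    have : (N : ℝ) / n - 1 ≤ ((N / n : ℕ) : ℝ) := by
      have := Nat.lt_floor_add_one ((N : ℝ) / n)
      rw [Nat.floor_div_eq_div] at this
      linarith
    calc _ = vonMangoldt n * ((N : ℝ) / n - 1) := by ring
      _ ≤ _ := mul_le_mul_of_nonneg_left this vonMangoldt_nonneg
  have hst := Stirling.le_log_factorial_stirling (n := N) (by omega)
  have hle : Real.log (N.factorial) ≤ N * Real.log N := by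
    rw [← Real.log_pow]
    exact Real.log_le_log (by positivity) (by exact_mod_cast Nat.factorial_le_pow N)
  have h1 : 0 ≤ Real.log N := Real.log_nonneg (by exact_mod_cast hN)
  have h2 : 0 ≤ Real.log (2 * Real.pi) :=
    Real.log_nonneg (by nlinarith [Real.pi_gt_three])
  have h4 : 0 ≤ Real.log 4 := Real.log_nonneg (by norm_num)
  rw [abs_le]
  constructor
  · refine le_of_mul_le_mul_left ?_ hN0
    nlinarith
  · refine le_of_mul_le_mul_left ?_ hN0
    nlinarith

/-- First-order Euler–Maclaurin error on a unit interval. -/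
theorem norm_antideriv_sub_le {F f f' : ℝ → ℂ} {a b B : ℝ} (hab : a ≤ b)
    (hF : ∀ u ∈ Set.Icc a b, HasDerivAt F (f u) u)
    (hf : ∀ u ∈ Set.Icc a b, HasDerivAt f (f' u) u)
    (hB : ∀ u ∈ Set.Icc a b, ‖f' u‖ ≤ B) (hb : b ≤ a + 1) :
    ‖F b - F a - (b - a) * f a‖ ≤ B := by
  have hB0 : 0 ≤ B := (norm_nonneg _).trans (hB a ⟨le_rfl, hab⟩)
  have h1 : ∀ u ∈ Set.Icc a b, ‖f u - f a‖ ≤ B := by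
    intro u hu
    have := norm_image_sub_le_of_norm_deriv_le_segment' (f := f) (f' := f') (a := a) (b := b)
      (C := B) (fun v hv => (hf v hv).hasDerivWithinAt) (fun v hv => hB v ⟨hv.1, hv.2.le⟩) u hu
    refine this.trans ?_
    nlinarith [hu.1, hu.2]
  have := norm_image_sub_le_of_norm_deriv_le_segment' (f := fun u : ℝ => F u - (u - a) * f a)
    (f' := fun u => f u - f a) (a := a) (b := b)
      (C := B) (fun v hv => by
        have h2 : HasDerivAt (fun u : ℝ => ((u : ℂ) - a) * f a) (f a) v := by
          simpa using ((Complex.ofRealCLM.hasDerivAt (x := v)).sub_const (a : ℂ)).mul_const (f a)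
        exact ((hF v hv).sub h2).hasDerivWithinAt)
      (fun v hv => h1 v ⟨hv.1, hv.2.le⟩) b ⟨hab, le_rfl⟩
  have h3 : (F b - (b - a) * f a) - (F a - ((a : ℂ) - a) * f a) = F b - F a - (b - a) * f a := by
    ring
  rw [← h3]
  refine this.trans ?_
  nlinarith

/-- Summation by parts for a sequence with bounded partial sums. -/
theorem sum_Ioc_sub_mul_by_parts (E : ℕ → ℂ) (g : ℕ → ℝ) {m N : ℕ} (h : m < N) :
    ∑ n ∈ Ioc m N, (E n - E (n - 1)) * g n =
      E N * g N - E m * g (m + 1) - ∑ n ∈ Ico (m + 1) N, E n * ((g (n + 1) - g n : ℝ) : ℂ) := by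
  induction N, h using Nat.le_induction with
  | base => simp; ring
  | succ k hk ih =>
    rw [Finset.sum_Ioc_succ_top (by omega), ih, Finset.sum_Ico_succ_top (by omega)]
    simp only [Nat.add_sub_cancel, Complex.ofReal_sub]
    ring

theorem norm_sum_Ioc_sub_mul_le {E : ℕ → ℂ} {g : ℕ → ℝ} {m N : ℕ} {C : ℝ}
    (hE : ∀ n, m ≤ n → n ≤ N → ‖E n‖ ≤ C) (hmN : m ≤ N) (hg : ∀ n, m < n → n ≤ N → 0 ≤ g n) {B : ℝ}
    (hB : ∀ n, m < n → n ≤ N → g n ≤ B) (hB0 : 0 ≤ B)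
    (hmono : (∀ n, m < n → n < N → g n ≤ g (n + 1)) ∨ (∀ n, m < n → n < N → g (n + 1) ≤ g n)) :
    ‖∑ n ∈ Ioc m N, (E n - E (n - 1)) * g n‖ ≤ 3 * C * B := by
  have hC : 0 ≤ C := (norm_nonneg _).trans (hE m le_rfl hmN)
  rcases hmN.eq_or_lt with rfl | h
  · simp; positivity
  rw [sum_Ioc_sub_mul_by_parts E g h]
  have key : ∑ n ∈ Ico (m + 1) N, |g (n + 1) - g n| ≤ B := by
    rcases hmono with hm | hm
    · rw [Finset.sum_congr rfl (g := fun n => g (n + 1) - g n), Finset.sum_Ico_sub _ (by omega)]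
      · linarith [hB N h le_rfl, hg (m + 1) (by omega) (by omega)]
      · intro n hn
        rw [mem_Ico] at hn
        exact abs_of_nonneg (by linarith [hm n (by omega) (by omega)])
    · rw [Finset.sum_congr rfl (g := fun n => -(g (n + 1) - g n)), Finset.sum_neg_distrib,
        Finset.sum_Ico_sub _ (by omega)]
      · linarith [hB (m + 1) (by omega) (by omega), hg N h le_rfl]
      · intro n hn
        rw [mem_Ico] at hn
        exact abs_of_nonpos (by linarith [hm n (by omega) (by omega)])
  have h1 : ‖E N * g N‖ ≤ C * B := by
    rw [norm_mul, Complex.norm_real, Real.norm_of_nonneg (hg N h le_rfl)]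
    exact mul_le_mul (hE N hmN le_rfl) (hB N h le_rfl) (hg N h le_rfl) hC
  have h2 : ‖E m * g (m + 1)‖ ≤ C * B := by
    have := hg (m + 1) (by omega) (by omega)
    rw [norm_mul, Complex.norm_real, Real.norm_of_nonneg this]
    exact mul_le_mul (hE m le_rfl hmN) (hB _ (by omega) (by omega)) this hC
  have h3 : ‖∑ n ∈ Ico (m + 1) N, E n * ((g (n + 1) - g n : ℝ) : ℂ)‖ ≤ C * B := by
    refine (norm_sum_le _ _).trans (le_trans ?_ (mul_le_mul_of_nonneg_left key hC))
    rw [mul_sum]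
    refine sum_le_sum fun n hn => ?_
    rw [mem_Ico] at hn
    rw [norm_mul, Complex.norm_real, Real.norm_eq_abs]
    exact mul_le_mul_of_nonneg_right (hE n (by omega) (by omega)) (abs_nonneg _)
  calc _ ≤ _ := norm_sub_le _ _
    _ ≤ _ := add_le_add_left (norm_sub_le _ _) _
    _ ≤ _ := by linarith

theorem norm_sub_le_sum_of_norm_succ_sub_le {B : ℕ → ℂ} {a : ℕ → ℝ} {m N : ℕ} (h : m ≤ N)
    (hB : ∀ n, m ≤ n → n < N → ‖B (n + 1) - B n‖ ≤ a n) :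
    ‖B N - B m‖ ≤ ∑ n ∈ Ico m N, a n := by
  rw [← Finset.sum_Ico_sub B h]
  exact (norm_sum_le _ _).trans
    (sum_le_sum fun n hn => hB n (mem_Ico.1 hn).1 (mem_Ico.1 hn).2)

theorem sum_Ico_one_div_sq_le {m N : ℕ} (hm : 1 ≤ m) :
    ∑ n ∈ Ico m N, 1 / (n : ℝ) ^ 2 ≤ 2 / (m : ℝ) := by
  obtain ⟨k, rfl⟩ : ∃ k, m = k + 1 := ⟨m - 1, by omega⟩
  have := sum_Ioo_inv_sq_le (α := ℝ) k N
  have h2 : Ico (k + 1) N = Ioo k N := by ext; simp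
  rw [h2]
  simpa [one_div] using this

/-- Derivative bound for the summand `u ↦ u ^ (-s)`. -/
theorem norm_cpow_step_le {s : ℂ} (hs : 1 ≤ s.re) (hs1 : s ≠ 1) {a b : ℝ} (ha : 1 ≤ a)
    (hab : a ≤ b) (hb : b ≤ a + 1) :
    ‖(b : ℂ) ^ (1 - s) / (1 - s) - (a : ℂ) ^ (1 - s) / (1 - s) - (b - a) * (a : ℂ) ^ (-s)‖ ≤
      ‖s‖ / a ^ 2 := by
  refine norm_antideriv_sub_le (F := fun u : ℝ => (u : ℂ) ^ (1 - s) / (1 - s))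
    (f := fun u : ℝ => (u : ℂ) ^ (-s)) (f' := fun u : ℝ => -s * (u : ℂ) ^ (-s - 1)) hab
    ?_ ?_ ?_ hb
  · intro u hu
    have hu0 : u ≠ 0 := by linarith [hu.1]
    have := hasDerivAt_ofReal_cpow_const' (x := u) hu0 (r := -s) (by simpa using hs1)
    have h2 : -s + 1 = 1 - s := by ring
    rwa [h2] at this
  · intro u hu
    have hu0 : u ≠ 0 := by linarith [hu.1]
    exact hasDerivAt_ofReal_cpow_const hu0 (by
      intro h
      rw [neg_eq_zero] at h
      rw [h] at hs
      norm_num at hs)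
  · intro u hu
    have hu0 : 0 < u := by linarith [hu.1]
    rw [norm_mul, norm_neg, Complex.norm_cpow_eq_rpow_re_of_pos hu0, div_eq_mul_inv]
    refine mul_le_mul_of_nonneg_left ?_ (norm_nonneg _)
    calc u ^ (-s - 1).re ≤ u ^ (-2 : ℝ) := by
          refine Real.rpow_le_rpow_of_exponent_le (by linarith [hu.1]) ?_
          simp; linarith
      _ = (u ^ 2)⁻¹ := by rw [Real.rpow_neg hu0.le]; norm_cast
      _ ≤ _ := by
          gcongr
          exact hu.1

theorem norm_riemannZeta_sub_partial_le_of_one_lt {s : ℂ} (hs : 1 < s.re) {N : ℕ} (hN : 1 ≤ N) :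
    ‖riemannZeta s - (∑ m ∈ Ico 1 N, (m : ℂ) ^ (-s) - (N : ℂ) ^ (1 - s) / (1 - s))‖ ≤
      2 * ‖s‖ / N := by
  have hs1 : s ≠ 1 := by rintro rfl; simp at hs
  set B : ℕ → ℂ := fun N => ∑ m ∈ Ico 1 N, (m : ℂ) ^ (-s) - (N : ℂ) ^ (1 - s) / (1 - s) with hB
  have hlim : Filter.Tendsto B Filter.atTop (nhds (riemannZeta s)) := by
    have h1 : Filter.Tendsto (fun N : ℕ => ∑ m ∈ Ico 1 N, (m : ℂ) ^ (-s)) Filter.atTop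
        (nhds (riemannZeta s)) := by
      rw [zeta_eq_tsum_one_div_nat_cpow hs]
      have := (Complex.summable_one_div_nat_cpow.2 hs).hasSum.tendsto_sum_nat
      refine this.congr' ?_
      filter_upwards [Filter.eventually_ge_atTop 1] with N hN
      rw [Finset.range_eq_Ico, Finset.sum_eq_sum_Ico_succ_bot (by omega)]
      have h0 : s ≠ 0 := by rintro rfl; simp at hs; linarith
      simp [Complex.cpow_neg, Complex.zero_cpow h0]
    have h2 : Filter.Tendsto (fun N : ℕ => (N : ℂ) ^ (1 - s) / (1 - s)) Filter.atTop (nhds 0) := by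
      rw [tendsto_zero_iff_norm_tendsto_zero]
      have h3 : Filter.Tendsto (fun N : ℕ => (N : ℝ) ^ (-(s.re - 1)) / ‖1 - s‖) Filter.atTop
          (nhds (0 / ‖1 - s‖)) := by
        refine Filter.Tendsto.div_const ?_ _
        exact (tendsto_rpow_neg_atTop (by linarith)).comp tendsto_natCast_atTop_atTop
      rw [zero_div] at h3
      refine h3.congr' ?_
      filter_upwards [Filter.eventually_ge_atTop 1] with N hN
      rw [norm_div, ← Complex.ofReal_natCast, Complex.norm_cpow_eq_rpow_re_of_pos (by
        exact_mod_cast hN)]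
      simp
    simpa using h1.sub h2
  have hstep : ∀ n, 1 ≤ n → ‖B (n + 1) - B n‖ ≤ ‖s‖ * (1 / (n : ℝ) ^ 2) := by
    intro n hn
    have := norm_cpow_step_le hs.le hs1 (a := n) (b := n + 1) (by exact_mod_cast hn) (by simp)
      le_rfl
    have e : B (n + 1) - B n = -(((n + 1 : ℝ) : ℂ) ^ (1 - s) / (1 - s) -
        ((n : ℝ) : ℂ) ^ (1 - s) / (1 - s) -
          (((n + 1 : ℝ) : ℂ) - (n : ℝ)) * ((n : ℝ) : ℂ) ^ (-s)) := by
      rw [hB]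
      dsimp only
      rw [Finset.sum_Ico_succ_top hn]
      push_cast
      ring
    rwa [mul_one_div, e, norm_neg]
  have hbd : ∀ᶠ N' in Filter.atTop, ‖B N' - B N‖ ≤ 2 * ‖s‖ / N := by
    filter_upwards [Filter.eventually_ge_atTop N] with N' hN'
    refine (norm_sub_le_sum_of_norm_succ_sub_le hN' fun n h1 _ => hstep n (by omega)).trans ?_
    rw [← mul_sum]
    calc _ ≤ ‖s‖ * (2 / N) := mul_le_mul_of_nonneg_left (sum_Ico_one_div_sq_le hN) (norm_nonneg _)
      _ = _ := by ring
  exact le_of_tendsto ((hlim.sub_const (B N)).norm) hbd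

theorem norm_riemannZeta_sub_partial_le {s : ℂ} (hs : 1 ≤ s.re) (hs1 : s ≠ 1) {N : ℕ}
    (hN : 1 ≤ N) :
    ‖riemannZeta s - (∑ m ∈ Ico 1 N, (m : ℂ) ^ (-s) - (N : ℂ) ^ (1 - s) / (1 - s))‖ ≤
      2 * ‖s‖ / N := by
  set φ : ℂ → ℝ := fun s =>
    ‖riemannZeta s - (∑ m ∈ Ico 1 N, (m : ℂ) ^ (-s) - (N : ℂ) ^ (1 - s) / (1 - s))‖ -
      2 * ‖s‖ / N with hφ
  suffices h : φ s ≤ 0 by simpa [hφ] using h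
  have hc : ContinuousAt φ s := by
    have h1 := (differentiableAt_riemannZeta hs1).continuousAt
    have h2 : ContinuousAt (fun s : ℂ => ∑ m ∈ Ico 1 N, (m : ℂ) ^ (-s)) s := by
      refine tendsto_finsetSum _ fun m hm => ?_
      have : (m : ℂ) ≠ 0 := by have := (mem_Ico.1 hm).1; norm_cast; omega
      exact continuousAt_neg.const_cpow (Or.inl this)
    have h3 : ContinuousAt (fun s : ℂ => (N : ℂ) ^ (1 - s) / (1 - s)) s := by
      have : (N : ℂ) ≠ 0 := by norm_cast; omega
      refine ContinuousAt.div ?_ (by fun_prop) (sub_ne_zero.2 hs1.symm)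
      exact ContinuousAt.const_cpow (by fun_prop) (Or.inl this)
    exact ((h1.sub (h2.sub h3)).norm).sub (by fun_prop)
  have hc2 : Filter.Tendsto (fun e : ℝ => φ (s + e)) (nhdsWithin 0 (Set.Ioi 0)) (nhds (φ s)) := by
    have h4 : Filter.Tendsto (fun e : ℝ => s + (e : ℂ)) (nhdsWithin 0 (Set.Ioi 0)) (nhds s) := by
      have : Filter.Tendsto (fun e : ℝ => s + (e : ℂ)) (nhds 0) (nhds (s + ((0 : ℝ) : ℂ))) :=
        (Continuous.tendsto (by fun_prop) 0)
      simp only [Complex.ofReal_zero, add_zero] at this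
      exact this.mono_left nhdsWithin_le_nhds
    exact hc.tendsto.comp h4
  refine le_of_tendsto hc2 ?_
  filter_upwards [self_mem_nhdsWithin] with e he
  have he : 0 < e := he
  have := norm_riemannZeta_sub_partial_le_of_one_lt (s := s + e) (by simp; linarith) hN
  simp only [hφ]
  linarith

theorem norm_sum_cpow_sub_le {s : ℂ} (hs : 1 ≤ s.re) (hs1 : s ≠ 1) {b : ℝ} (hb : 1 ≤ b) :
    ‖∑ m ∈ Ioc 0 ⌊b⌋₊, (m : ℂ) ^ (-s) - (riemannZeta s + (b : ℂ) ^ (1 - s) / (1 - s))‖ ≤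
      (6 * ‖s‖ + 4) / b := by
  set N := ⌊b⌋₊ with hNdef
  have hN : 1 ≤ N := Nat.le_floor (by simpa using hb)
  have hNb : (N : ℝ) ≤ b := Nat.floor_le (by linarith)
  have hbN : b ≤ N + 1 := (Nat.lt_floor_add_one b).le
  have hN1 : (1 : ℝ) ≤ N := by exact_mod_cast hN
  have h1 := norm_riemannZeta_sub_partial_le hs hs1 hN
  have h2 := norm_cpow_step_le hs hs1 (a := N) (b := b) hN1 hNb hbN
  have h3 : ‖(N : ℂ) ^ (-s)‖ ≤ 1 / N := by
    rw [← Complex.ofReal_natCast, Complex.norm_cpow_eq_rpow_re_of_pos (by linarith)]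
    rw [one_div, ← Real.rpow_neg_one]
    exact Real.rpow_le_rpow_of_exponent_le hN1 (by simpa using hs)
  have h4 : ∑ m ∈ Ioc 0 N, (m : ℂ) ^ (-s) = ∑ m ∈ Ico 1 N, (m : ℂ) ^ (-s) + (N : ℂ) ^ (-s) := by
    rw [← Finset.sum_Ico_succ_top hN]
    refine sum_congr ?_ fun _ _ => rfl
    ext; simp; omega
  have h5 : ‖((b : ℂ) - N - 1) * (N : ℂ) ^ (-s)‖ ≤ 1 / N := by
    rw [norm_mul]
    have : ‖((b : ℂ) - N - 1)‖ ≤ 1 := by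
      rw [show ((b : ℂ) - N - 1) = ((b - N - 1 : ℝ) : ℂ) by push_cast; ring, Complex.norm_real,
        Real.norm_eq_abs, abs_le]
      constructor <;> linarith
    calc _ ≤ 1 * (1 / (N : ℝ)) := mul_le_mul this h3 (norm_nonneg _) zero_le_one
      _ = _ := one_mul _
  have h6 : ∑ m ∈ Ioc 0 N, (m : ℂ) ^ (-s) - (riemannZeta s + (b : ℂ) ^ (1 - s) / (1 - s)) =
      -(riemannZeta s - (∑ m ∈ Ico 1 N, (m : ℂ) ^ (-s) - (N : ℂ) ^ (1 - s) / (1 - s)))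
      - ((b : ℂ) ^ (1 - s) / (1 - s) - ((N : ℝ) : ℂ) ^ (1 - s) / (1 - s)
          - (b - (N : ℝ)) * ((N : ℝ) : ℂ) ^ (-s))
      - ((b : ℂ) - N - 1) * (N : ℂ) ^ (-s) := by
    rw [h4]; push_cast; ring
  rw [h6]
  have h7 : ‖s‖ / (N : ℝ) ^ 2 ≤ ‖s‖ / N := by
    gcongr
    nlinarith
  have h8 : (3 * ‖s‖ + 1) / (N : ℝ) ≤ (6 * ‖s‖ + 4) / b := by
    rw [div_le_div_iff₀ (by linarith) (by linarith)]
    have := norm_nonneg s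
    nlinarith
  calc _ ≤ 2 * ‖s‖ / N + ‖s‖ / N + 1 / N := by
        refine (norm_sub_le _ _).trans (add_le_add ((norm_sub_le _ _).trans (add_le_add ?_ ?_)) h5)
        · rwa [norm_neg]
        · exact h2.trans h7
    _ = (3 * ‖s‖ + 1) / (N : ℝ) := by ring
    _ ≤ _ := h8

theorem norm_log_cpow_step_le {s : ℂ} (hs : s.re = 1) (hs1 : s ≠ 1) {a : ℝ} (ha : 1 ≤ a) :
    ‖((a + 1 : ℝ) : ℂ) ^ (1 - s) / (1 - s) * (Real.log (a + 1) - 1 / (1 - s)) -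
      (a : ℂ) ^ (1 - s) / (1 - s) * (Real.log a - 1 / (1 - s)) - Real.log a * (a : ℂ) ^ (-s)‖ ≤
      (1 + 2 * ‖s‖) * a ^ (-(3 / 2) : ℝ) := by
  have hs1' : (1 - s) ≠ 0 := sub_ne_zero.2 hs1.symm
  have := norm_antideriv_sub_le
    (F := fun u : ℝ => (u : ℂ) ^ (1 - s) / (1 - s) * (Real.log u - 1 / (1 - s)))
    (f := fun u : ℝ => (u : ℂ) ^ (-s) * Real.log u)
    (f' := fun u : ℝ => -s * (u : ℂ) ^ (-s - 1) * Real.log u + (u : ℂ) ^ (-s) * (u⁻¹ : ℝ))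
    (a := a) (b := a + 1) (B := (1 + 2 * ‖s‖) * a ^ (-(3 / 2) : ℝ)) (by linarith) ?_ ?_ ?_ le_rfl
  · convert this using 2
    push_cast
    ring
  · intro u hu
    have hu0 : u ≠ 0 := by linarith [hu.1]
    have h1 := hasDerivAt_ofReal_cpow_const' (x := u) hu0 (r := -s) (by simpa using hs1)
    have h2 : -s + 1 = 1 - s := by ring
    rw [h2] at h1
    have h3 := ((Real.hasDerivAt_log hu0).ofReal_comp).sub_const (1 / (1 - s))
    refine (h1.mul h3).congr_deriv ?_
    have h4 : (u : ℂ) ^ (1 - s) = u * (u : ℂ) ^ (-s) := by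
      rw [sub_eq_add_neg, Complex.cpow_add _ _ (by exact_mod_cast hu0), Complex.cpow_one]
    rw [h4]
    have hu0' : (u : ℂ) ≠ 0 := by exact_mod_cast hu0
    push_cast
    field_simp
    ring
  · intro u hu
    have hu0 : u ≠ 0 := by linarith [hu.1]
    have h1 := hasDerivAt_ofReal_cpow_const hu0 (r := -s) (by
      intro h
      rw [neg_eq_zero] at h
      rw [h] at hs
      norm_num at hs)
    exact h1.mul ((Real.hasDerivAt_log hu0).ofReal_comp)
  · intro u hu
    have hu1 : 1 ≤ u := ha.trans hu.1
    have hu0 : 0 < u := by linarith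
    have hl : Real.log u ≤ 2 * u ^ (1 / 2 : ℝ) := by
      have := Real.log_le_rpow_div hu0.le (ε := 1 / 2) (by norm_num)
      linarith
    have hl0 := Real.log_nonneg hu1
    have e1 : ‖(u : ℂ) ^ (-s - 1)‖ = u ^ (-2 : ℝ) := by
      rw [Complex.norm_cpow_eq_rpow_re_of_pos hu0]; simp [hs]; norm_num
    have e2 : ‖(u : ℂ) ^ (-s)‖ = u ^ (-1 : ℝ) := by
      rw [Complex.norm_cpow_eq_rpow_re_of_pos hu0]; simp [hs]
    have e3 : u ^ (-2 : ℝ) * u ^ (1 / 2 : ℝ) = u ^ (-(3 / 2) : ℝ) := by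
      rw [← Real.rpow_add hu0]; norm_num
    have e4 : u ^ (-1 : ℝ) * u⁻¹ ≤ u ^ (-(3 / 2) : ℝ) := by
      rw [← Real.rpow_neg_one, ← Real.rpow_add hu0]
      exact Real.rpow_le_rpow_of_exponent_le hu1 (by norm_num)
    have e5 : u ^ (-(3 / 2) : ℝ) ≤ a ^ (-(3 / 2) : ℝ) :=
      Real.rpow_le_rpow_of_nonpos (by linarith) hu.1 (by norm_num)
    calc _ ≤ ‖s‖ * u ^ (-2 : ℝ) * (2 * u ^ (1 / 2 : ℝ)) + u ^ (-1 : ℝ) * u⁻¹ := by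
          refine (norm_add_le _ _).trans (add_le_add ?_ ?_)
          · rw [norm_mul, norm_mul, norm_neg, e1, Complex.norm_real, Real.norm_of_nonneg hl0]
            gcongr
          · rw [norm_mul, e2, Complex.norm_real, Real.norm_of_nonneg (by positivity)]
      _ = 2 * ‖s‖ * (u ^ (-2 : ℝ) * u ^ (1 / 2 : ℝ)) + u ^ (-1 : ℝ) * u⁻¹ := by ring
      _ ≤ 2 * ‖s‖ * a ^ (-(3 / 2) : ℝ) + a ^ (-(3 / 2) : ℝ) := by
          rw [e3]
          gcongr
          exact e4.trans e5
      _ = _ := by ring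

theorem exists_norm_sum_log_cpow_sub_le {s : ℂ} (hs : s.re = 1) (hs1 : s ≠ 1) :
    ∃ C : ℝ, ∀ N : ℕ, 1 ≤ N →
      ‖∑ m ∈ Ioc 0 N, Real.log m * (m : ℂ) ^ (-s) -
        (N : ℂ) ^ (1 - s) / (1 - s) * (Real.log N - 1 / (1 - s))‖ ≤ C := by
  set B : ℕ → ℂ := fun N => ∑ m ∈ Ico 1 N, Real.log m * (m : ℂ) ^ (-s) -
        (N : ℂ) ^ (1 - s) / (1 - s) * (Real.log N - 1 / (1 - s)) with hB
  have hsum : Summable (fun n : ℕ => (n : ℝ) ^ (-(3 / 2) : ℝ)) :=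
    Real.summable_nat_rpow.2 (by norm_num)
  set Z := ∑' n : ℕ, (n : ℝ) ^ (-(3 / 2) : ℝ)
  refine ⟨‖B 1‖ + (1 + 2 * ‖s‖) * Z + 1, fun N hN => ?_⟩
  have hstep : ∀ n, 1 ≤ n → ‖B (n + 1) - B n‖ ≤ (1 + 2 * ‖s‖) * (n : ℝ) ^ (-(3 / 2) : ℝ) := by
    intro n hn
    have := norm_log_cpow_step_le hs hs1 (a := n) (by exact_mod_cast hn)
    rw [← norm_neg] at this
    refine le_of_eq_of_le (congrArg _ ?_) this
    rw [hB]
    dsimp only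
    rw [Finset.sum_Ico_succ_top hn]
    push_cast
    ring
  have h1 : ‖B N - B 1‖ ≤ (1 + 2 * ‖s‖) * Z := by
    refine (norm_sub_le_sum_of_norm_succ_sub_le hN fun n h1 _ => hstep n h1).trans ?_
    rw [← mul_sum]
    refine mul_le_mul_of_nonneg_left ?_ (by positivity)
    exact hsum.sum_le_tsum _ fun _ _ => by positivity
  have hN1 : (1 : ℝ) ≤ N := by exact_mod_cast hN
  have h2 : ‖Real.log N * (N : ℂ) ^ (-s)‖ ≤ 1 := by
    rw [norm_mul, ← Complex.ofReal_natCast N, Complex.norm_cpow_eq_rpow_re_of_pos (by linarith),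
      Complex.norm_real, Real.norm_of_nonneg (Real.log_nonneg hN1), Complex.neg_re, hs,
      Real.rpow_neg_one, ← div_eq_mul_inv, div_le_one (by linarith)]
    exact (Real.log_le_sub_one_of_pos (by linarith)).trans (by linarith)
  have h4 : ∑ m ∈ Ioc 0 N, Real.log m * (m : ℂ) ^ (-s) -
        (N : ℂ) ^ (1 - s) / (1 - s) * (Real.log N - 1 / (1 - s)) =
      B 1 + (B N - B 1) + Real.log N * (N : ℂ) ^ (-s) := by
    have : ∑ m ∈ Ioc 0 N, Real.log m * (m : ℂ) ^ (-s) =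
        ∑ m ∈ Ico 1 N, Real.log m * (m : ℂ) ^ (-s) + Real.log N * (N : ℂ) ^ (-s) := by
      rw [← Finset.sum_Ico_succ_top hN (fun m : ℕ => (Real.log m : ℂ) * (m : ℂ) ^ (-s))]
      refine sum_congr ?_ fun _ _ => rfl
      ext; simp; omega
    rw [this, hB]
    ring
  rw [h4]
  exact (norm_add_le _ _).trans (add_le_add ((norm_add_le _ _).trans (add_le_add le_rfl h1)) h2)

theorem sum_log_cpow_eq (s : ℂ) (N : ℕ) :
    ∑ m ∈ Ioc 0 N, Real.log m * (m : ℂ) ^ (-s) =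
      ∑ d ∈ Ioc 0 N, (vonMangoldt d : ℂ) * (d : ℂ) ^ (-s) *
        ∑ m ∈ Ioc 0 (N / d), (m : ℂ) ^ (-s) := by
  let f : ArithmeticFunction ℂ := ⟨fun n => (vonMangoldt n : ℂ) * (n : ℂ) ^ (-s), by simp⟩
  let g : ArithmeticFunction ℂ := ⟨fun n => if n = 0 then 0 else (n : ℂ) ^ (-s), by simp⟩
  have h := sum_Ioc_mul_eq_sum_sum f g N
  have e1 : ∑ m ∈ Ioc 0 N, Real.log m * (m : ℂ) ^ (-s) = ∑ n ∈ Ioc 0 N, (f * g) n := by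
    refine sum_congr rfl fun n hn => ?_
    rw [mul_apply, ← vonMangoldt_sum, Complex.ofReal_sum, sum_mul,
      Nat.sum_divisorsAntidiagonal (fun i j => f i * g j)]
    refine sum_congr rfl fun d hd => ?_
    have hdn := Nat.dvd_of_mem_divisors hd
    have hn0 : 0 < n := (mem_Ioc.1 hn).1
    have hne : n / d ≠ 0 := (Nat.div_pos (Nat.le_of_dvd hn0 hdn) (Nat.pos_of_dvd_of_pos hdn hn0)).ne'
    simp only [f, g, coe_mk, hne, if_false]
    rw [mul_assoc, ← Complex.natCast_mul_natCast_cpow, ← Nat.cast_mul, Nat.mul_div_cancel' hdn]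
  rw [e1, h]
  refine sum_congr rfl fun d hd => ?_
  simp only [f, coe_mk]
  congr 1
  refine sum_congr rfl fun m hm => ?_
  have : m ≠ 0 := by have := (mem_Ioc.1 hm).1; omega
  simp [g, this]

theorem exists_norm_sum_vonMangoldt_cpow_le {s : ℂ} (hs : s.re = 1) (hs1 : s ≠ 1) :
    ∃ C : ℝ, ∀ N : ℕ, ‖∑ n ∈ Ioc 0 N, (vonMangoldt n : ℂ) * (n : ℂ) ^ (-s)‖ ≤ C := by
  obtain ⟨C₁, hC₁⟩ := exists_norm_sum_log_cpow_sub_le hs hs1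
  obtain ⟨C₂, hC₂0, hC₂⟩ := exists_abs_sum_vonMangoldt_div_sub_log_le
  have hz : riemannZeta s ≠ 0 := riemannZeta_ne_zero_of_one_le_re hs.ge
  have hz0 : 0 < ‖riemannZeta s‖ := norm_pos_iff.2 hz
  have hs1' : (1 - s) ≠ 0 := sub_ne_zero.2 hs1.symm
  set A := (6 * ‖s‖ + 4) * (Real.log 4 + 4)
  have hlog4 : 0 ≤ Real.log 4 := Real.log_nonneg (by norm_num)
  have hA : 0 ≤ A := by positivity
  set D := C₁ + A + C₂ / ‖1 - s‖ + 1 / ‖1 - s‖ ^ 2 with hD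
  have hC₁0 : 0 ≤ C₁ := (norm_nonneg _).trans (hC₁ 1 le_rfl)
  refine ⟨D / ‖riemannZeta s‖, fun N => ?_⟩
  rcases Nat.eq_zero_or_pos N with rfl | hN
  · simp; positivity
  have hN0 : (0 : ℝ) < N := by exact_mod_cast hN
  rw [le_div_iff₀ hz0, ← norm_mul]
  set S := ∑ n ∈ Ioc 0 N, (vonMangoldt n : ℂ) * (n : ℂ) ^ (-s)
  set P : ℂ := (N : ℂ) ^ (1 - s) / (1 - s)
  have hNs : ‖(N : ℂ) ^ (1 - s)‖ = 1 := by
    rw [← Complex.ofReal_natCast, Complex.norm_cpow_eq_rpow_re_of_pos hN0]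
    simp [hs]
  have hP : ‖P‖ = 1 / ‖1 - s‖ := by rw [norm_div, hNs]
  have hpsi : ∑ n ∈ Ioc 0 N, vonMangoldt n ≤ (Real.log 4 + 4) * N := by
    have := Chebyshev.psi_le_const_mul_self (x := N) (by positivity)
    simpa [Chebyshev.psi] using this
  have key : ‖∑ m ∈ Ioc 0 N, Real.log m * (m : ℂ) ^ (-s) -
      (S * riemannZeta s + P * (∑ n ∈ Ioc 0 N, vonMangoldt n / n : ℝ))‖ ≤ A := by
    rw [sum_log_cpow_eq, sum_mul, Complex.ofReal_sum, mul_sum, ← sum_add_distrib,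
      ← sum_sub_distrib]
    refine (norm_sum_le _ _).trans ?_
    have : ∀ d ∈ Ioc 0 N, ‖(vonMangoldt d : ℂ) * (d : ℂ) ^ (-s) *
        ∑ m ∈ Ioc 0 (N / d), (m : ℂ) ^ (-s) -
        ((vonMangoldt d : ℂ) * (d : ℂ) ^ (-s) * riemannZeta s +
          P * ((vonMangoldt d / d : ℝ) : ℂ))‖ ≤ vonMangoldt d * ((6 * ‖s‖ + 4) / N) := by
      intro d hd
      obtain ⟨hd0, hdN⟩ := mem_Ioc.1 hd
      have hd0' : (0 : ℝ) < d := by exact_mod_cast hd0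
      have hb := norm_sum_cpow_sub_le hs.ge hs1 (b := (N : ℝ) / d) (by
        rw [le_div_iff₀ hd0']; simpa using hdN)
      rw [Nat.floor_div_natCast, Nat.floor_natCast] at hb
      have hsplit : (((N : ℝ) / d : ℝ) : ℂ) ^ (1 - s) = (N : ℂ) ^ (1 - s) * ((d : ℂ)⁻¹ * (d : ℂ) ^ s) := by
        rw [Complex.ofReal_div, div_eq_mul_inv, ← Complex.ofReal_inv,
          Complex.mul_cpow_ofReal_nonneg hN0.le (by positivity)]
        congr 1
        have hd0'' : (d : ℂ) ≠ 0 := by exact_mod_cast hd0'.ne'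
        rw [Complex.cpow_sub _ _ (by simpa using hd0'.ne'), Complex.cpow_one, Complex.ofReal_inv,
          Complex.ofReal_natCast, div_eq_mul_inv, Complex.inv_cpow, inv_inv]
        rw [Complex.natCast_arg]
        exact Real.pi_pos.ne
      have hds : (d : ℂ) ^ (-s) * (d : ℂ) ^ s = 1 := by
        rw [← Complex.cpow_add _ _ (by exact_mod_cast hd0'.ne')]; simp
      have hnorm : ‖(d : ℂ) ^ (-s)‖ = 1 / d := by
        rw [← Complex.ofReal_natCast, Complex.norm_cpow_eq_rpow_re_of_pos hd0', Complex.neg_re, hs,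
          Real.rpow_neg_one, one_div]
      have e : (vonMangoldt d : ℂ) * (d : ℂ) ^ (-s) * ∑ m ∈ Ioc 0 (N / d), (m : ℂ) ^ (-s) -
          ((vonMangoldt d : ℂ) * (d : ℂ) ^ (-s) * riemannZeta s +
          P * ((vonMangoldt d / d : ℝ) : ℂ)) = (vonMangoldt d : ℂ) * (d : ℂ) ^ (-s) *
          (∑ m ∈ Ioc 0 (N / d), (m : ℂ) ^ (-s) -
            (riemannZeta s + (((N : ℝ) / d : ℝ) : ℂ) ^ (1 - s) / (1 - s))) := by
        rw [hsplit]
        have : P * ((vonMangoldt d / d : ℝ) : ℂ) =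
          (vonMangoldt d : ℂ) * ((d : ℂ) ^ (-s) * (d : ℂ) ^ s) * ((N : ℂ) ^ (1 - s) * (d : ℂ)⁻¹) / (1 - s) := by
          rw [hds]; push_cast; simp only [P]; ring
        rw [this]; ring
      rw [e, norm_mul, norm_mul, hnorm, Complex.norm_real,
        Real.norm_of_nonneg vonMangoldt_nonneg, mul_assoc]
      refine mul_le_mul_of_nonneg_left ?_ vonMangoldt_nonneg
      calc _ ≤ 1 / (d : ℝ) * ((6 * ‖s‖ + 4) / (N / d)) := by gcongr
        _ = _ := by field_simp
    refine (sum_le_sum this).trans ?_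
    rw [← sum_mul]
    calc _ ≤ (Real.log 4 + 4) * N * ((6 * ‖s‖ + 4) / N) := by gcongr
      _ = A := by simp only [A]; field_simp
  have h1 := hC₁ N hN
  have h2 : ‖P * ((Real.log N - ∑ n ∈ Ioc 0 N, vonMangoldt n / n : ℝ) : ℂ)‖ ≤ C₂ / ‖1 - s‖ := by
    rw [norm_mul, hP, Complex.norm_real, Real.norm_eq_abs, abs_sub_comm]
    calc _ ≤ 1 / ‖1 - s‖ * C₂ := by gcongr; exact hC₂ N hN
      _ = _ := by ring
  have h3 : ‖P * (1 / (1 - s))‖ ≤ 1 / ‖1 - s‖ ^ 2 := by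
    rw [norm_mul, hP, norm_div, norm_one]; apply le_of_eq; ring
  have e : S * riemannZeta s =
      (∑ m ∈ Ioc 0 N, Real.log m * (m : ℂ) ^ (-s) - P * (Real.log N - 1 / (1 - s))) -
      (∑ m ∈ Ioc 0 N, Real.log m * (m : ℂ) ^ (-s) -
      (S * riemannZeta s + P * (∑ n ∈ Ioc 0 N, vonMangoldt n / n : ℝ))) +
      P * ((Real.log N - ∑ n ∈ Ioc 0 N, vonMangoldt n / n : ℝ) : ℂ) - P * (1 / (1 - s)) := by
    push_cast; ring
  rw [e]
  exact (norm_sub_le _ _).trans (add_le_add ((norm_add_le _ _).trans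
    (add_le_add ((norm_sub_le _ _).trans (add_le_add h1 key)) h2)) h3)

/-- `log n / n` on primes, zero elsewhere. -/
noncomputable def primeWeight (n : ℕ) : ℝ := if n.Prime then Real.log n / n else 0

theorem primeWeight_nonneg (n : ℕ) : 0 ≤ primeWeight n := by
  unfold primeWeight; split_ifs
  · positivity
  · exact le_rfl

theorem primeWeight_le (n : ℕ) : primeWeight n ≤ vonMangoldt n / n := by
  unfold primeWeight; split_ifs with h
  · rw [vonMangoldt_apply_prime h]
  · exact div_nonneg vonMangoldt_nonneg (by positivity)

theorem sum_Ioc_div_eq (d : ℕ → ℝ) (N : ℕ) :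
    ∑ n ∈ Ioc 0 N, d n / n = (∑ n ∈ Ioc 0 N, d n) / (N + 1) +
      ∑ n ∈ Ioc 0 N, (∑ k ∈ Ioc 0 n, d k) / (n * (n + 1)) := by
  induction N with
  | zero => simp
  | succ N ih =>
    rw [Finset.sum_Ioc_succ_top (by omega), ih, Finset.sum_Ioc_succ_top (by omega),
      Finset.sum_Ioc_succ_top (by omega), Finset.sum_Ioc_succ_top (by omega)]
    have : (N : ℝ) + 1 ≠ 0 := by positivity
    have : (N : ℝ) + 1 + 1 ≠ 0 := by positivity
    push_cast
    field_simp
    ring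

theorem exists_sum_vonMangoldt_sub_primeWeight_le :
    ∃ C : ℝ, 0 ≤ C ∧ ∀ N : ℕ, ∑ n ∈ Ioc 0 N, (vonMangoldt n / n - primeWeight n) ≤ C := by
  obtain ⟨C, hC⟩ := Chebyshev.psi_sub_theta_le_mul_sqrt
  have hsum : Summable (fun n : ℕ => (n : ℝ) ^ (-(3 / 2) : ℝ)) :=
    Real.summable_nat_rpow.2 (by norm_num)
  set d : ℕ → ℝ := fun n => vonMangoldt n - if n.Prime then Real.log n else 0 with hd
  have hD : ∀ N : ℕ, ∑ n ∈ Ioc 0 N, d n ≤ |C| * (N : ℝ) ^ (1 / 2 : ℝ) := by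
    intro N
    have := hC N
    rw [Real.sqrt_eq_rpow] at this
    refine le_trans ?_ (this.trans (mul_le_mul_of_nonneg_right (le_abs_self C) (by positivity)))
    apply le_of_eq
    simp [hd, Chebyshev.psi, Chebyshev.theta, sum_filter]
  refine ⟨|C| + |C| * ∑' n : ℕ, (n : ℝ) ^ (-(3 / 2) : ℝ), by positivity, fun N => ?_⟩
  have e : ∑ n ∈ Ioc 0 N, (vonMangoldt n / n - primeWeight n) = ∑ n ∈ Ioc 0 N, d n / n := by
    refine sum_congr rfl fun n _ => ?_
    simp only [hd, primeWeight]
    split_ifs <;> ring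
  rw [e, sum_Ioc_div_eq]
  refine add_le_add ?_ ?_
  · rw [div_le_iff₀ (by positivity)]
    refine (hD N).trans (mul_le_mul_of_nonneg_left ?_ (abs_nonneg _))
    rcases Nat.eq_zero_or_pos N with rfl | hN
    · simp
    · have h1 : (1 : ℝ) ≤ N := by exact_mod_cast hN
      calc (N : ℝ) ^ (1 / 2 : ℝ) ≤ (N : ℝ) ^ (1 : ℝ) :=
            Real.rpow_le_rpow_of_exponent_le h1 (by norm_num)
        _ ≤ _ := by rw [Real.rpow_one]; linarith
  · calc _ ≤ ∑ n ∈ Ioc 0 N, |C| * (n : ℝ) ^ (-(3 / 2) : ℝ) := by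
          refine sum_le_sum fun n hn => ?_
          have hn0 : (0 : ℝ) < n := by exact_mod_cast (mem_Ioc.1 hn).1
          rw [div_le_iff₀ (by positivity)]
          refine (hD n).trans ?_
          rw [mul_assoc]
          refine mul_le_mul_of_nonneg_left ?_ (abs_nonneg _)
          calc (n : ℝ) ^ (1 / 2 : ℝ) = (n : ℝ) ^ (-(3 / 2) : ℝ) * (n : ℝ) ^ (2 : ℝ) := by
                rw [← Real.rpow_add hn0]; norm_num
            _ ≤ _ := by
                refine mul_le_mul_of_nonneg_left ?_ (by positivity)
                rw [Real.rpow_two]; nlinarith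
      _ ≤ _ := by
          rw [← mul_sum]
          exact mul_le_mul_of_nonneg_left (hsum.sum_le_tsum _ fun _ _ => by positivity)
            (abs_nonneg _)

/-- First theorem of Mertens. -/
theorem exists_abs_sum_primeWeight_sub_log_le :
    ∃ C : ℝ, 0 < C ∧ ∀ N : ℕ, |∑ n ∈ Ioc 0 N, primeWeight n - Real.log N| ≤ C := by
  obtain ⟨C₁, h1, hC₁⟩ := exists_abs_sum_vonMangoldt_div_sub_log_le
  obtain ⟨C₂, h2, hC₂⟩ := exists_sum_vonMangoldt_sub_primeWeight_le
  refine ⟨C₁ + C₂, by positivity, fun N => ?_⟩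
  rcases Nat.eq_zero_or_pos N with rfl | hN
  · simp; positivity
  have h3 := abs_le.1 (hC₁ N hN)
  have h4 := hC₂ N
  rw [sum_sub_distrib] at h4
  have h5 : ∑ n ∈ Ioc 0 N, primeWeight n ≤ ∑ n ∈ Ioc 0 N, vonMangoldt n / n :=
    sum_le_sum fun n _ => primeWeight_le n
  rw [abs_le]
  constructor <;> linarith

/-- Boundedness of `∑ log p / p ^ (1 + it)` for `t ≠ 0`. -/
theorem exists_norm_sum_primeWeight_cpow_le {t : ℝ} (ht : t ≠ 0) :
    ∃ C : ℝ, ∀ N : ℕ, ‖∑ n ∈ Ioc 0 N, (primeWeight n : ℂ) * (n : ℂ) ^ (-(t * Complex.I))‖ ≤ C := by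
  set s : ℂ := 1 + t * Complex.I with hsd
  have hs : s.re = 1 := by simp [hsd]
  have hs1 : s ≠ 1 := by simp [hsd, ht]
  obtain ⟨C₁, hC₁⟩ := exists_norm_sum_vonMangoldt_cpow_le hs hs1
  obtain ⟨C₂, h2, hC₂⟩ := exists_sum_vonMangoldt_sub_primeWeight_le
  refine ⟨C₁ + C₂, fun N => ?_⟩
  have e : ∑ n ∈ Ioc 0 N, (primeWeight n : ℂ) * (n : ℂ) ^ (-(t * Complex.I)) =
      ∑ n ∈ Ioc 0 N, (vonMangoldt n : ℂ) * (n : ℂ) ^ (-s) -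
      ∑ n ∈ Ioc 0 N, ((vonMangoldt n / n - primeWeight n : ℝ) : ℂ) * (n : ℂ) ^ (-(t * Complex.I)) := by
    rw [← sum_sub_distrib]
    refine sum_congr rfl fun n hn => ?_
    have hn0 : (n : ℂ) ≠ 0 := by have := (mem_Ioc.1 hn).1; norm_cast; omega
    have : (n : ℂ) ^ (-s) = (n : ℂ)⁻¹ * (n : ℂ) ^ (-(t * Complex.I)) := by
      rw [hsd, neg_add, Complex.cpow_add _ _ hn0, Complex.cpow_neg_one]
    rw [this]; push_cast; ring
  rw [e]
  refine (norm_sub_le _ _).trans (add_le_add (hC₁ N) (le_trans ?_ (hC₂ N)))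
  refine (norm_sum_le _ _).trans (sum_le_sum fun n hn => ?_)
  have hn0 : (0 : ℝ) < n := by exact_mod_cast (mem_Ioc.1 hn).1
  rw [norm_mul, Complex.norm_real, Real.norm_of_nonneg (by linarith [primeWeight_le n]),
    ← Complex.ofReal_natCast, Complex.norm_cpow_eq_rpow_re_of_pos hn0]
  simp

end SievedGaps

namespace SievedGaps
open Finset

theorem sin_pi_mul_nonpos_of_not_even_floor {u : ℝ} (h : ¬ Even ⌊u⌋) : Real.sin (Real.pi * u) ≤ 0 := by
  have e : Real.pi * u = Real.pi * Int.fract u + ⌊u⌋ * Real.pi := by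
    conv_lhs => rw [← Int.floor_add_fract u]
    ring
  rw [e, Real.sin_add_int_mul_pi, (Int.not_even_iff_odd.1 h).neg_one_zpow]
  have := Real.sin_nonneg_of_nonneg_of_le_pi (x := Real.pi * Int.fract u)
    (mul_nonneg Real.pi_pos.le (Int.fract_nonneg u))
    (by nlinarith [Real.pi_pos, Int.fract_lt_one u])
  linarith

theorem two_mul_le_sin_pi_mul {a u : ℝ} (ha : 0 ≤ a) (h1 : a ≤ u) (h2 : u ≤ 1 - a) :
    2 * a ≤ Real.sin (Real.pi * u) := by
  have key : ∀ v : ℝ, 0 ≤ v → v ≤ 1 / 2 → 2 * v ≤ Real.sin (Real.pi * v) := by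
    intro v h0 hv
    have := Real.mul_le_sin (x := Real.pi * v) (by positivity) (by nlinarith [Real.pi_pos])
    refine le_trans (le_of_eq ?_) this
    field_simp
  rcases le_total u (1 / 2) with h | h
  · linarith [key u (by linarith) h]
  · have e : Real.sin (Real.pi * u) = Real.sin (Real.pi * (1 - u)) := by
      rw [← Real.sin_pi_sub]; ring_nf
    rw [e]
    linarith [key (1 - u) (by linarith) (by linarith)]

theorem integral_exp_pi_int {k : ℤ} (hk : k ≠ 0) :
    ∫ u in (0 : ℝ)..2, Complex.exp (Real.pi * Complex.I * k * u) = 0 := by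
  rw [integral_exp_mul_complex]
  · have : Complex.exp (Real.pi * Complex.I * k * (2 : ℝ)) = 1 := by
      rw [Complex.exp_eq_one_iff]
      exact ⟨k, by push_cast; ring⟩
    rw [this]; simp
  · have : (Real.pi : ℂ) ≠ 0 := by exact_mod_cast Real.pi_ne_zero
    simp [this, hk]

/-- A trigonometric polynomial below the indicator of `⌊u⌋` even, with mean close to `1 / 2`. -/
theorem exists_trig_minorant {η : ℝ} (hη : 0 < η) :
    ∃ c : ℤ →₀ ℂ, 1 / 2 - η ≤ (c 0).re ∧ ∀ u : ℝ,
      (c.sum fun k a => a * Complex.exp (Real.pi * Complex.I * k * u)).re ≤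
        if Even ⌊u⌋ then 1 else 0 := by
  have : Fact (0 < (2 : ℝ)) := ⟨by norm_num⟩
  obtain ⟨a, ha0, haη, ha2⟩ : ∃ a : ℝ, 0 < a ∧ a ≤ η / 2 ∧ a ≤ 1 / 2 :=
    ⟨min (η / 2) (1 / 2), by positivity, min_le_left _ _, min_le_right _ _⟩
  let f : C(AddCircle (2 : ℝ), ℂ) :=
    ⟨fun x => ((min 1 (max 0 ((AddCircle.toCircle x : ℂ).im / (2 * a))) : ℝ) : ℂ), by
      have := AddCircle.continuous_toCircle (T := (2 : ℝ))
      fun_prop⟩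
  have hf : ∀ u : ℝ, f (u : AddCircle (2 : ℝ)) =
      ((min 1 (max 0 (Real.sin (Real.pi * u) / (2 * a))) : ℝ) : ℂ) := by
    intro u
    simp only [f, ContinuousMap.coe_mk, AddCircle.toCircle_apply_mk, Circle.coe_exp]
    rw [Complex.exp_ofReal_mul_I_im]
    congr 6
    ring
  have hmem : f ∈ (Submodule.span ℂ (Set.range (fourier (T := (2 : ℝ))))).topologicalClosure := by
    rw [span_fourier_closure_eq_top]; trivial
  have hcl : f ∈ closure (Submodule.span ℂ (Set.range (fourier (T := (2 : ℝ)))) :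
      Set C(AddCircle (2 : ℝ), ℂ)) := hmem
  obtain ⟨P, hP, hdist⟩ := Metric.mem_closure_iff.1 hcl (η / 4) (by positivity)
  obtain ⟨c₀, rfl⟩ := (Finsupp.mem_span_range_iff_exists_finsupp).1 hP
  set P := c₀.sum fun i a => a • fourier (T := (2 : ℝ)) i with hPd
  have hPu : ∀ u : ℝ, P (u : AddCircle (2 : ℝ)) =
      c₀.sum fun k a => a * Complex.exp (Real.pi * Complex.I * k * u) := by
    intro u
    rw [hPd, Finsupp.sum, Finsupp.sum, ContinuousMap.coe_sum, Finset.sum_apply]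
    refine sum_congr rfl fun k _ => ?_
    rw [ContinuousMap.coe_smul, Pi.smul_apply, fourier_coe_apply, smul_eq_mul]
    congr 2
    push_cast
    ring
  have hclose : ∀ u : ℝ, |(min 1 (max 0 (Real.sin (Real.pi * u) / (2 * a)))) -
      (c₀.sum fun k a => a * Complex.exp (Real.pi * Complex.I * k * u)).re| ≤ η / 4 := by
    intro u
    have h1 := (ContinuousMap.dist_lt_iff (by positivity)).1 hdist (u : AddCircle (2 : ℝ))
    rw [hf, hPu, Complex.dist_eq] at h1
    refine le_trans (le_of_eq_of_le ?_ (Complex.abs_re_le_norm _)) h1.le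
    simp
  set c : ℤ →₀ ℂ := c₀ - Finsupp.single 0 ((η / 4 : ℝ) : ℂ) with hc
  have hcsum : ∀ u : ℝ, (c.sum fun k a => a * Complex.exp (Real.pi * Complex.I * k * u)) =
      (c₀.sum fun k a => a * Complex.exp (Real.pi * Complex.I * k * u)) - ((η / 4 : ℝ) : ℂ) := by
    intro u
    rw [hc, Finsupp.sum_sub_index (by intros; ring), Finsupp.sum_single_index (by simp)]
    simp
  have hlow : ∀ u : ℝ, min 1 (max 0 (Real.sin (Real.pi * u) / (2 * a))) - η / 2 ≤
      (c.sum fun k a => a * Complex.exp (Real.pi * Complex.I * k * u)).re := by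
    intro u
    rw [hcsum, Complex.sub_re, Complex.ofReal_re]
    linarith [(abs_le.1 (hclose u)).2]
  refine ⟨c, ?_, fun u => ?_⟩
  · have hintegral : ∫ u in (0 : ℝ)..2, (c.sum fun k a => a * Complex.exp (Real.pi * Complex.I * k * u)) =
        2 * c 0 := by
      simp only [Finsupp.sum]
      rw [intervalIntegral.integral_finsetSum]
      · by_cases h0 : (0 : ℤ) ∈ c.support
        · rw [Finset.sum_eq_single_of_mem 0 h0]
          · simp [mul_comm]
          · intro k _ hk
            rw [intervalIntegral.integral_const_mul, integral_exp_pi_int hk, mul_zero]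
        · rw [Finset.sum_eq_zero, Finsupp.notMem_support_iff.1 h0, mul_zero]
          intro k hk
          have hk0 : k ≠ 0 := by rintro rfl; exact h0 hk
          rw [intervalIntegral.integral_const_mul, integral_exp_pi_int hk0, mul_zero]
      · intro k _
        exact Continuous.intervalIntegrable (by fun_prop) _ _
    have hcont : Continuous fun u : ℝ =>
        (c.sum fun k a => a * Complex.exp (Real.pi * Complex.I * k * u)) := by
      simp only [Finsupp.sum]
      fun_prop
    have hre : ∫ u in (0 : ℝ)..2,
        (c.sum fun k a => a * Complex.exp (Real.pi * Complex.I * k * u)).re = 2 * (c 0).re := by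
      have := intervalIntegral.intervalIntegral_re (𝕜 := ℂ) (f := fun u : ℝ =>
        (c.sum fun k a => a * Complex.exp (Real.pi * Complex.I * k * u))) (a := 0) (b := 2)
        (μ := MeasureTheory.volume) (hcont.intervalIntegrable _ _)
      refine this.trans ?_
      rw [hintegral]
      simp
    set φ : ℝ → ℝ := fun u => (c.sum fun k a => a * Complex.exp (Real.pi * Complex.I * k * u)).re
    have hφ : Continuous φ := Complex.continuous_re.comp hcont
    have hφi : ∀ p q : ℝ, IntervalIntegrable φ MeasureTheory.volume p q :=
      fun p q => hφ.intervalIntegrable _ _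
    have hm : ∀ u, -(η / 2) ≤ φ u := fun u => by
      have : 0 ≤ min 1 (max 0 (Real.sin (Real.pi * u) / (2 * a))) := le_min zero_le_one (le_max_left _ _)
      linarith [hlow u]
    have hs1 := intervalIntegral.integral_add_adjacent_intervals (hφi 0 a) (hφi a (1 - a))
    have hs2 := intervalIntegral.integral_add_adjacent_intervals (hφi 0 (1 - a)) (hφi (1 - a) 2)
    have i1 : a * (-(η / 2)) ≤ ∫ u in (0 : ℝ)..a, φ u := by
      have := intervalIntegral.integral_mono_on (a := 0) (b := a) ha0.le
        (intervalIntegrable_const (c := -(η / 2))) (hφi 0 a) fun u _ => hm u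
      rw [intervalIntegral.integral_const, smul_eq_mul] at this
      linarith
    have i2 : (1 - a - a) * (1 - η / 2) ≤ ∫ u in a..(1 - a), φ u := by
      have := intervalIntegral.integral_mono_on (a := a) (b := 1 - a) (by linarith)
        (intervalIntegrable_const (c := 1 - η / 2)) (hφi a (1 - a)) fun u hu => ?_
      · rwa [intervalIntegral.integral_const, smul_eq_mul] at this
      · refine le_trans ?_ (hlow u)
        have h3 := two_mul_le_sin_pi_mul ha0.le hu.1 hu.2
        have h4 : 1 ≤ Real.sin (Real.pi * u) / (2 * a) := by
          rw [le_div_iff₀ (by positivity)]; linarith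
        have : (1 : ℝ) ≤ min 1 (max 0 (Real.sin (Real.pi * u) / (2 * a))) :=
          le_min le_rfl (h4.trans (le_max_right _ _))
        linarith
    have i3 : (2 - (1 - a)) * (-(η / 2)) ≤ ∫ u in (1 - a)..2, φ u := by
      have := intervalIntegral.integral_mono_on (a := 1 - a) (b := 2) (by linarith)
        (intervalIntegrable_const (c := -(η / 2))) (hφi _ _) fun u _ => hm u
      rw [intervalIntegral.integral_const, smul_eq_mul] at this
      linarith
    nlinarith
  · rw [hcsum, Complex.sub_re, Complex.ofReal_re]
    have h1 := (abs_le.1 (hclose u)).1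
    have h2 : min 1 (max 0 (Real.sin (Real.pi * u) / (2 * a))) ≤ if Even ⌊u⌋ then 1 else 0 := by
      split_ifs with h
      · exact min_le_left _ _
      · refine (min_le_right _ _).trans (max_le le_rfl ?_)
        exact div_nonpos_of_nonpos_of_nonneg (sin_pi_mul_nonpos_of_not_even_floor h) (by positivity)
    linarith

/-- Primes in logarithmic windows of even index carry half of the weight, up to a bounded error. -/
theorem exists_parity_lower_bound {ℓ : ℝ} (hℓ : 0 < ℓ) {η : ℝ} (hη : 0 < η) :
    ∃ C : ℝ, 0 ≤ C ∧ ∀ (y : ℝ), 0 < y → ∀ (m N : ℕ) (g : ℕ → ℝ) (B : ℝ), m ≤ N → 0 ≤ B →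
      (∀ n, m < n → n ≤ N → 0 ≤ g n) → (∀ n, m < n → n ≤ N → g n ≤ B) →
      (∀ n, m < n → n < N → g n ≤ g (n + 1)) →
      (1 / 2 - η) * ∑ n ∈ Ioc m N, primeWeight n * g n - C * B ≤
        ∑ n ∈ Ioc m N, primeWeight n * g n *
          if Even ⌊Real.log (y / n) / ℓ⌋ then (1 : ℝ) else 0 := by
  obtain ⟨c, hc0, hc⟩ := exists_trig_minorant hη
  have hπ := Real.pi_pos
  have hE : ∀ k : ℤ, ∃ C : ℝ, 0 ≤ C ∧ (k ≠ 0 → ∀ N : ℕ,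
      ‖∑ n ∈ Ioc 0 N, (primeWeight n : ℂ) * (n : ℂ) ^ (-((Real.pi * k / ℓ : ℝ) * Complex.I))‖ ≤ C) := by
    intro k
    by_cases hk : k = 0
    · exact ⟨0, le_rfl, fun h => absurd hk h⟩
    · obtain ⟨C, hC⟩ := exists_norm_sum_primeWeight_cpow_le (t := Real.pi * k / ℓ) (by
        have : (k : ℝ) ≠ 0 := by exact_mod_cast hk
        positivity)
      exact ⟨C, (norm_nonneg _).trans (hC 0), fun _ => hC⟩
  choose CE hCE0 hCE using hE
  refine ⟨∑ k ∈ c.support, ‖c k‖ * (3 * CE k),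
    sum_nonneg fun k _ => mul_nonneg (norm_nonneg _) (by linarith [hCE0 k]), ?_⟩
  intro y hy m N g B hmN hB0 hg hgB hmono
  set w : ℕ → ℝ := fun n => primeWeight n * g n with hw
  have hw0 : ∀ n ∈ Ioc m N, 0 ≤ w n := fun n hn =>
    mul_nonneg (primeWeight_nonneg n) (hg n (mem_Ioc.1 hn).1 (mem_Ioc.1 hn).2)
  set u : ℕ → ℝ := fun n => Real.log (y / n) / ℓ with hu
  have h1 : ∑ n ∈ Ioc m N, w n *
      (c.sum fun k a => a * Complex.exp (Real.pi * Complex.I * k * (u n))).re ≤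
      ∑ n ∈ Ioc m N, w n * if Even ⌊u n⌋ then (1 : ℝ) else 0 :=
    sum_le_sum fun n hn => mul_le_mul_of_nonneg_left (hc _) (hw0 n hn)
  refine le_trans ?_ h1
  have h2 : ∑ n ∈ Ioc m N, w n *
      (c.sum fun k a => a * Complex.exp (Real.pi * Complex.I * k * (u n))).re =
      ∑ k ∈ c.support, (c k * ∑ n ∈ Ioc m N, (w n : ℂ) *
        Complex.exp (Real.pi * Complex.I * k * (u n))).re := by
    rw [← Complex.re_sum]
    simp_rw [mul_sum]
    rw [sum_comm, Complex.re_sum]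
    refine sum_congr rfl fun n _ => ?_
    rw [Finsupp.sum, ← Complex.re_ofReal_mul, mul_sum]
    congr 1
    exact sum_congr rfl fun k _ => by ring
  have hosc : ∀ k : ℤ, k ≠ 0 → ‖∑ n ∈ Ioc m N, (w n : ℂ) *
        Complex.exp (Real.pi * Complex.I * k * (u n))‖ ≤ 3 * CE k * B := by
    intro k hk
    set E : ℕ → ℂ := fun N => ∑ n ∈ Ioc 0 N, (primeWeight n : ℂ) *
      (n : ℂ) ^ (-((Real.pi * k / ℓ : ℝ) * Complex.I)) with hEd
    have h3 := norm_sum_Ioc_sub_mul_le (E := E) (g := g) (m := m) (N := N) (C := CE k)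
      (fun n _ _ => hCE k hk n) hmN hg hgB hB0 (Or.inl hmono)
    set ω : ℂ := Complex.exp (((Real.pi * k / ℓ * Real.log y : ℝ) : ℂ) * Complex.I)
    have hω : ‖ω‖ = 1 := Complex.norm_exp_ofReal_mul_I _
    have h4 : ∑ n ∈ Ioc m N, (w n : ℂ) * Complex.exp (Real.pi * Complex.I * k * (u n)) =
        ω * ∑ n ∈ Ioc m N, (E n - E (n - 1)) * g n := by
      rw [mul_sum]
      refine sum_congr rfl fun n hn => ?_
      have hn1 : 1 ≤ n := by have := (mem_Ioc.1 hn).1; omega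
      have hn0 : (0 : ℝ) < n := by exact_mod_cast hn1
      have e1 : E n - E (n - 1) = (primeWeight n : ℂ) *
          (n : ℂ) ^ (-((Real.pi * k / ℓ : ℝ) * Complex.I)) := by
        obtain ⟨j, rfl⟩ : ∃ j, n = j + 1 := ⟨n - 1, by omega⟩
        simp only [hEd, Nat.add_sub_cancel]
        rw [Finset.sum_Ioc_succ_top (by omega)]
        ring
      have e2 : Complex.exp (Real.pi * Complex.I * k * (u n)) =
          ω * (n : ℂ) ^ (-((Real.pi * k / ℓ : ℝ) * Complex.I)) := by
        rw [Complex.cpow_def_of_ne_zero (by exact_mod_cast hn0.ne'), ← Complex.exp_add]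
        congr 1
        rw [← Complex.natCast_log]
        simp only [hu]
        rw [Real.log_div hy.ne' hn0.ne']
        push_cast
        ring
      rw [e1, e2]
      simp only [hw]
      push_cast
      ring
    rw [h4, norm_mul, hω, one_mul]
    exact h3
  rw [h2]
  have hsumw : 0 ≤ ∑ n ∈ Ioc m N, w n := sum_nonneg hw0
  have hterm : ∀ k ∈ c.support, (if k = 0 then (c 0).re * ∑ n ∈ Ioc m N, w n else 0) -
      ‖c k‖ * (3 * CE k) * B ≤ (c k * ∑ n ∈ Ioc m N, (w n : ℂ) *
        Complex.exp (Real.pi * Complex.I * k * (u n))).re := by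
    intro k _
    have hpos : 0 ≤ ‖c k‖ * (3 * CE k) * B :=
      mul_nonneg (mul_nonneg (norm_nonneg _) (by linarith [hCE0 k])) hB0
    split_ifs with hk
    · subst hk
      have : (c 0 * ∑ n ∈ Ioc m N, (w n : ℂ) *
          Complex.exp (Real.pi * Complex.I * ((0 : ℤ) : ℂ) * (u n))).re =
          (c 0).re * ∑ n ∈ Ioc m N, w n := by
        simp [← Complex.ofReal_sum]
      rw [this]
      linarith
    · have h5 := Complex.abs_re_le_norm (c k * ∑ n ∈ Ioc m N, (w n : ℂ) *
        Complex.exp (Real.pi * Complex.I * k * (u n)))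
      have h6 := neg_le_of_abs_le h5
      rw [norm_mul] at h6
      have h7 := mul_le_mul_of_nonneg_left (hosc k hk) (norm_nonneg (c k))
      nlinarith
  have h8 := sum_le_sum hterm
  rw [sum_sub_distrib, ← sum_mul] at h8
  refine le_trans (sub_le_sub_right ?_ _) h8
  by_cases h0 : (0 : ℤ) ∈ c.support
  · rw [Finset.sum_ite_eq' c.support 0, if_pos h0]
    exact mul_le_mul_of_nonneg_right hc0 hsumw
  · have : (c 0).re = 0 := by rw [Finsupp.notMem_support_iff.1 h0]; rfl
    rw [Finset.sum_ite_eq' c.support 0, if_neg h0]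
    rw [this] at hc0
    nlinarith

theorem mem_primesBetween {w t : ℝ} {p : ℕ} :
    p ∈ primesBetween w t ↔ p.Prime ∧ w < p ∧ (p : ℝ) ≤ t := by
  unfold primesBetween
  rw [mem_filter, mem_range]
  constructor
  · exact fun h => h.2
  · exact fun h => ⟨Nat.lt_succ_of_le (Nat.le_floor h.2.2), h⟩

theorem mem_primesUpTo {t : ℝ} {p : ℕ} : p ∈ primesUpTo t ↔ p.Prime ∧ (p : ℝ) ≤ t := by
  unfold primesUpTo
  rw [mem_filter, mem_range]
  constructor
  · exact fun h => h.2
  · exact fun h => ⟨Nat.lt_succ_of_le (Nat.le_floor h.2), h⟩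

theorem primesBetween_eq_filter {w z : ℝ} (hw : 0 ≤ w) (hz : 0 ≤ z) :
    primesBetween w z = (Ioc ⌊w⌋₊ ⌊z⌋₊).filter Nat.Prime := by
  ext p
  rw [mem_primesBetween, mem_filter, mem_Ioc, Nat.floor_lt hw, Nat.le_floor_iff hz]
  tauto

theorem exists_abs_sum_prime_inv_sub_le_nat :
    ∃ C : ℝ, 0 < C ∧ ∀ m N : ℕ, 2 ≤ m → m ≤ N →
      |∑ p ∈ (Ioc m N).filter Nat.Prime, 1 / (p : ℝ) -
        (Real.log (Real.log N) - Real.log (Real.log m))| ≤ C / Real.log m := by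
  obtain ⟨C, hC0, hC⟩ := exists_abs_sum_primeWeight_sub_log_le
  refine ⟨3 * C + 1, by positivity, fun m N hm hmN => ?_⟩
  have hlogpos : ∀ n : ℕ, 2 ≤ n → 0 < Real.log n := fun n hn =>
    Real.log_pos (by exact_mod_cast hn)
  have hlogmono : ∀ a b : ℕ, 2 ≤ a → a ≤ b → Real.log a ≤ Real.log b := fun a b ha hab =>
    Real.log_le_log (by positivity) (by exact_mod_cast hab)
  set E : ℕ → ℂ := fun N => ((∑ n ∈ Ioc 0 N, primeWeight n - Real.log N : ℝ) : ℂ) with hE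
  have h1 := norm_sum_Ioc_sub_mul_le (E := E) (g := fun n => 1 / Real.log n) (m := m) (N := N)
    (C := C) (B := 1 / Real.log m) (fun n _ _ => by
      simp only [hE]; rw [Complex.norm_real, Real.norm_eq_abs]; exact hC n) hmN
    (fun n h1 h2 => (one_div_pos.2 (hlogpos n (by omega))).le)
    (fun n h1 h2 => one_div_le_one_div_of_le (hlogpos m hm) (hlogmono m n hm h1.le))
    (one_div_pos.2 (hlogpos m hm)).le
    (Or.inr fun n h1 h2 => one_div_le_one_div_of_le (hlogpos n (by omega))
      (hlogmono n (n + 1) (by omega) (by omega)))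
  have h2 : ∑ n ∈ Ioc m N, (E n - E (n - 1)) * ((1 / Real.log n : ℝ) : ℂ) =
      ((∑ p ∈ (Ioc m N).filter Nat.Prime, 1 / (p : ℝ) -
        ∑ n ∈ Ioc m N, (Real.log n - Real.log (n - 1 : ℕ)) / Real.log n : ℝ) : ℂ) := by
    rw [sum_filter, ← sum_sub_distrib, Complex.ofReal_sum]
    refine sum_congr rfl fun n hn => ?_
    have hn := mem_Ioc.1 hn
    obtain ⟨j, rfl⟩ : ∃ j, n = j + 1 := ⟨n - 1, by omega⟩
    have hp := hlogpos (j + 1) (by omega)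
    simp only [hE, Nat.add_sub_cancel]
    rw [Finset.sum_Ioc_succ_top (by omega), ← Complex.ofReal_sub, ← Complex.ofReal_mul]
    congr 1
    unfold primeWeight
    split_ifs
    · field_simp; ring
    · field_simp; ring
  rw [h2, Complex.norm_real, Real.norm_eq_abs, abs_le] at h1
  have h3 : |∑ n ∈ Ioc m N, (Real.log n - Real.log (n - 1 : ℕ)) / Real.log n -
      (Real.log (Real.log N) - Real.log (Real.log m))| ≤ 1 / Real.log m - 1 / Real.log N := by
    clear h1 h2
    induction N, hmN using Nat.le_induction with
    | base => simp
    | succ k hk ih =>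
      rw [Finset.sum_Ioc_succ_top (by omega)]
      simp only [Nat.add_sub_cancel]
      set a := Real.log k with ha
      set b := Real.log ((k + 1 : ℕ) : ℝ) with hb
      have ha0 : 0 < a := hlogpos k (by omega)
      have hab : a ≤ b := hlogmono k (k + 1) (by omega) (by omega)
      have hb0 : 0 < b := by linarith
      have hd : b - a ≤ 1 := by
        rw [ha, hb, ← Real.log_div (by positivity) (by norm_cast; omega)]
        have hk0 : (1 : ℝ) ≤ k := by norm_cast; omega
        have : ((k + 1 : ℕ) : ℝ) / k ≤ 2 := by
          rw [div_le_iff₀ (by linarith)]; push_cast; linarith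
        calc _ ≤ Real.log 2 := Real.log_le_log (by positivity) this
          _ ≤ 1 := by linarith [Real.log_two_lt_d9]
      have l1 : Real.log b - Real.log a ≤ (b - a) / a := by
        rw [← Real.log_div hb0.ne' ha0.ne']
        refine (Real.log_le_sub_one_of_pos (by positivity)).trans (le_of_eq ?_)
        field_simp
      have l2 : (b - a) / b ≤ Real.log b - Real.log a := by
        have := Real.log_le_sub_one_of_pos (x := a / b) (by positivity)
        rw [Real.log_div ha0.ne' hb0.ne'] at this
        have e : (b - a) / b = 1 - a / b := by field_simp
        linarith
      have l3 : (b - a) / a - (b - a) / b ≤ 1 / a - 1 / b := by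
        have e : (b - a) / a - (b - a) / b = (b - a) * (1 / a - 1 / b) := by ring
        have : 0 ≤ 1 / a - 1 / b := sub_nonneg.2 (one_div_le_one_div_of_le ha0 hab)
        rw [e]
        nlinarith
      rw [abs_le] at ih ⊢
      constructor <;> linarith
  have h4 : 0 < 1 / Real.log N := one_div_pos.2 (hlogpos N (by omega))
  rw [abs_le] at h3 ⊢
  have e : (3 * C + 1) / Real.log m = 3 * C * (1 / Real.log m) + 1 / Real.log m := by ring
  rw [e]
  constructor <;> linarith

/-- Second theorem of Mertens on an interval. -/
theorem exists_abs_sum_primesBetween_inv_sub_le :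
    ∃ C : ℝ, 0 < C ∧ ∀ w z : ℝ, 2 ≤ w → w ≤ z →
      |∑ p ∈ primesBetween w z, 1 / (p : ℝ) -
        (Real.log (Real.log z) - Real.log (Real.log w))| ≤ C / Real.log w := by
  obtain ⟨C, hC0, hC⟩ := exists_abs_sum_prime_inv_sub_le_nat
  refine ⟨2 * C + 2, by positivity, fun w z hw hwz => ?_⟩
  rw [primesBetween_eq_filter (by linarith) (by linarith)]
  have key : ∀ t : ℝ, 2 ≤ t → 2 ≤ ⌊t⌋₊ ∧ Real.log t / 2 ≤ Real.log ⌊t⌋₊ ∧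
      Real.log (Real.log ⌊t⌋₊) ≤ Real.log (Real.log t) ∧
      Real.log (Real.log t) - Real.log (Real.log ⌊t⌋₊) ≤ 2 / Real.log t := by
    intro t ht
    have h2 : 2 ≤ ⌊t⌋₊ := Nat.le_floor (by simpa using ht)
    have h2' : (2 : ℝ) ≤ ⌊t⌋₊ := by exact_mod_cast h2
    have hle : (⌊t⌋₊ : ℝ) ≤ t := Nat.floor_le (by linarith)
    have hlt := Nat.lt_floor_add_one t
    have hlf : 0 < Real.log ⌊t⌋₊ := Real.log_pos (by linarith)
    have hlt0 : 0 < Real.log t := Real.log_pos (by linarith)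
    have hll : Real.log ⌊t⌋₊ ≤ Real.log t := Real.log_le_log (by linarith) hle
    have hhalf : Real.log t / 2 ≤ Real.log ⌊t⌋₊ := by
      have : Real.log t ≤ Real.log ((⌊t⌋₊ : ℝ) ^ 2) := Real.log_le_log (by linarith) (by nlinarith)
      rw [Real.log_pow] at this
      push_cast at this
      linarith
    refine ⟨h2, hhalf, Real.log_le_log hlf hll, ?_⟩
    have hd : Real.log t - Real.log ⌊t⌋₊ ≤ 1 := by
      rw [← Real.log_div (by linarith) (by linarith)]
      have : t / ⌊t⌋₊ ≤ 2 := by rw [div_le_iff₀ (by linarith)]; linarith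
      calc _ ≤ Real.log 2 := Real.log_le_log (div_pos (by linarith) (by linarith)) this
        _ ≤ 1 := by linarith [Real.log_two_lt_d9]
    rw [← Real.log_div hlt0.ne' hlf.ne']
    refine (Real.log_le_sub_one_of_pos (by positivity)).trans ?_
    have e : Real.log t / Real.log ⌊t⌋₊ - 1 = (Real.log t - Real.log ⌊t⌋₊) / Real.log ⌊t⌋₊ := by
      field_simp
    rw [e, div_le_div_iff₀ hlf hlt0]
    nlinarith
  obtain ⟨w1, w2, w3, w4⟩ := key w hw
  obtain ⟨z1, z2, z3, z4⟩ := key z (hw.trans hwz)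
  have h := hC ⌊w⌋₊ ⌊z⌋₊ w1 (Nat.floor_le_floor hwz)
  have hw0 : 0 < Real.log w := Real.log_pos (by linarith)
  have hz0 : Real.log w ≤ Real.log z := Real.log_le_log (by linarith) hwz
  have h5 : C / Real.log ⌊w⌋₊ ≤ 2 * C / Real.log w := by
    rw [div_le_div_iff₀ (by linarith) hw0]
    nlinarith
  have h6 : 2 / Real.log z ≤ 2 / Real.log w := by gcongr
  have e : (2 * C + 2) / Real.log w = 2 * C / Real.log w + 2 / Real.log w := by ring
  rw [e]
  rw [abs_le] at h ⊢
  constructor <;> linarith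

theorem sum_primesBetween_inv_sq_le {w z : ℝ} (hw : 1 ≤ w) :
    ∑ p ∈ primesBetween w z, 1 / (p : ℝ) ^ 2 ≤ 2 / w := by
  have h1 : ∑ p ∈ primesBetween w z, 1 / (p : ℝ) ^ 2 ≤
      ∑ p ∈ Ioo ⌊w⌋₊ (⌊z⌋₊ + 1), 1 / (p : ℝ) ^ 2 := by
    refine sum_le_sum_of_subset_of_nonneg (fun p hp => ?_) fun _ _ _ => by positivity
    have hp := mem_primesBetween.1 hp
    rw [mem_Ioo, Nat.floor_lt (by linarith)]
    exact ⟨hp.2.1, Nat.lt_succ_of_le (Nat.le_floor hp.2.2)⟩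
  refine h1.trans ?_
  have h2 := sum_Ioo_inv_sq_le (α := ℝ) ⌊w⌋₊ (⌊z⌋₊ + 1)
  simp only [one_div]
  refine h2.trans ?_
  have := (Nat.lt_floor_add_one w).le
  gcongr

theorem sigBetween_pos (w z : ℝ) : 0 < sigBetween w z := by
  refine prod_pos fun p hp => ?_
  have hp2 : (2 : ℝ) ≤ p := by exact_mod_cast (mem_primesBetween.1 hp).1.two_le
  have : 1 / (p : ℝ) ≤ 1 / 2 := one_div_le_one_div_of_le (by norm_num) hp2
  linarith

theorem sigUpTo_pos (z : ℝ) : 0 < sigUpTo z := by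
  refine prod_pos fun p hp => ?_
  have hp2 : (2 : ℝ) ≤ p := by exact_mod_cast (mem_primesUpTo.1 hp).1.two_le
  have : 1 / (p : ℝ) ≤ 1 / 2 := one_div_le_one_div_of_le (by norm_num) hp2
  linarith

/-- Third theorem of Mertens on an interval. -/
theorem exists_abs_log_sigBetween_le :
    ∃ C : ℝ, 0 < C ∧ ∀ w z : ℝ, 2 ≤ w → w ≤ z →
      |-Real.log (sigBetween w z) - (Real.log (Real.log z) - Real.log (Real.log w))|
        ≤ C / Real.log w := by
  obtain ⟨C, hC0, hC⟩ := exists_abs_sum_primesBetween_inv_sub_le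
  refine ⟨C + 4, by positivity, fun w z hw hwz => ?_⟩
  have h := hC w z hw hwz
  have hlog : -Real.log (sigBetween w z) = ∑ p ∈ primesBetween w z, -Real.log (1 - 1 / (p : ℝ)) := by
    unfold sigBetween
    rw [Real.log_prod, sum_neg_distrib]
    intro p hp
    have hp2 : (2 : ℝ) ≤ p := by exact_mod_cast (mem_primesBetween.1 hp).1.two_le
    have : 1 / (p : ℝ) ≤ 1 / 2 := one_div_le_one_div_of_le (by norm_num) hp2
    linarith
  have hlo : ∑ p ∈ primesBetween w z, 1 / (p : ℝ) ≤ -Real.log (sigBetween w z) := by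
    rw [hlog]
    refine sum_le_sum fun p hp => ?_
    have hp2 : (2 : ℝ) ≤ p := by exact_mod_cast (mem_primesBetween.1 hp).1.two_le
    have h2 : 1 / (p : ℝ) ≤ 1 / 2 := one_div_le_one_div_of_le (by norm_num) hp2
    have := Real.log_le_sub_one_of_pos (x := 1 - 1 / (p : ℝ)) (by linarith)
    linarith
  have hup : -Real.log (sigBetween w z) ≤ ∑ p ∈ primesBetween w z, 1 / (p : ℝ) + 2 * (2 / w) := by
    refine le_trans ?_ (add_le_add_right (mul_le_mul_of_nonneg_left
      (sum_primesBetween_inv_sq_le (z := z) (by linarith)) zero_le_two) _)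
    rw [hlog, mul_sum, ← sum_add_distrib]
    refine sum_le_sum fun p hp => ?_
    have hp2 : (2 : ℝ) ≤ p := by exact_mod_cast (mem_primesBetween.1 hp).1.two_le
    have h2 : 1 / (p : ℝ) ≤ 1 / 2 := one_div_le_one_div_of_le (by norm_num) hp2
    have h0 : 0 < 1 / (p : ℝ) := by positivity
    set t := 1 / (p : ℝ)
    rw [show 1 / (p : ℝ) ^ 2 = t ^ 2 by simp [t]]
    have h3 := Real.log_le_sub_one_of_pos (x := (1 - t)⁻¹) (inv_pos.2 (by linarith))
    rw [Real.log_inv] at h3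
    have h4 : (1 - t)⁻¹ ≤ 1 + t + 2 * t ^ 2 := by
      rw [inv_le_iff_one_le_mul₀ (by linarith)]
      nlinarith [mul_nonneg (sq_nonneg t) (by linarith : (0 : ℝ) ≤ 1 - 2 * t)]
    linarith
  have hw0 : 0 < Real.log w := Real.log_pos (by linarith)
  have h2w : 2 / w ≤ 2 / Real.log w := by
    gcongr
    linarith [Real.log_le_sub_one_of_pos (x := w) (by linarith)]
  have e : (C + 4) / Real.log w = C / Real.log w + 2 * (2 / Real.log w) := by ring
  rw [e]
  rw [abs_le] at h ⊢
  constructor <;> linarith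

theorem exists_inv_sigBetween_bounds :
    ∃ C : ℝ, 0 < C ∧ ∀ w z : ℝ, 2 ≤ w → w ≤ z →
      Real.log z / Real.log w * (1 - C / Real.log w) ≤ (sigBetween w z)⁻¹ ∧
      (sigBetween w z)⁻¹ ≤ C * (Real.log z / Real.log w) := by
  obtain ⟨C, hC0, hC⟩ := exists_abs_log_sigBetween_le
  refine ⟨max C (Real.exp (C / Real.log 2)), lt_max_of_lt_left hC0, fun w z hw hwz => ?_⟩
  have h := abs_le.1 (hC w z hw hwz)
  have hw0 : 0 < Real.log w := Real.log_pos (by linarith)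
  have hz0 : 0 < Real.log z := hw0.trans_le (Real.log_le_log (by linarith) hwz)
  have e1 : (sigBetween w z)⁻¹ = Real.exp (-Real.log (sigBetween w z)) := by
    rw [Real.exp_neg, Real.exp_log (sigBetween_pos w z)]
  have e2 : Real.log z / Real.log w =
      Real.exp (Real.log (Real.log z) - Real.log (Real.log w)) := by
    rw [Real.exp_sub, Real.exp_log hw0, Real.exp_log hz0]
  constructor
  · calc _ ≤ Real.log z / Real.log w * (1 - C / Real.log w) := by
          gcongr
          exact le_max_left _ _
      _ ≤ Real.log z / Real.log w * Real.exp (-(C / Real.log w)) := by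
          gcongr
          linarith [Real.add_one_le_exp (-(C / Real.log w))]
      _ ≤ _ := by
          rw [e1, e2, ← Real.exp_add]
          exact Real.exp_le_exp.2 (by linarith)
  · calc _ ≤ Real.exp (C / Real.log w) * (Real.log z / Real.log w) := by
          rw [e1, e2, ← Real.exp_add]
          exact Real.exp_le_exp.2 (by linarith)
      _ ≤ Real.exp (C / Real.log 2) * (Real.log z / Real.log w) := by
          gcongr
      _ ≤ _ := by
          gcongr
          exact le_max_right _ _

theorem primesUpTo_eq_union {w z : ℝ} (hwz : w ≤ z) :
    primesUpTo z = (primesUpTo w).disjUnion (primesBetween w z)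
      (disjoint_left.2 fun _ h1 h2 =>
        not_lt.2 (mem_primesUpTo.1 h1).2 (mem_primesBetween.1 h2).2.1) := by
  ext p
  rw [mem_disjUnion, mem_primesUpTo, mem_primesUpTo, mem_primesBetween]
  constructor
  · intro h
    rcases le_or_gt (p : ℝ) w with h1 | h1
    · exact Or.inl ⟨h.1, h1⟩
    · exact Or.inr ⟨h.1, h1, h.2⟩
  · rintro (h | h)
    · exact ⟨h.1, h.2.trans hwz⟩
    · exact ⟨h.1, h.2.2⟩

theorem sigUpTo_eq_mul {w z : ℝ} (hwz : w ≤ z) :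
    sigUpTo z = sigUpTo w * sigBetween w z := by
  unfold sigUpTo sigBetween
  rw [primesUpTo_eq_union hwz, prod_disjUnion]

theorem PP_eq_mul {w z : ℝ} (hwz : w ≤ z) :
    PP z = PP w * ∏ p ∈ primesBetween w z, p := by
  unfold PP
  rw [primesUpTo_eq_union hwz, prod_disjUnion]

theorem exists_sigUpTo_bounds :
    ∃ c C : ℝ, 0 < c ∧ 0 < C ∧ ∀ t : ℝ, 2 ≤ t →
      c / Real.log t ≤ sigUpTo t ∧ sigUpTo t ≤ C / Real.log t := by
  obtain ⟨C, hC0, hC⟩ := exists_abs_log_sigBetween_le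
  have h2 := sigUpTo_pos 2
  have hl2 : 0 < Real.log 2 := Real.log_pos (by norm_num)
  refine ⟨sigUpTo 2 * (Real.exp (-(C / Real.log 2)) * Real.log 2),
    sigUpTo 2 * (Real.exp (C / Real.log 2) * Real.log 2), by positivity, by positivity,
    fun t ht => ?_⟩
  have ht0 : 0 < Real.log t := Real.log_pos (by linarith)
  have h := abs_le.1 (hC 2 t le_rfl ht)
  have e1 : sigBetween 2 t = Real.exp (Real.log (sigBetween 2 t)) :=
    (Real.exp_log (sigBetween_pos 2 t)).symm
  have e2 : Real.log 2 / Real.log t =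
      Real.exp (Real.log (Real.log 2) - Real.log (Real.log t)) := by
    rw [Real.exp_sub, Real.exp_log hl2, Real.exp_log ht0]
  rw [sigUpTo_eq_mul ht, mul_div_assoc, mul_div_assoc, mul_div_assoc, mul_div_assoc, e1, e2,
    ← Real.exp_add, ← Real.exp_add]
  constructor
  · gcongr
    linarith
  · gcongr
    linarith

/-- The average of `f` over the residues `0, …, m - 1`. -/
noncomputable def avg (m : ℕ) (f : ℤ → ℝ) : ℝ := (∑ b ∈ range m, f b) / m

theorem sum_range_mul_eq (f : ℤ → ℝ) (m n : ℕ) :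
    ∑ b ∈ range (m * n), f b = ∑ b ∈ range m, ∑ t ∈ range n, f (b + m * t) := by
  rw [sum_comm]
  induction n with
  | zero => simp
  | succ n ih =>
    rw [sum_range_succ, ← ih, Nat.mul_succ, sum_range_add]
    congr 1
    refine sum_congr rfl fun b _ => ?_
    push_cast
    ring_nf

theorem periodic_eq_of_modEq {f : ℤ → ℝ} {n : ℤ} (hf : Function.Periodic f n) {a b : ℤ}
    (h : a ≡ b [ZMOD n]) : f a = f b := by
  obtain ⟨k, hk⟩ := h.dvd
  have : b = a + k * n := by linarith
  rw [this]
  exact ((hf.int_mul k) a).symm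

theorem periodic_of_dvd {f : ℤ → ℝ} {m n : ℤ} (hf : Function.Periodic f m) (h : m ∣ n) :
    Function.Periodic f n := by
  obtain ⟨k, rfl⟩ := h
  intro a
  exact periodic_eq_of_modEq hf (by simp [Int.ModEq])

theorem sum_range_add_mul_of_periodic {f : ℤ → ℝ} {m n : ℕ} (hn : 0 < n)
    (hf : Function.Periodic f n) (hmn : Nat.Coprime m n) (a : ℤ) :
    ∑ t ∈ range n, f (a + m * t) = ∑ r ∈ range n, f r := by
  have hn' : (n : ℤ) ≠ 0 := by exact_mod_cast hn.ne'
  have hinj : Set.InjOn (fun t : ℕ => ((a + m * t) % n : ℤ).toNat) (range n : Set ℕ) := by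
    intro s hs t ht hst
    rw [coe_range, Set.mem_Iio] at hs ht
    have h1 : ((a + m * s) % n : ℤ) = (a + m * t) % n := by
      have := congrArg (fun k : ℕ => (k : ℤ)) hst
      simpa [Int.toNat_of_nonneg (Int.emod_nonneg _ hn')] using this
    have h2 : (m * s : ℤ) ≡ m * t [ZMOD n] := Int.ModEq.add_left_cancel' a h1
    have h3 : (m * s) ≡ m * t [MOD n] := by
      rw [← Int.natCast_modEq_iff]; push_cast; exact h2
    exact Nat.ModEq.eq_of_lt_of_lt (Nat.ModEq.cancel_left_of_coprime
      (by rwa [Nat.gcd_comm]) h3) hs ht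
  have himg : (range n).image (fun t : ℕ => ((a + m * t) % n : ℤ).toNat) = range n := by
    refine eq_of_subset_of_card_le (fun r hr => ?_) ?_
    · obtain ⟨t, _, rfl⟩ := mem_image.1 hr
      rw [mem_range, Int.toNat_lt (Int.emod_nonneg _ hn')]
      exact Int.emod_lt_of_pos _ (by exact_mod_cast hn)
    · rw [card_image_of_injOn hinj]
  conv_rhs => rw [← himg, sum_image hinj]
  refine sum_congr rfl fun t _ => ?_
  rw [Int.toNat_of_nonneg (Int.emod_nonneg _ hn')]
  exact periodic_eq_of_modEq hf (Int.mod_modEq _ _).symm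

theorem sum_range_prod_eq_prod_sum {S : Finset ℕ} (hS : ∀ p ∈ S, p.Prime) {g : ℕ → ℤ → ℝ}
    (hg : ∀ p ∈ S, Function.Periodic (g p) p) {m : ℕ} (hm : ∀ p ∈ S, Nat.Coprime m p) (b : ℤ) :
    ∑ t ∈ range (∏ p ∈ S, p), ∏ p ∈ S, g p (b + m * t) = ∏ p ∈ S, ∑ r ∈ range p, g p r := by
  induction S using Finset.induction_on with
  | empty => simp
  | insert p S hp ih =>
    rw [prod_insert hp, prod_insert hp, mul_comm p, sum_range_mul_eq
      (fun t => ∏ q ∈ insert p S, g q (b + m * t))]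
    have hpS := hS p (mem_insert_self _ _)
    have hcop : Nat.Coprime (m * ∏ q ∈ S, q) p :=
      Nat.Coprime.mul_left (hm p (mem_insert_self _ _)) (Nat.Coprime.prod_left fun q hq =>
        (Nat.coprime_primes (hS q (mem_insert_of_mem hq)) hpS).2 (by rintro rfl; exact hp hq))
    rw [← ih (fun q hq => hS q (mem_insert_of_mem hq)) (fun q hq => hg q (mem_insert_of_mem hq))
      (fun q hq => hm q (mem_insert_of_mem hq)), mul_comm, sum_mul]
    refine sum_congr rfl fun s _ => ?_
    rw [← sum_range_add_mul_of_periodic hpS.pos (hg p (mem_insert_self _ _)) hcop (b + m * s),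
      mul_sum]
    refine sum_congr rfl fun u _ => ?_
    rw [prod_insert hp, mul_comm]
    congr 1
    · refine prod_congr rfl fun q hq => ?_
      refine periodic_eq_of_modEq (hg q (mem_insert_of_mem hq)) ?_
      have : (q : ℤ) ∣ ∏ q ∈ S, (q : ℤ) := dvd_prod_of_mem _ hq
      refine (Int.modEq_iff_dvd.2 ?_)
      push_cast
      obtain ⟨k, hk⟩ := this
      rw [hk]
      exact ⟨-(m * k * u), by ring⟩
    · push_cast
      ring_nf

theorem avg_mul_prod_eq {S : Finset ℕ} (hS : ∀ p ∈ S, p.Prime) {W : ℕ}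
    (hW : ∀ p ∈ S, Nat.Coprime W p) {F : ℤ → ℝ} (hF : Function.Periodic F W)
    {g : ℤ → ℕ → ℤ → ℝ} (hgW : ∀ p b, Function.Periodic (fun c => g c p b) W)
    (hg : ∀ c, ∀ p ∈ S, Function.Periodic (g c p) p) :
    avg (W * ∏ p ∈ S, p) (fun b => F b * ∏ p ∈ S, g b p b) =
      avg W (fun b => F b * ∏ p ∈ S, avg p (g b p)) := by
  unfold avg
  rw [sum_range_mul_eq (fun b => F b * ∏ p ∈ S, g b p b)]
  push_cast
  rw [← div_div, div_right_comm, sum_div]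
  congr 1
  refine sum_congr rfl fun b _ => ?_
  rw [prod_div_distrib, ← sum_range_prod_eq_prod_sum hS (hg b) hW b, mul_div_assoc', mul_sum]
  congr 1
  refine sum_congr rfl fun t _ => ?_
  congr 1
  · exact periodic_eq_of_modEq hF (by simp [Int.ModEq])
  · refine prod_congr rfl fun p _ => ?_
    exact periodic_eq_of_modEq (f := fun c => g c p (b + W * t)) (hgW p _) (by simp [Int.ModEq])

theorem avg_mono {m : ℕ} {f g : ℤ → ℝ} (h : ∀ b, f b ≤ g b) : avg m f ≤ avg m g := by
  unfold avg
  gcongr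
  exact h _

theorem avg_nonneg {m : ℕ} {f : ℤ → ℝ} (h : ∀ b, 0 ≤ f b) : 0 ≤ avg m f :=
  div_nonneg (sum_nonneg fun _ _ => h _) (by positivity)

theorem avg_sum {ι : Type*} (s : Finset ι) (m : ℕ) (f : ι → ℤ → ℝ) :
    avg m (fun b => ∑ i ∈ s, f i b) = ∑ i ∈ s, avg m (f i) := by
  unfold avg
  rw [sum_comm, sum_div]

theorem avg_add (m : ℕ) (f g : ℤ → ℝ) :
    avg m (fun b => f b + g b) = avg m f + avg m g := by
  unfold avg
  rw [sum_add_distrib, add_div]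

theorem avg_sub (m : ℕ) (f g : ℤ → ℝ) :
    avg m (fun b => f b - g b) = avg m f - avg m g := by
  unfold avg
  rw [sum_sub_distrib, sub_div]

theorem avg_const_mul (m : ℕ) (c : ℝ) (f : ℤ → ℝ) :
    avg m (fun b => c * f b) = c * avg m f := by
  unfold avg
  rw [← mul_sum, mul_div_assoc]

theorem avg_const {m : ℕ} (hm : 0 < m) (c : ℝ) : avg m (fun _ => c) = c := by
  unfold avg
  have : (m : ℝ) ≠ 0 := by exact_mod_cast hm.ne'
  simp only [sum_const, card_range, nsmul_eq_mul]
  field_simp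

theorem avg_mul_eq_of_periodic {m n : ℕ} (hm : 0 < m) (hn : 0 < n) {f : ℤ → ℝ}
    (hf : Function.Periodic f m) : avg (m * n) f = avg m f := by
  unfold avg
  rw [sum_range_mul_eq]
  have : ∀ b ∈ range m, ∑ t ∈ range n, f (b + m * t) = n * f b := fun b _ => by
    rw [sum_congr rfl fun t _ => periodic_eq_of_modEq hf (b := b) (by simp [Int.ModEq])]
    simp
  rw [sum_congr rfl this, ← mul_sum]
  have h1 : (m : ℝ) ≠ 0 := by exact_mod_cast hm.ne'
  have h2 : (n : ℝ) ≠ 0 := by exact_mod_cast hn.ne'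
  push_cast
  field_simp

theorem sum_Ioc_le_of_periodic {f : ℤ → ℝ} {m : ℕ} (hm : 0 < m) (hf : Function.Periodic f m)
    (h0 : ∀ n, 0 ≤ f n) {a b : ℤ} (hab : a ≤ b) :
    ∑ n ∈ Ioc a b, f n ≤ ((b - a : ℝ) / m + 1) * ∑ r ∈ range m, f r := by
  obtain ⟨ℓ, rfl⟩ : ∃ ℓ : ℕ, b = a + ℓ := ⟨(b - a).toNat, by omega⟩
  have h1 : ∑ n ∈ Ioc a (a + ℓ), f n = ∑ i ∈ range ℓ, f (a + 1 + i) := by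
    symm
    refine sum_bij (fun i _ => a + 1 + i) ?_ ?_ ?_ ?_
    · intro i hi; rw [mem_range] at hi; rw [mem_Ioc]; omega
    · intro i _ j _ h; omega
    · intro n hn
      rw [mem_Ioc] at hn
      exact ⟨(n - a - 1).toNat, by rw [mem_range]; omega, by omega⟩
    · intros; rfl
  have h2 : ∑ i ∈ range ℓ, f (a + 1 + i) ≤ ∑ i ∈ range (m * (ℓ / m + 1)), f (a + 1 + i) := by
    refine sum_le_sum_of_subset_of_nonneg (range_subset_range.2 ?_) fun _ _ _ => h0 _
    have := Nat.div_add_mod ℓ m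
    have := Nat.mod_lt ℓ hm
    rw [Nat.mul_succ]; omega
  have h3 : ∑ i ∈ range (m * (ℓ / m + 1)), f (a + 1 + i) =
      ((ℓ / m + 1 : ℕ) : ℝ) * ∑ r ∈ range m, f r := by
    rw [sum_range_mul_eq (fun i => f (a + 1 + i)), sum_comm]
    rw [sum_congr rfl (g := fun _ => ∑ r ∈ range m, f r)]
    · simp
    · intro t _
      rw [← sum_range_add_mul_of_periodic hm hf (Nat.coprime_one_left m) (a + 1 + m * t)]
      refine sum_congr rfl fun i _ => ?_
      push_cast
      ring_nf
  rw [h1]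
  refine h2.trans ?_
  rw [h3]
  refine mul_le_mul_of_nonneg_right ?_ (sum_nonneg fun _ _ => h0 _)
  push_cast
  have : ((ℓ / m : ℕ) : ℝ) ≤ (ℓ : ℝ) / m := Nat.cast_div_le
  rw [add_sub_cancel_left]
  linarith

theorem periodic_prod_of_dvd {D : Finset ℕ} {g : ℕ → ℤ → ℝ}
    (hg : ∀ p ∈ D, Function.Periodic (g p) p) :
    Function.Periodic (fun n => ∏ p ∈ D, g p n) ((∏ p ∈ D, p : ℕ) : ℤ) := by
  intro n
  refine prod_congr rfl fun p hp => ?_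
  refine periodic_of_dvd (hg p hp) ?_ n
  exact_mod_cast dvd_prod_of_mem _ hp

theorem sum_Ioc_prod_le {S : Finset ℕ} (hS : ∀ p ∈ S, p.Prime) {g : ℕ → ℤ → ℝ}
    (hg : ∀ p ∈ S, Function.Periodic (g p) p) (h0 : ∀ p ∈ S, ∀ n, 0 ≤ g p n) {a b : ℤ}
    (hab : a ≤ b) :
    ∑ n ∈ Ioc a b, ∏ p ∈ S, (1 + g p n) ≤
      (b - a) * ∏ p ∈ S, (1 + avg p (g p)) + ∏ p ∈ S, (1 + ∑ r ∈ range p, g p r) := by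
  simp_rw [prod_one_add]
  rw [sum_comm, mul_sum, ← sum_add_distrib]
  refine sum_le_sum fun D hD => ?_
  rw [mem_powerset] at hD
  have hpos : 0 < ∏ p ∈ D, p := prod_pos fun p hp => (hS p (hD hp)).pos
  have := sum_Ioc_le_of_periodic (f := fun n => ∏ p ∈ D, g p n) hpos
    (periodic_prod_of_dvd fun p hp => hg p (hD hp))
    (fun n => prod_nonneg fun p hp => h0 p (hD hp) n) hab
  refine this.trans (le_of_eq ?_)
  have h1 := sum_range_prod_eq_prod_sum (S := D) (g := g) (m := 1) (fun p hp => hS p (hD hp))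
    (fun p hp => hg p (hD hp)) (fun p _ => Nat.coprime_one_left p) 0
  simp only [zero_add, Nat.cast_one, one_mul] at h1
  rw [h1]
  unfold avg
  rw [prod_div_distrib]
  push_cast
  ring

/-- The sieve weight attached to a finite set `A` of integers. -/
noncomputable def lamSet (w z : ℝ) (A : Finset ℤ) (b : ℤ) : ℝ :=
  if ∀ a ∈ A.filter (inS w b), inSBetween w z b a
  then sigBetween w z ^ (-((A.filter (inS w b)).card : ℤ)) else 0

/-- The indicator of the residues `r` avoided by `A` modulo `p`. -/
noncomputable def avoid (p : ℕ) (A : Finset ℤ) (r : ℤ) : ℝ :=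
  if ∀ a ∈ A, ¬ (p : ℤ) ∣ a - r then 1 else 0

/-- The number of pairs in `A × B` that are congruent modulo `p`. -/
noncomputable def coinc (p : ℕ) (A B : Finset ℤ) : ℕ :=
  ((A ×ˢ B).filter fun a => (p : ℤ) ∣ a.1 - a.2).card

theorem PP_pos (t : ℝ) : 0 < PP t := prod_pos fun _ hp => (mem_primesUpTo.1 hp).1.pos

theorem coprime_PP {w z : ℝ} {p : ℕ} (hp : p ∈ primesBetween w z) : Nat.Coprime (PP w) p := by
  have hp := mem_primesBetween.1 hp
  refine Nat.Coprime.prod_left fun q hq => ?_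
  have hq := mem_primesUpTo.1 hq
  refine (Nat.coprime_primes hq.1 hp.1).2 ?_
  rintro rfl
  linarith [hp.2.1, hq.2]

theorem inS_add_PP (w : ℝ) (b n : ℤ) : inS w (b + PP w) n ↔ inS w b n := by
  unfold inS
  refine forall_congr' fun p => forall_congr' fun hp => forall_congr' fun hpw => not_congr ?_
  have : (p : ℤ) ∣ PP w := by exact_mod_cast dvd_prod_of_mem _ (mem_primesUpTo.2 ⟨hp, hpw⟩)
  rw [← sub_sub]
  exact dvd_sub_left this

theorem filter_inS_add_PP (w : ℝ) (A : Finset ℤ) (b : ℤ) :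
    A.filter (inS w (b + PP w)) = A.filter (inS w b) :=
  filter_congr fun a _ => inS_add_PP w b a

theorem avoid_nonneg (p : ℕ) (A : Finset ℤ) (r : ℤ) : 0 ≤ avoid p A r := by
  unfold avoid; split_ifs <;> norm_num

theorem avoid_periodic (p : ℕ) (A : Finset ℤ) : Function.Periodic (avoid p A) p := by
  intro r
  unfold avoid
  congr 1
  refine propext (forall_congr' fun a => forall_congr' fun _ => not_congr ?_)
  rw [← sub_sub]
  exact dvd_sub_left (dvd_refl _)

theorem lamSet_nonneg (w z : ℝ) (A : Finset ℤ) (b : ℤ) : 0 ≤ lamSet w z A b := by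
  unfold lamSet
  split_ifs
  · exact zpow_nonneg (sigBetween_pos w z).le _
  · exact le_rfl

theorem lamSet_eq_prod (w z : ℝ) (A : Finset ℤ) (b : ℤ) :
    lamSet w z A b = ∏ p ∈ primesBetween w z, (avoid p (A.filter (inS w b)) b *
      ((1 - 1 / (p : ℝ))⁻¹) ^ (A.filter (inS w b)).card) := by
  rw [prod_mul_distrib, prod_pow, prod_inv_distrib]
  unfold lamSet avoid
  set B := A.filter (inS w b)
  by_cases h : ∀ a ∈ B, inSBetween w z b a
  · rw [if_pos h, prod_eq_one, one_mul, zpow_neg, zpow_natCast, inv_pow]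
    · rfl
    · intro p hp
      have hp := mem_primesBetween.1 hp
      exact if_pos fun a ha => h a ha p hp.1 hp.2.1 hp.2.2
  · rw [if_neg h]
    push Not at h
    obtain ⟨a, ha, h⟩ := h
    unfold inSBetween at h
    push Not at h
    obtain ⟨p, h1, h2, h3, h4⟩ := h
    rw [prod_eq_zero (mem_primesBetween.2 ⟨h1, h2, h3⟩), zero_mul]
    rw [if_neg]
    push Not
    exact ⟨a, ha, h4⟩

theorem sum_range_ite_dvd_sub {p : ℕ} (hp : 0 < p) (a : ℤ) :
    ∑ r ∈ range p, (if (p : ℤ) ∣ a - r then (1 : ℝ) else 0) = 1 := by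
  have hp' : (p : ℤ) ≠ 0 := by exact_mod_cast hp.ne'
  have h0 := Int.emod_nonneg a hp'
  have h1 := Int.emod_lt_of_pos a (b := p) (by exact_mod_cast hp)
  rw [sum_eq_single (a % p).toNat]
  · rw [if_pos]
    rw [Int.toNat_of_nonneg h0]
    exact Int.dvd_self_sub_emod
  · intro r hr hne
    rw [if_neg]
    intro hd
    rw [mem_range] at hr
    apply hne
    have : (r : ℤ) = a % p := by
      have h2 := (Int.emod_emod_of_dvd a (dvd_refl (p : ℤ)))
      have h3 := Int.emod_emod_of_dvd r (dvd_refl (p : ℤ))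
      have h4 : (r : ℤ) % p = a % p := Int.modEq_iff_dvd.2 hd
      rwa [Int.emod_eq_of_lt (by positivity) (by exact_mod_cast hr)] at h4
    omega
  · intro h
    exfalso
    apply h
    rw [mem_range]
    omega

theorem avoid_eq_one_sub {p : ℕ} {A : Finset ℤ}
    (hA : ∀ a ∈ A, ∀ a' ∈ A, (p : ℤ) ∣ a - a' → a = a') (r : ℤ) :
    avoid p A r = 1 - ∑ a ∈ A, if (p : ℤ) ∣ a - r then (1 : ℝ) else 0 := by
  unfold avoid
  split_ifs with h
  · rw [sum_eq_zero, sub_zero]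
    intro a ha
    exact if_neg (h a ha)
  · push Not at h
    obtain ⟨a, ha, hd⟩ := h
    rw [sum_eq_single_of_mem a ha, if_pos hd, sub_self]
    intro a' ha' hne
    rw [if_neg]
    intro hd'
    refine hne (hA a' ha' a ha ?_)
    have := dvd_sub hd' hd
    rwa [sub_sub_sub_cancel_right] at this

theorem avg_avoid {p : ℕ} (hp : 0 < p) {A : Finset ℤ}
    (hA : ∀ a ∈ A, ∀ a' ∈ A, (p : ℤ) ∣ a - a' → a = a') :
    avg p (avoid p A) = 1 - A.card / p := by
  rw [show avoid p A = fun r => 1 - ∑ a ∈ A, if (p : ℤ) ∣ a - r then (1 : ℝ) else 0 from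
    funext (avoid_eq_one_sub hA), avg_sub, avg_const hp, avg_sum]
  congr 1
  unfold avg
  simp only [sum_range_ite_dvd_sub hp, sum_const, nsmul_eq_mul]
  ring

theorem avg_avoid_mul_avoid_le {p : ℕ} (hp : 0 < p) {A B : Finset ℤ}
    (hA : ∀ a ∈ A, ∀ a' ∈ A, (p : ℤ) ∣ a - a' → a = a')
    (hB : ∀ a ∈ B, ∀ a' ∈ B, (p : ℤ) ∣ a - a' → a = a') :
    avg p (fun r => avoid p A r * avoid p B r) ≤
      1 - (A.card + B.card : ℕ) / p + coinc p A B / p := by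
  have hexp : (fun r => avoid p A r * avoid p B r) = fun r =>
      ((1 - ∑ a ∈ A, (if (p : ℤ) ∣ a - r then (1 : ℝ) else 0)) -
        ∑ a ∈ B, (if (p : ℤ) ∣ a - r then (1 : ℝ) else 0)) +
      ∑ a ∈ A ×ˢ B, (if (p : ℤ) ∣ a.1 - r then (1 : ℝ) else 0) *
        (if (p : ℤ) ∣ a.2 - r then (1 : ℝ) else 0) := by
    funext r
    rw [avoid_eq_one_sub hA, avoid_eq_one_sub hB, sum_product]
    have := sum_mul_sum A B (fun a => if (p : ℤ) ∣ a - r then (1 : ℝ) else 0)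
      (fun a => if (p : ℤ) ∣ a - r then (1 : ℝ) else 0)
    linarith
  rw [hexp, avg_add, avg_sub, avg_sub, avg_const hp, avg_sum, avg_sum, avg_sum]
  have h1 : ∀ C : Finset ℤ, ∑ a ∈ C, avg p (fun r => if (p : ℤ) ∣ a - r then (1 : ℝ) else 0) =
      C.card / p := fun C => by
    unfold avg
    simp only [sum_range_ite_dvd_sub hp, sum_const, nsmul_eq_mul]
    ring
  have h2 : ∑ a ∈ A ×ˢ B, avg p (fun r => (if (p : ℤ) ∣ a.1 - r then (1 : ℝ) else 0) *
        (if (p : ℤ) ∣ a.2 - r then (1 : ℝ) else 0)) ≤ coinc p A B / p := by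
    unfold coinc
    rw [card_filter]
    push_cast
    rw [sum_div]
    refine sum_le_sum fun a _ => ?_
    unfold avg
    gcongr
    split_ifs with h
    · refine le_trans (sum_le_sum fun r _ => ?_) (sum_range_ite_dvd_sub hp a.1).le
      dsimp only
      split_ifs <;> norm_num
    · refine le_of_eq (sum_eq_zero fun r _ => ?_)
      dsimp only
      split_ifs with h3 h4
      · exfalso
        apply h
        have := dvd_sub h3 h4
        rwa [sub_sub_sub_cancel_right] at this
      all_goals norm_num
  rw [h1, h1]
  push_cast
  rw [add_div]
  linarith

theorem one_sub_mul_le_pow {p : ℕ} (hp : 2 ≤ p) (k : ℕ) :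
    1 - (k : ℝ) / p ≤ (1 - 1 / (p : ℝ)) ^ k := by
  have hp2 : (2 : ℝ) ≤ p := by exact_mod_cast hp
  have h := one_add_mul_le_pow (a := -(1 / (p : ℝ))) (by
    have : 1 / (p : ℝ) ≤ 1 / 2 := one_div_le_one_div_of_le (by norm_num) hp2
    linarith) k
  rw [← sub_eq_add_neg] at h
  refine le_trans (le_of_eq ?_) h
  ring

theorem one_sub_one_div_pos {p : ℕ} (hp : 2 ≤ p) : 0 < 1 - 1 / (p : ℝ) := by
  have hp2 : (2 : ℝ) ≤ p := by exact_mod_cast hp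
  have : 1 / (p : ℝ) ≤ 1 / 2 := one_div_le_one_div_of_le (by norm_num) hp2
  linarith

theorem one_sub_sum_le_prod_one_sub {ι : Type*} {s : Finset ι} {f : ι → ℝ}
    (h0 : ∀ i ∈ s, 0 ≤ f i) (h1 : ∀ i ∈ s, f i ≤ 1) : 1 - ∑ i ∈ s, f i ≤ ∏ i ∈ s, (1 - f i) := by
  induction s using Finset.induction_on with
  | empty => simp
  | insert i s hi ih =>
    rw [sum_insert hi, prod_insert hi]
    have hs := ih (fun j hj => h0 j (mem_insert_of_mem hj)) fun j hj => h1 j (mem_insert_of_mem hj)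
    have hi0 := h0 i (mem_insert_self _ _)
    have hi1 := h1 i (mem_insert_self _ _)
    have hsum : 0 ≤ ∑ j ∈ s, f j := sum_nonneg fun j hj => h0 j (mem_insert_of_mem hj)
    nlinarith [mul_le_mul_of_nonneg_left hs (sub_nonneg.2 hi1)]

theorem inS_periodic (w : ℝ) (b n : ℤ) : inS w (b + PP w) n = inS w b n :=
  propext (inS_add_PP w b n)

section Moments

variable {w z : ℝ} {A B : Finset ℤ} {F : ℤ → ℝ}

theorem avg_mul_lamSet_eq (hwz : w ≤ z) (hF : Function.Periodic F (PP w))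
    (hA : ∀ p ∈ primesBetween w z, ∀ a ∈ A, ∀ a' ∈ A, (p : ℤ) ∣ a - a' → a = a') :
    avg (PP z) (fun b => F b * lamSet w z A b) =
      avg (PP w) (fun b => F b * ∏ p ∈ primesBetween w z,
        ((1 - ((A.filter (inS w b)).card : ℝ) / p) *
          ((1 - 1 / (p : ℝ))⁻¹) ^ (A.filter (inS w b)).card)) := by
  simp_rw [lamSet_eq_prod]
  rw [PP_eq_mul hwz, avg_mul_prod_eq (g := fun c p b => avoid p (A.filter (inS w c)) b *
      ((1 - 1 / (p : ℝ))⁻¹) ^ (A.filter (inS w c)).card)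
      (fun p hp => (mem_primesBetween.1 hp).1) (fun p hp => coprime_PP hp) hF]
  · congr 1
    funext b
    congr 1
    refine prod_congr rfl fun p hp => ?_
    rw [← avg_avoid (mem_primesBetween.1 hp).1.pos (A := A.filter (inS w b))
      fun a ha a' ha' => hA p hp a (mem_filter.1 ha).1 a' (mem_filter.1 ha').1]
    simp_rw [mul_comm _ (_ ^ _)]
    rw [avg_const_mul]
  · intro p b c
    simp only [filter_inS_add_PP]
  · intro c p _ b
    simp only [avoid_periodic p _ b]

theorem le_avg_mul_lamSet (hwz : w ≤ z) (hw : 1 ≤ w) (hF : Function.Periodic F (PP w))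
    (hF0 : ∀ b, 0 ≤ F b)
    (hA : ∀ p ∈ primesBetween w z, ∀ a ∈ A, ∀ a' ∈ A, (p : ℤ) ∣ a - a' → a = a')
    {k : ℕ} (hAk : A.card ≤ k) (hk : ∀ p ∈ primesBetween w z, k ≤ p) :
    (1 - 2 * (k : ℝ) ^ 2 / w) * avg (PP w) F ≤ avg (PP z) (fun b => F b * lamSet w z A b) := by
  rw [avg_mul_lamSet_eq hwz hF hA, ← avg_const_mul]
  refine avg_mono fun b => ?_
  rw [mul_comm]
  refine mul_le_mul_of_nonneg_left ?_ (hF0 b)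
  set j := (A.filter (inS w b)).card
  have hjk : (j : ℝ) ≤ k := by exact_mod_cast (card_filter_le _ _).trans hAk
  have h1 : ∀ p ∈ primesBetween w z, 1 - (k : ℝ) ^ 2 / (p : ℝ) ^ 2 ≤
      (1 - (j : ℝ) / p) * ((1 - 1 / (p : ℝ))⁻¹) ^ j := by
    intro p hp
    have hp2 := (mem_primesBetween.1 hp).1.two_le
    have hpos := one_sub_one_div_pos hp2
    have hp0 : (0 : ℝ) < p := by positivity
    have hjp : (j : ℝ) / p ≤ 1 := (div_le_one hp0).2 (hjk.trans (by exact_mod_cast hk p hp))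
    have hinv : 1 + 1 / (p : ℝ) ≤ (1 - 1 / (p : ℝ))⁻¹ := by
      rw [← one_div, le_div_iff₀ hpos]
      nlinarith [sq_nonneg (1 / (p : ℝ))]
    have hpow : 1 + (j : ℝ) / p ≤ ((1 - 1 / (p : ℝ))⁻¹) ^ j := by
      calc _ = 1 + (j : ℝ) * (1 / p) := by ring
        _ ≤ (1 + 1 / (p : ℝ)) ^ j := one_add_mul_le_pow (by
            have : 0 ≤ 1 / (p : ℝ) := by positivity
            linarith) j
        _ ≤ _ := pow_le_pow_left₀ (by positivity) hinv j
    calc 1 - (k : ℝ) ^ 2 / (p : ℝ) ^ 2 ≤ 1 - (j : ℝ) ^ 2 / (p : ℝ) ^ 2 := by gcongr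
      _ = (1 - (j : ℝ) / p) * (1 + (j : ℝ) / p) := by ring
      _ ≤ _ := mul_le_mul_of_nonneg_left hpow (by linarith)
  have hkp : ∀ p ∈ primesBetween w z, (k : ℝ) ^ 2 / (p : ℝ) ^ 2 ≤ 1 := by
    intro p hp
    have hp2 := (mem_primesBetween.1 hp).1.pos
    rw [← div_pow]
    refine pow_le_one₀ (by positivity) ((div_le_one (by positivity)).2 ?_)
    exact_mod_cast hk p hp
  calc 1 - 2 * (k : ℝ) ^ 2 / w ≤ 1 - ∑ p ∈ primesBetween w z, (k : ℝ) ^ 2 / (p : ℝ) ^ 2 := by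
        have := mul_le_mul_of_nonneg_left (sum_primesBetween_inv_sq_le (z := z) hw)
          (sq_nonneg (k : ℝ))
        rw [mul_sum] at this
        have e : ∑ p ∈ primesBetween w z, (k : ℝ) ^ 2 / (p : ℝ) ^ 2 =
            ∑ p ∈ primesBetween w z, (k : ℝ) ^ 2 * (1 / (p : ℝ) ^ 2) :=
          sum_congr rfl fun p _ => by ring
        rw [e]
        have e2 : 2 * (k : ℝ) ^ 2 / w = (k : ℝ) ^ 2 * (2 / w) := by ring
        linarith
    _ ≤ ∏ p ∈ primesBetween w z, (1 - (k : ℝ) ^ 2 / (p : ℝ) ^ 2) :=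
        one_sub_sum_le_prod_one_sub (fun p hp => by positivity) hkp
    _ ≤ _ := prod_le_prod (fun p hp => by linarith [hkp p hp]) h1

theorem avg_mul_lamSet_mul_lamSet_le (hwz : w ≤ z) (hF : Function.Periodic F (PP w))
    (hF0 : ∀ b, 0 ≤ F b)
    (hA : ∀ p ∈ primesBetween w z, ∀ a ∈ A, ∀ a' ∈ A, (p : ℤ) ∣ a - a' → a = a')
    (hB : ∀ p ∈ primesBetween w z, ∀ a ∈ B, ∀ a' ∈ B, (p : ℤ) ∣ a - a' → a = a')
    {k : ℕ} (hAk : A.card ≤ k) (hBk : B.card ≤ k) (hk : ∀ p ∈ primesBetween w z, 4 * k ≤ p) :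
    avg (PP z) (fun b => F b * (lamSet w z A b * lamSet w z B b)) ≤
      avg (PP w) F * ∏ p ∈ primesBetween w z, (1 + 2 * (coinc p A B : ℝ) / p) := by
  simp_rw [lamSet_eq_prod, ← prod_mul_distrib]
  rw [PP_eq_mul hwz, avg_mul_prod_eq (g := fun c p b => avoid p (A.filter (inS w c)) b *
      ((1 - 1 / (p : ℝ))⁻¹) ^ (A.filter (inS w c)).card * (avoid p (B.filter (inS w c)) b *
      ((1 - 1 / (p : ℝ))⁻¹) ^ (B.filter (inS w c)).card))
      (fun p hp => (mem_primesBetween.1 hp).1) (fun p hp => coprime_PP hp) hF]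
  · rw [mul_comm (avg _ _), ← avg_const_mul]
    refine avg_mono fun b => ?_
    rw [mul_comm (∏ _ ∈ _, _)]
    refine mul_le_mul_of_nonneg_left (prod_le_prod (fun p hp => ?_) fun p hp => ?_) (hF0 b)
    · have hpos := one_sub_one_div_pos (mem_primesBetween.1 hp).1.two_le
      exact avg_nonneg fun r => mul_nonneg (mul_nonneg (avoid_nonneg _ _ _) (by positivity))
        (mul_nonneg (avoid_nonneg _ _ _) (by positivity))
    have hp2 := (mem_primesBetween.1 hp).1.two_le
    have hpos := one_sub_one_div_pos hp2
    have hp0 : (0 : ℝ) < p := by positivity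
    set A' := A.filter (inS w b)
    set B' := B.filter (inS w b)
    have hle := avg_avoid_mul_avoid_le (mem_primesBetween.1 hp).1.pos (A := A') (B := B')
      (fun a ha a' ha' => hA p hp a (mem_filter.1 ha).1 a' (mem_filter.1 ha').1)
      (fun a ha a' ha' => hB p hp a (mem_filter.1 ha).1 a' (mem_filter.1 ha').1)
    have hc : coinc p A' B' ≤ coinc p A B := by
      unfold coinc
      exact card_le_card (filter_subset_filter _
        (product_subset_product (filter_subset _ _) (filter_subset _ _)))
    have e : (fun r => avoid p A' r * ((1 - 1 / (p : ℝ))⁻¹) ^ A'.card *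
        (avoid p B' r * ((1 - 1 / (p : ℝ))⁻¹) ^ B'.card)) =
        fun r => ((1 - 1 / (p : ℝ))⁻¹) ^ (A'.card + B'.card) *
          (avoid p A' r * avoid p B' r) := by
      funext r
      rw [pow_add]
      ring
    rw [e, avg_const_mul, inv_pow, ← div_eq_inv_mul, div_le_iff₀ (by positivity)]
    set j := A'.card + B'.card
    have hj : 2 * j ≤ p := by
      have h1 : A'.card ≤ k := (card_filter_le _ _).trans hAk
      have h2 : B'.card ≤ k := (card_filter_le _ _).trans hBk
      have := hk p hp
      omega
    have hB1 := one_sub_mul_le_pow hp2 j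
    have hhalf : (j : ℝ) / p ≤ 1 / 2 := by
      rw [div_le_div_iff₀ hp0 (by norm_num)]
      have : (2 : ℝ) * j ≤ p := by exact_mod_cast hj
      linarith
    have hc' : (coinc p A' B' : ℝ) / p ≤ coinc p A B / p := by gcongr
    have hc0 : 0 ≤ (coinc p A B : ℝ) / p := by positivity
    calc _ ≤ 1 - (j : ℝ) / p + coinc p A B / p := by linarith
      _ ≤ (1 - 1 / (p : ℝ)) ^ j + 2 * (coinc p A B / p) * (1 - 1 / (p : ℝ)) ^ j := by nlinarith
      _ = _ := by ring
  · intro p b c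
    simp only [filter_inS_add_PP]
  · intro c p _ b
    simp only [avoid_periodic p _ b]

end Moments

/-- The indicator of the sifted set. -/
noncomputable def oneS (t : ℝ) (b n : ℤ) : ℝ := if inS t b n then 1 else 0

theorem oneS_nonneg (t : ℝ) (b n : ℤ) : 0 ≤ oneS t b n := by
  unfold oneS; split_ifs <;> norm_num

theorem oneS_le_one (t : ℝ) (b n : ℤ) : oneS t b n ≤ 1 := by
  unfold oneS; split_ifs <;> norm_num

theorem oneS_periodic (w : ℝ) (n : ℤ) : Function.Periodic (fun b => oneS w b n) (PP w) := by
  intro b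
  simp only [oneS, inS_periodic]

theorem inS_iff {w z : ℝ} (hwz : w ≤ z) (b n : ℤ) :
    inS z b n ↔ inS w b n ∧ inSBetween w z b n := by
  constructor
  · exact fun h => ⟨fun p hp hpw => h p hp (hpw.trans hwz), fun p hp _ hpz => h p hp hpz⟩
  · intro h p hp hpz
    rcases le_or_gt (p : ℝ) w with h1 | h1
    · exact h.1 p hp h1
    · exact h.2 p hp h1 hpz

theorem oneS_mul_lamSet {w z : ℝ} (hwz : w ≤ z) {A : Finset ℤ} {n : ℤ} (hn : n ∈ A) (b : ℤ) :
    oneS z b n * lamSet w z A b = oneS w b n * lamSet w z A b := by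
  by_cases h : inS w b n
  · by_cases h2 : inSBetween w z b n
    · unfold oneS
      rw [if_pos h, if_pos ((inS_iff hwz b n).2 ⟨h, h2⟩)]
    · unfold lamSet
      rw [if_neg (fun h3 => h2 (h3 n (mem_filter.2 ⟨hn, h⟩))), mul_zero, mul_zero]
  · unfold oneS
    rw [if_neg h, if_neg fun h2 => h ((inS_iff hwz b n).1 h2).1]

theorem oneS_eq {w z : ℝ} (hwz : w ≤ z) (n b : ℤ) :
    oneS z b n = sigBetween w z * (oneS w b n * lamSet w z {n} b) := by
  have hs := (sigBetween_pos w z).ne'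
  by_cases h : inS w b n
  · by_cases h2 : inSBetween w z b n
    · unfold oneS lamSet
      rw [if_pos h, if_pos ((inS_iff hwz b n).2 ⟨h, h2⟩), if_pos]
      · rw [filter_singleton, if_pos h, card_singleton]
        simp [hs]
      · intro a ha
        rw [mem_singleton.1 (mem_filter.1 ha).1]
        exact h2
    · have hlam : lamSet w z {n} b = 0 :=
        if_neg fun h3 => h2 (h3 n (mem_filter.2 ⟨mem_singleton_self n, h⟩))
      rw [hlam, mul_zero, mul_zero, oneS, if_neg fun h3 => h2 ((inS_iff hwz b n).1 h3).2]
  · unfold oneS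
    rw [if_neg h, if_neg fun h2 => h ((inS_iff hwz b n).1 h2).1]
    simp

theorem oneS_mul_lamSet_mul_lamSet {w z : ℝ} (hwz : w ≤ z) {A B : Finset ℤ} {n : ℤ} (hn : n ∈ A)
    (hn' : n ∈ B) (b : ℤ) :
    oneS z b n * (lamSet w z A b * lamSet w z B b) =
      (sigBetween w z)⁻¹ * (oneS w b n * (lamSet w z A b * lamSet w z (B.erase n) b)) := by
  have hs := (sigBetween_pos w z).ne'
  by_cases h : inS w b n
  · by_cases h2 : inSBetween w z b n
    · unfold oneS
      rw [if_pos h, if_pos ((inS_iff hwz b n).2 ⟨h, h2⟩)]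
      have : lamSet w z B b = (sigBetween w z)⁻¹ * lamSet w z (B.erase n) b := by
        have hB : B.filter (inS w b) = insert n ((B.erase n).filter (inS w b)) := by
          rw [filter_erase, insert_erase (mem_filter.2 ⟨hn', h⟩)]
        have hcard : (B.filter (inS w b)).card = ((B.erase n).filter (inS w b)).card + 1 := by
          rw [hB, card_insert_of_notMem]
          simp
        have hiff : (∀ a ∈ B.filter (inS w b), inSBetween w z b a) ↔
            ∀ a ∈ (B.erase n).filter (inS w b), inSBetween w z b a := by
          rw [hB, forall_mem_insert]
          exact and_iff_right h2
        unfold lamSet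
        simp only [hiff, hcard]
        split_ifs
        · push_cast
          rw [neg_add, add_comm, zpow_add₀ hs, zpow_neg_one]
        · rw [mul_zero]
      rw [this]
      ring
    · unfold lamSet
      rw [if_neg (fun h3 => h2 (h3 n (mem_filter.2 ⟨hn, h⟩)))]
      simp
  · unfold oneS
    rw [if_neg h, if_neg fun h2 => h ((inS_iff hwz b n).1 h2).1]
    simp

theorem avg_oneS {z : ℝ} (hz : 1 ≤ z) (n : ℤ) : avg (PP z) (fun b => oneS z b n) = sigUpTo z := by
  have hP1 : primesUpTo 1 = ∅ := by
    refine eq_empty_of_forall_notMem fun p hp => ?_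
    have hp := mem_primesUpTo.1 hp
    have : (2 : ℝ) ≤ p := by exact_mod_cast hp.1.two_le
    linarith [hp.2]
  have hinS : ∀ b m, inS 1 b m := fun b m p hp hp1 => by
    have : (2 : ℝ) ≤ p := by exact_mod_cast hp.two_le
    linarith
  simp_rw [oneS_eq hz]
  rw [avg_const_mul, avg_mul_lamSet_eq hz (oneS_periodic 1 n)]
  · have h1 : sigUpTo z = sigBetween 1 z := by
      rw [sigUpTo_eq_mul hz, sigUpTo, hP1, prod_empty, one_mul]
    rw [h1]
    have : (fun b => oneS 1 b n * ∏ p ∈ primesBetween 1 z,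
        ((1 - ((({n} : Finset ℤ).filter (inS 1 b)).card : ℝ) / p) *
          ((1 - 1 / (p : ℝ))⁻¹) ^ (({n} : Finset ℤ).filter (inS 1 b)).card)) = fun _ => 1 := by
      funext b
      rw [filter_true_of_mem fun a _ => hinS b a, card_singleton, oneS, if_pos (hinS b n), one_mul]
      refine prod_eq_one fun p hp => ?_
      have := one_sub_one_div_pos (mem_primesBetween.1 hp).1.two_le
      rw [pow_one, Nat.cast_one, mul_inv_cancel₀ this.ne']
    rw [this, avg_const (PP_pos 1), mul_one]
  · intro p _ a ha a' ha' _
    rw [mem_singleton.1 ha, mem_singleton.1 ha']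

theorem lamSet_periodic {w z : ℝ} (hwz : w ≤ z) (A : Finset ℤ) :
    Function.Periodic (lamSet w z A) (PP z) := by
  intro b
  have hd : (PP w : ℤ) ∣ PP z := by
    rw [PP_eq_mul hwz]; push_cast; exact dvd_mul_right _ _
  have h1 : A.filter (inS w (b + PP z)) = A.filter (inS w b) := by
    refine filter_congr fun a _ => ?_
    unfold inS
    refine forall_congr' fun p => forall_congr' fun hp => forall_congr' fun hpw => not_congr ?_
    have : (p : ℤ) ∣ PP w := by exact_mod_cast dvd_prod_of_mem _ (mem_primesUpTo.2 ⟨hp, hpw⟩)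
    rw [← sub_sub]
    exact dvd_sub_left (this.trans hd)
  have h2 : ∀ a, inSBetween w z (b + PP z) a ↔ inSBetween w z b a := fun a => by
    unfold inSBetween
    refine forall_congr' fun p => forall_congr' fun hp => forall_congr' fun _ =>
      forall_congr' fun hpz => not_congr ?_
    have : (p : ℤ) ∣ PP z := by exact_mod_cast dvd_prod_of_mem _ (mem_primesUpTo.2 ⟨hp, hpz⟩)
    rw [← sub_sub]
    exact dvd_sub_left this
  unfold lamSet
  simp only [h1, h2]

/-- A Chebyshev-type inequality for averages. -/
theorem avg_sq_sub_le {m : ℕ} {G Z : ℤ → ℝ} {c E₀ E₁ E₂ : ℝ} (hc : 0 ≤ c)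
    (h0 : avg m G ≤ E₀) (h1 : E₁ ≤ avg m (fun b => G b * Z b))
    (h2 : avg m (fun b => G b * Z b ^ 2) ≤ E₂) :
    avg m (fun b => G b * (Z b - c) ^ 2) ≤ E₂ - 2 * c * E₁ + c ^ 2 * E₀ := by
  have e : (fun b => G b * (Z b - c) ^ 2) = fun b =>
      (G b * Z b ^ 2 - (2 * c) * (G b * Z b)) + c ^ 2 * G b := by
    funext b; ring
  rw [e, avg_add, avg_sub, avg_const_mul, avg_const_mul]
  have := mul_le_mul_of_nonneg_left h1 (by positivity : 0 ≤ 2 * c)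
  have := mul_le_mul_of_nonneg_left h0 (sq_nonneg c)
  linarith

theorem ite_dvd_sub_periodic (p : ℕ) (r : ℤ) :
    Function.Periodic (fun n : ℤ => if (p : ℤ) ∣ n - r then (1 : ℝ) else 0) p := by
  intro n
  have : (p : ℤ) ∣ n + p - r ↔ (p : ℤ) ∣ n - r := by
    rw [add_sub_right_comm]
    exact Int.dvd_add_left (dvd_refl _)
  simp only [this]

theorem exp_le_one_add_two_mul {t : ℝ} (h0 : 0 ≤ t) (h1 : t ≤ 1) : Real.exp t ≤ 1 + 2 * t := by
  have := Real.abs_exp_sub_one_le (x := t) (by rwa [abs_of_nonneg h0])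
  rw [abs_of_nonneg h0] at this
  linarith [le_abs_self (Real.exp t - 1)]

/-- Moments, over an interval, of an additive function counting congruence conditions. -/
theorem sum_Ioc_pow_le {S : Finset ℕ} (hS : ∀ p ∈ S, p.Prime) {α : ℕ → ℝ}
    (hα0 : ∀ p ∈ S, 0 ≤ α p) (hα1 : ∀ p ∈ S, α p ≤ 1) (r : ℕ → ℤ) {a b : ℤ} (hab : a ≤ b) (m : ℕ) :
    ∑ n ∈ Ioc a b, (∑ p ∈ S, α p * if (p : ℤ) ∣ n - r p then (1 : ℝ) else 0) ^ m ≤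
      (b - a) * (m.factorial * Real.exp (∑ p ∈ S, 2 * α p / p)) + (S.card : ℝ) ^ m := by
  set A : ℤ → ℝ := fun n => ∑ p ∈ S, α p * if (p : ℤ) ∣ n - r p then (1 : ℝ) else 0 with hA
  set φ : (Fin m → ℕ) → ℤ → ℝ := fun f n =>
    ∏ i, (α (f i) * if ((f i : ℕ) : ℤ) ∣ n - r (f i) then (1 : ℝ) else 0) with hφ
  have hexp : ∀ n, A n ^ m = ∑ f ∈ Fintype.piFinset (fun _ : Fin m => S), φ f n := fun n => by
    rw [hφ, ← prod_univ_sum (t := fun _ : Fin m => S)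
      (f := fun _ p => α p * if (p : ℤ) ∣ n - r p then (1 : ℝ) else 0)]
    simp [hA]
  have hba : (0 : ℝ) ≤ b - a := by
    have : (a : ℝ) ≤ b := by exact_mod_cast hab
    linarith
  have hterm : ∀ f ∈ Fintype.piFinset (fun _ : Fin m => S),
      ∑ n ∈ Ioc a b, φ f n ≤ (b - a) * avg (∏ p ∈ S, p) (φ f) + 1 := by
    intro f hf
    rw [Fintype.mem_piFinset] at hf
    set D := univ.image f with hD
    have hDS : D ⊆ S := fun p hp => by
      obtain ⟨i, _, rfl⟩ := mem_image.1 hp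
      exact hf i
    have hDpos : 0 < ∏ p ∈ D, p := prod_pos fun p hp => (hS p (hDS hp)).pos
    have hper : Function.Periodic (φ f) ((∏ p ∈ D, p : ℕ) : ℤ) := by
      intro n
      refine prod_congr rfl fun i _ => ?_
      congr 1
      refine periodic_of_dvd (ite_dvd_sub_periodic (f i) (r (f i))) ?_ n
      exact_mod_cast dvd_prod_of_mem _ (mem_image_of_mem f (mem_univ i))
    have h0 : ∀ n, 0 ≤ φ f n := fun n => prod_nonneg fun i _ =>
      mul_nonneg (hα0 _ (hf i)) (by split_ifs <;> norm_num)
    have hle1 : ∀ n, φ f n ≤ if ∀ p ∈ D, (p : ℤ) ∣ n - r p then 1 else 0 := by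
      intro n
      split_ifs with h
      · refine prod_le_one (fun i _ => mul_nonneg (hα0 _ (hf i)) (by split_ifs <;> norm_num))
          fun i _ => ?_
        have := hα1 _ (hf i)
        split_ifs <;> linarith
      · push Not at h
        obtain ⟨p, hp, hnd⟩ := h
        obtain ⟨i, _, rfl⟩ := mem_image.1 hp
        refine le_of_eq (prod_eq_zero (mem_univ i) ?_)
        rw [if_neg hnd, mul_zero]
    have hsum1 : ∑ n ∈ range (∏ p ∈ D, p), φ f n ≤ 1 := by
      refine (sum_le_sum fun (n : ℕ) _ => hle1 (n : ℤ)).trans ?_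
      rw [← sum_filter, sum_const, nsmul_eq_mul, mul_one]
      norm_cast
      rw [card_le_one]
      intro n hn n' hn'
      rw [mem_filter, mem_range] at hn hn'
      have hd : ((∏ p ∈ D, p : ℕ) : ℤ) ∣ (n : ℤ) - n' := by
        push_cast
        refine Finset.prod_dvd_of_coprime (fun p hp q hq hpq => ?_) fun p hp => ?_
        · exact Nat.isCoprime_iff_coprime.2
            ((Nat.coprime_primes (hS p (hDS hp)) (hS q (hDS hq))).2 hpq)
        · have := dvd_sub (hn.2 p hp) (hn'.2 p hp)
          rwa [sub_sub_sub_cancel_right] at this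
      have := (Nat.modEq_iff_dvd.2 hd).symm
      exact (Nat.ModEq.eq_of_lt_of_lt this hn.1 hn'.1)
    have havg : avg (∏ p ∈ S, p) (φ f) = avg (∏ p ∈ D, p) (φ f) := by
      rw [← prod_sdiff hDS, mul_comm, avg_mul_eq_of_periodic hDpos _ hper]
      exact prod_pos fun p hp => (hS p (mem_sdiff.1 hp).1).pos
    refine (sum_Ioc_le_of_periodic hDpos hper h0 hab).trans ?_
    rw [havg]
    unfold avg
    have e : ((b - a : ℝ) / (∏ p ∈ D, p : ℕ) + 1) * ∑ n ∈ range (∏ p ∈ D, p), φ f n =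
        (b - a) * ((∑ n ∈ range (∏ p ∈ D, p), φ f n) / (∏ p ∈ D, p : ℕ)) +
          ∑ n ∈ range (∏ p ∈ D, p), φ f n := by ring
    rw [e]
    linarith
  have h1 : ∑ n ∈ Ioc a b, A n ^ m ≤ (b - a) * avg (∏ p ∈ S, p) (fun n => A n ^ m) +
      (S.card : ℝ) ^ m := by
    simp_rw [hexp]
    rw [sum_comm, avg_sum, mul_sum]
    refine (sum_le_sum hterm).trans (le_of_eq ?_)
    rw [sum_add_distrib, sum_const, Fintype.card_piFinset]
    simp
  refine h1.trans ?_
  have hA0 : ∀ n, 0 ≤ A n := fun n => sum_nonneg fun p hp =>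
    mul_nonneg (hα0 p hp) (by split_ifs <;> norm_num)
  have h2 : avg (∏ p ∈ S, p) (fun n => A n ^ m) ≤
      m.factorial * avg (∏ p ∈ S, p) (fun n => Real.exp (A n)) := by
    rw [← avg_const_mul]
    refine avg_mono fun n => ?_
    have := Real.pow_div_factorial_le_exp _ (hA0 n) m
    rw [div_le_iff₀ (by positivity)] at this
    linarith
  have h3 : avg (∏ p ∈ S, p) (fun n => Real.exp (A n)) ≤ Real.exp (∑ p ∈ S, 2 * α p / p) := by
    have hprod : ∀ n, Real.exp (A n) =
        ∏ p ∈ S, Real.exp (α p * if (p : ℤ) ∣ n - r p then (1 : ℝ) else 0) := fun n => by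
      rw [hA, ← Real.exp_sum]
    simp_rw [hprod]
    unfold avg
    have h4 := sum_range_prod_eq_prod_sum (S := S) (m := 1) hS
      (g := fun p n => Real.exp (α p * if (p : ℤ) ∣ n - r p then (1 : ℝ) else 0))
      (fun p _ n => by
        have := ite_dvd_sub_periodic p (r p) n
        simp only at this ⊢
        rw [this]) (fun p _ => Nat.coprime_one_left p) 0
    simp only [zero_add, Nat.cast_one, one_mul] at h4
    rw [h4]
    push_cast
    rw [← prod_div_distrib, Real.exp_sum]
    refine prod_le_prod (fun p _ => by positivity) fun p hp => ?_
    have hp0 := (hS p hp).pos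
    have hp0' : (0 : ℝ) < p := by positivity
    have h5 : ∀ n : ℕ, Real.exp (α p * if (p : ℤ) ∣ n - r p then (1 : ℝ) else 0) ≤
        1 + 2 * α p * if (p : ℤ) ∣ r p - n then (1 : ℝ) else 0 := fun n => by
      simp only [dvd_sub_comm (b := (n : ℤ))]
      split_ifs
      · have := exp_le_one_add_two_mul (hα0 p hp) (hα1 p hp)
        simpa using this
      · simp
    have h6 : ∑ n ∈ range p, Real.exp (α p * if (p : ℤ) ∣ n - r p then (1 : ℝ) else 0) ≤
        p + 2 * α p := by
      refine (sum_le_sum fun n _ => h5 n).trans (le_of_eq ?_)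
      rw [sum_add_distrib, ← mul_sum, sum_range_ite_dvd_sub hp0]
      simp
    calc _ ≤ (p + 2 * α p) / (p : ℝ) := by gcongr
      _ = 2 * α p / p + 1 := by field_simp; ring
      _ ≤ _ := Real.add_one_le_exp _
  have h4 : avg (∏ p ∈ S, p) (fun n => A n ^ m) ≤
      m.factorial * Real.exp (∑ p ∈ S, 2 * α p / p) :=
    h2.trans (mul_le_mul_of_nonneg_left h3 (by positivity))
  have := mul_le_mul_of_nonneg_left h4 hba
  linarith

/-- Average of a product of factors counting congruence conditions, over an interval. -/
theorem sum_Ioc_prod_one_add_le {S : Finset ℕ} (hS : ∀ p ∈ S, p.Prime) {ι : Type*} (J : Finset ι)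
    (r : ℕ → ι → ℤ) {t : ℝ} (ht : 0 ≤ t) {a b : ℤ} (hab : a ≤ b) :
    ∑ n ∈ Ioc a b, ∏ p ∈ S,
        (1 + t / p * ∑ j ∈ J, if (p : ℤ) ∣ n - r p j then (1 : ℝ) else 0) ≤
      (b - a) * Real.exp (t * J.card * ∑ p ∈ S, 1 / (p : ℝ) ^ 2) +
        Real.exp (t * J.card * ∑ p ∈ S, 1 / (p : ℝ)) := by
  have hba : (0 : ℝ) ≤ b - a := by
    have : (a : ℝ) ≤ b := by exact_mod_cast hab
    linarith
  have hsum : ∀ p ∈ S, ∑ n ∈ range p, (t / p * ∑ j ∈ J, if (p : ℤ) ∣ (n : ℤ) - r p j then (1 : ℝ) else 0)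
      = t * J.card * (1 / p) := fun p hp => by
    rw [← mul_sum, sum_comm]
    simp_rw [dvd_sub_comm (b := ((_ : ℕ) : ℤ)), sum_range_ite_dvd_sub (hS p hp).pos]
    simp only [sum_const, nsmul_eq_mul]
    ring
  refine (sum_Ioc_prod_le hS (g := fun p n => t / p * ∑ j ∈ J,
    if (p : ℤ) ∣ n - r p j then (1 : ℝ) else 0) ?_ ?_ hab).trans ?_
  · intro p _ n
    simp only
    congr 1
    exact sum_congr rfl fun j _ => ite_dvd_sub_periodic p (r p j) n
  · intro p _ n
    exact mul_nonneg (by positivity) (sum_nonneg fun j _ => by split_ifs <;> norm_num)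
  · refine add_le_add (mul_le_mul_of_nonneg_left ?_ hba) ?_
    · rw [mul_sum, Real.exp_sum]
      refine prod_le_prod (fun p hp => ?_) fun p hp => ?_
      · unfold avg
        rw [hsum p hp]
        positivity
      · unfold avg
        rw [hsum p hp, add_comm]
        refine le_trans (le_of_eq ?_) (Real.add_one_le_exp _)
        field_simp
    · rw [mul_sum, Real.exp_sum]
      refine prod_le_prod (fun p hp => ?_) fun p hp => ?_
      · rw [hsum p hp]
        positivity
      · rw [hsum p hp, add_comm]
        exact Real.add_one_le_exp _

/-- The arithmetic progression `n + q, n + 2q, …, n + kq`. -/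
noncomputable def ap (k q : ℕ) (n : ℤ) : Finset ℤ :=
  (Icc 1 k).image fun h : ℕ => n + (q : ℤ) * (h : ℤ)

theorem card_ap_le (k q : ℕ) (n : ℤ) : (ap k q n).card ≤ k :=
  card_image_le.trans (by simp)

theorem eq_of_dvd_mul_sub {p q k h h' : ℕ} (hp : p.Prime) (hq : ¬ p ∣ q) (hk : k ≤ p)
    (hh : h ∈ Icc 1 k) (hh' : h' ∈ Icc 1 k) (hd : (p : ℤ) ∣ q * ((h : ℤ) - h')) : h = h' := by
  rw [mem_Icc] at hh hh'
  rcases (Nat.prime_iff_prime_int.1 hp).dvd_or_dvd hd with h1 | h1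
  · exact absurd (by exact_mod_cast h1) hq
  · have := Int.eq_zero_of_abs_lt_dvd h1 (by rw [abs_lt]; constructor <;> omega)
    omega

theorem eq_of_dvd_sub_of_mem_ap {p q k : ℕ} (hp : p.Prime) (hq : ¬ p ∣ q) (hk : k ≤ p) {n a a' : ℤ}
    (ha : a ∈ ap k q n) (ha' : a' ∈ ap k q n) (hd : (p : ℤ) ∣ a - a') : a = a' := by
  obtain ⟨h, hh, rfl⟩ := mem_image.1 ha
  obtain ⟨h', hh', rfl⟩ := mem_image.1 ha'
  have e : n + (q : ℤ) * h - (n + (q : ℤ) * h') = q * ((h : ℤ) - h') := by ring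
  rw [e] at hd
  rw [eq_of_dvd_mul_sub hp hq hk hh hh' hd]

theorem coinc_image_le {ι κ : Type*} (p : ℕ) (s : Finset ι) (t : Finset κ) (f : ι → ℤ) (g : κ → ℤ) :
    (coinc p (s.image f) (t.image g) : ℝ) ≤
      ∑ j ∈ s ×ˢ t, if (p : ℤ) ∣ f j.1 - g j.2 then (1 : ℝ) else 0 := by
  rw [← sum_filter, sum_const, nsmul_eq_mul, mul_one]
  norm_cast
  unfold coinc
  refine (card_le_card (t := ((s ×ˢ t).filter fun j => (p : ℤ) ∣ f j.1 - g j.2).image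
    fun j => (f j.1, g j.2)) ?_).trans card_image_le
  intro a ha
  rw [mem_filter, mem_product] at ha
  obtain ⟨i, hi, h1⟩ := mem_image.1 ha.1.1
  obtain ⟨j, hj, h2⟩ := mem_image.1 ha.1.2
  rw [mem_image]
  refine ⟨(i, j), ?_, ?_⟩
  · rw [mem_filter, mem_product]
    refine ⟨⟨hi, hj⟩, ?_⟩
    simp only [h1, h2]
    exact ha.2
  · simp only [h1, h2]

theorem prod_one_add_coinc_ap_le (S : Finset ℕ) (k q : ℕ) (n n' : ℤ) :
    ∏ p ∈ S, (1 + 2 * (coinc p (ap k q n) (ap k q n') : ℝ) / p) ≤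
      ∏ p ∈ S, (1 + 2 / (p : ℝ) * ∑ j ∈ Icc 1 k ×ˢ Icc 1 k,
        if (p : ℤ) ∣ n' - (n + q * (j.1 : ℤ) - q * (j.2 : ℤ)) then (1 : ℝ) else 0) := by
  refine prod_le_prod (fun p _ => by positivity) fun p _ => ?_
  have h := coinc_image_le p (Icc 1 k) (Icc 1 k) (fun h : ℕ => n + (q : ℤ) * (h : ℤ))
    (fun h : ℕ => n' + (q : ℤ) * (h : ℤ))
  have e : ∀ j : ℕ × ℕ, (p : ℤ) ∣ n + q * (j.1 : ℤ) - (n' + q * (j.2 : ℤ)) ↔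
      (p : ℤ) ∣ n' - (n + q * (j.1 : ℤ) - q * (j.2 : ℤ)) := fun j => by
    rw [dvd_sub_comm]
    ring_nf
  simp only [e] at h
  have e2 : 2 * (coinc p (ap k q n) (ap k q n') : ℝ) / p =
      2 / (p : ℝ) * coinc p (ap k q n) (ap k q n') := by ring
  rw [e2]
  gcongr
  exact h

/-- Variance, over the shift `b`, of the total weight of the progressions of step `q`. -/
theorem avg_sq_sum_lamSet_ap_sub_le {w z : ℝ} (hwz : w ≤ z) {k q : ℕ} (hk : 1 ≤ k)
    (hkw : 4 * (k : ℝ) ^ 2 ≤ w) (hq : ∀ p ∈ primesBetween w z, ¬ p ∣ q) {a c : ℤ} (hac : a ≤ c) :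
    avg (PP z) (fun b => (∑ n ∈ Ioc a c, lamSet w z (ap k q n) b - (c - a)) ^ 2) ≤
      12 * (c - a) ^ 2 * (k : ℝ) ^ 2 / w +
        (c - a) * Real.exp (2 * (k : ℝ) ^ 2 * ∑ p ∈ primesBetween w z, 1 / (p : ℝ)) := by
  have hk1 : (1 : ℝ) ≤ k := by exact_mod_cast hk
  have hw1 : 1 ≤ w := by nlinarith
  have hY : (0 : ℝ) ≤ c - a := by
    have : (a : ℝ) ≤ c := by exact_mod_cast hac
    linarith
  have h4k : ∀ p ∈ primesBetween w z, 4 * k ≤ p := fun p hp => by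
    have := (mem_primesBetween.1 hp).2.1
    have : (4 : ℝ) * k ≤ p := by nlinarith
    exact_mod_cast this
  have hinc : ∀ n : ℤ, ∀ p ∈ primesBetween w z, ∀ x ∈ ap k q n, ∀ x' ∈ ap k q n,
      (p : ℤ) ∣ x - x' → x = x' := fun n p hp x hx x' hx' hd =>
    eq_of_dvd_sub_of_mem_ap (mem_primesBetween.1 hp).1 (hq p hp) (by have := h4k p hp; omega) hx hx' hd
  have hcard : ((Ioc a c).card : ℝ) = c - a := by
    rw [Int.card_Ioc]
    have : ((c - a).toNat : ℤ) = c - a := Int.toNat_of_nonneg (by omega)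
    exact_mod_cast this
  have hone : Function.Periodic (fun _ : ℤ => (1 : ℝ)) (PP w) := fun _ => rfl
  set E := Real.exp (2 * (k : ℝ) ^ 2 * ∑ p ∈ primesBetween w z, 1 / (p : ℝ)) with hE
  have hZ1 : (1 - 2 * (k : ℝ) ^ 2 / w) * (c - a) ≤
      avg (PP z) (fun b => 1 * ∑ n ∈ Ioc a c, lamSet w z (ap k q n) b) := by
    simp_rw [one_mul]
    rw [avg_sum, ← hcard, mul_comm, ← nsmul_eq_mul]
    refine card_nsmul_le_sum _ _ _ fun n _ => ?_
    have := le_avg_mul_lamSet hwz hw1 hone (fun _ => zero_le_one) (hinc n) (card_ap_le k q n)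
      (fun p hp => by have := h4k p hp; omega)
    rw [avg_const (PP_pos w)] at this
    simpa using this
  have hkk : (k : ℝ) ^ 2 / w ≤ 1 / 4 := by
    rw [div_le_div_iff₀ (by linarith) (by norm_num)]; linarith
  have hexp : Real.exp (2 * ((Icc 1 k ×ˢ Icc 1 k).card : ℝ) *
      ∑ p ∈ primesBetween w z, 1 / (p : ℝ) ^ 2) ≤ 1 + 8 * (k : ℝ) ^ 2 / w := by
    have h1 : 2 * ((Icc 1 k ×ˢ Icc 1 k).card : ℝ) * ∑ p ∈ primesBetween w z, 1 / (p : ℝ) ^ 2 ≤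
        4 * ((k : ℝ) ^ 2 / w) := by
      have := mul_le_mul_of_nonneg_left (sum_primesBetween_inv_sq_le (z := z) hw1)
        (by positivity : 0 ≤ 2 * (k : ℝ) ^ 2)
      simp only [card_product, Nat.card_Icc, Nat.add_sub_cancel]
      push_cast
      calc _ = 2 * (k : ℝ) ^ 2 * ∑ p ∈ primesBetween w z, 1 / (p : ℝ) ^ 2 := by ring
        _ ≤ _ := this
        _ = _ := by ring
    calc _ ≤ Real.exp (4 * ((k : ℝ) ^ 2 / w)) := Real.exp_le_exp.2 h1
      _ ≤ 1 + 2 * (4 * ((k : ℝ) ^ 2 / w)) := exp_le_one_add_two_mul (by positivity) (by linarith)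
      _ = _ := by ring
  have hZ2 : avg (PP z) (fun b => 1 * (∑ n ∈ Ioc a c, lamSet w z (ap k q n) b) ^ 2) ≤
      (c - a) * ((c - a) * (1 + 8 * (k : ℝ) ^ 2 / w) + E) := by
    simp_rw [one_mul, sq, sum_mul_sum]
    rw [avg_sum]
    simp_rw [avg_sum]
    have : ∀ n ∈ Ioc a c, ∑ n' ∈ Ioc a c, avg (PP z)
        (fun b => lamSet w z (ap k q n) b * lamSet w z (ap k q n') b) ≤
          (c - a) * (1 + 8 * (k : ℝ) ^ 2 / w) + E := by
      intro n _
      calc _ ≤ ∑ n' ∈ Ioc a c, ∏ p ∈ primesBetween w z, (1 + 2 / (p : ℝ) *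
            ∑ j ∈ Icc 1 k ×ˢ Icc 1 k, if (p : ℤ) ∣ n' - (n + q * (j.1 : ℤ) - q * (j.2 : ℤ))
              then (1 : ℝ) else 0) := by
            refine sum_le_sum fun n' _ => ?_
            refine le_trans ?_ (prod_one_add_coinc_ap_le _ k q n n')
            have := avg_mul_lamSet_mul_lamSet_le hwz hone (fun _ => zero_le_one) (hinc n) (hinc n')
              (card_ap_le k q n) (card_ap_le k q n') h4k
            rw [avg_const (PP_pos w)] at this
            simpa using this
        _ ≤ _ := sum_Ioc_prod_one_add_le (fun p hp => (mem_primesBetween.1 hp).1)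
            (Icc 1 k ×ˢ Icc 1 k) (fun _ j => n + q * (j.1 : ℤ) - q * (j.2 : ℤ)) zero_le_two hac
        _ ≤ _ := by
            refine add_le_add (mul_le_mul_of_nonneg_left hexp hY) (le_of_eq ?_)
            rw [hE]
            simp only [card_product, Nat.card_Icc, Nat.add_sub_cancel]
            push_cast
            ring_nf
    refine (sum_le_sum this).trans (le_of_eq ?_)
    rw [sum_const, nsmul_eq_mul, hcard]
    ring_nf
  have := avg_sq_sub_le (m := PP z) (G := fun _ => 1) hY (avg_const (PP_pos z) 1).le hZ1 hZ2
  simp only [one_mul] at this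
  refine this.trans (le_of_eq ?_)
  ring

theorem mul_le_add_pow_div {u v B : ℝ} (hu : 0 ≤ u) (hv : 0 ≤ v) (hB : 0 < B) (κ : ℕ) :
    u * v ≤ B + (u ^ (2 * (κ + 1)) + v ^ (2 * (κ + 1))) / B ^ κ := by
  have h0 : 0 ≤ (u ^ (2 * (κ + 1)) + v ^ (2 * (κ + 1))) / B ^ κ := by positivity
  rcases le_or_gt (u * v) B with h | h
  · linarith
  · suffices u * v ≤ (u ^ (2 * (κ + 1)) + v ^ (2 * (κ + 1))) / B ^ κ by linarith
    rw [le_div_iff₀ (by positivity)]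
    calc u * v * B ^ κ ≤ u * v * (u * v) ^ κ := by gcongr
      _ = u ^ (κ + 1) * v ^ (κ + 1) := by ring
      _ ≤ (u ^ (κ + 1)) ^ 2 + (v ^ (κ + 1)) ^ 2 := by
          nlinarith [sq_nonneg (u ^ (κ + 1) - v ^ (κ + 1)), sq_nonneg (u ^ (κ + 1)),
            sq_nonneg (v ^ (κ + 1))]
      _ = _ := by ring

theorem exp_le_one_add_mul_exp {s B : ℝ} (h0 : 0 ≤ s) (hs : s ≤ B) :
    Real.exp s ≤ 1 + s * Real.exp B := by
  have h1 := Real.add_one_le_exp (-s)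
  have h2 : Real.exp (-s) * Real.exp s = 1 := by rw [← Real.exp_add]; simp
  have h3 : Real.exp s ≤ Real.exp B := Real.exp_le_exp.2 hs
  nlinarith [Real.exp_pos s, mul_le_mul_of_nonneg_right h1 (Real.exp_pos s).le,
    mul_le_mul_of_nonneg_left h3 h0]

section

variable {ι : Type*} {w : ℝ} {S S' : Finset ℕ} {k : ℕ} {J : Finset ι}

theorem sum_Ioc_pow_double_sum_le (hS : ∀ p ∈ S, p.Prime) (hSw : ∀ p ∈ S, w < p) (hw : 1 ≤ w)
    (hsq : ∑ p ∈ S, 1 / (p : ℝ) ^ 2 ≤ 2 / w) (hk : 1 ≤ k) (hJ : J.card ≤ k ^ 2) (r : ℕ → ι → ℤ)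
    {a c : ℤ} (hac : a ≤ c) (m : ℕ) :
    ∑ n ∈ Ioc a c, (w / (k : ℝ) ^ 2 * ∑ p ∈ S, 2 / (p : ℝ) *
        ∑ j ∈ J, if (p : ℤ) ∣ n - r p j then (1 : ℝ) else 0) ^ (m + 1) ≤
      2 ^ (m + 1) * ((c - a) * ((m + 1).factorial * Real.exp 4) + (S.card : ℝ) ^ (m + 1)) := by
  have hk0 : (0 : ℝ) < k := by exact_mod_cast hk
  set A : ι → ℤ → ℝ := fun j n => ∑ p ∈ S, w / p * if (p : ℤ) ∣ n - r p j then (1 : ℝ) else 0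
    with hA
  have hA0 : ∀ j n, 0 ≤ A j n := fun j n => sum_nonneg fun p _ =>
    mul_nonneg (by positivity) (by split_ifs <;> norm_num)
  have hu : ∀ n, w / (k : ℝ) ^ 2 * ∑ p ∈ S, 2 / (p : ℝ) *
        ∑ j ∈ J, (if (p : ℤ) ∣ n - r p j then (1 : ℝ) else 0) =
      2 / (k : ℝ) ^ 2 * ∑ j ∈ J, A j n := fun n => by
    simp_rw [hA, mul_sum]
    rw [sum_comm]
    refine sum_congr rfl fun j _ => sum_congr rfl fun p _ => ?_
    ring
  have hpow : ∀ n, (2 / (k : ℝ) ^ 2 * ∑ j ∈ J, A j n) ^ (m + 1) ≤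
      2 ^ (m + 1) / (k : ℝ) ^ 2 * ∑ j ∈ J, A j n ^ (m + 1) := fun n => by
    rcases J.eq_empty_or_nonempty with rfl | hne
    · simp
    have hJ0 : (0 : ℝ) < J.card := by exact_mod_cast hne.card_pos
    have h1 := pow_sum_div_card_le_sum_pow (s := J) (f := fun j => A j n)
      (fun j _ => hA0 j n) m
    rw [div_le_iff₀ (by positivity)] at h1
    have hJ' : (J.card : ℝ) ≤ (k : ℝ) ^ 2 := by exact_mod_cast hJ
    have h2 : (∑ j ∈ J, A j n) ^ (m + 1) ≤ (∑ j ∈ J, A j n ^ (m + 1)) * ((k : ℝ) ^ 2) ^ m := by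
      refine h1.trans (mul_le_mul_of_nonneg_left (by gcongr) (sum_nonneg fun j _ => ?_))
      exact pow_nonneg (hA0 j n) _
    rw [mul_pow, div_pow]
    calc _ ≤ 2 ^ (m + 1) / ((k : ℝ) ^ 2) ^ (m + 1) *
          ((∑ j ∈ J, A j n ^ (m + 1)) * ((k : ℝ) ^ 2) ^ m) := by gcongr
      _ = _ := by field_simp; ring
  simp_rw [hu]
  have hmom : ∀ j ∈ J, ∑ n ∈ Ioc a c, A j n ^ (m + 1) ≤
      (c - a) * ((m + 1).factorial * Real.exp 4) + (S.card : ℝ) ^ (m + 1) := by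
    intro j _
    have hba : (0 : ℝ) ≤ c - a := by
      have : (a : ℝ) ≤ c := by exact_mod_cast hac
      linarith
    refine (sum_Ioc_pow_le hS (α := fun p => w / p) (fun p _ => by positivity) (fun p hp => ?_)
      (fun p => r p j) hac (m + 1)).trans ?_
    · exact div_le_one_of_le₀ (hSw p hp).le (by positivity)
    · gcongr
      calc ∑ p ∈ S, 2 * (w / p) / (p : ℝ) = 2 * w * ∑ p ∈ S, 1 / (p : ℝ) ^ 2 := by
            rw [mul_sum]
            refine sum_congr rfl fun p _ => ?_
            ring
        _ ≤ 2 * w * (2 / w) := by gcongr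
        _ = 4 := by field_simp; norm_num
  have hJ' : (J.card : ℝ) ≤ (k : ℝ) ^ 2 := by exact_mod_cast hJ
  have hba : (0 : ℝ) ≤ c - a := by
    have : (a : ℝ) ≤ c := by exact_mod_cast hac
    linarith
  calc _ ≤ ∑ n ∈ Ioc a c, 2 ^ (m + 1) / (k : ℝ) ^ 2 * ∑ j ∈ J, A j n ^ (m + 1) :=
        sum_le_sum fun n _ => hpow n
    _ = 2 ^ (m + 1) / (k : ℝ) ^ 2 * ∑ j ∈ J, ∑ n ∈ Ioc a c, A j n ^ (m + 1) := by
        rw [← mul_sum, sum_comm]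
    _ ≤ 2 ^ (m + 1) / (k : ℝ) ^ 2 *
        (J.card * ((c - a) * ((m + 1).factorial * Real.exp 4) + (S.card : ℝ) ^ (m + 1))) := by
        gcongr
        rw [← nsmul_eq_mul]
        exact sum_le_card_nsmul _ _ _ hmom
    _ ≤ 2 ^ (m + 1) / (k : ℝ) ^ 2 *
        ((k : ℝ) ^ 2 * ((c - a) * ((m + 1).factorial * Real.exp 4) + (S.card : ℝ) ^ (m + 1))) := by
        gcongr
    _ = _ := by field_simp

theorem sum_Ioc_exp_double_sum_le (hS : ∀ p ∈ S, p.Prime) (hSw : ∀ p ∈ S, w < p) (hw : 1 ≤ w)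
    (hsq : ∑ p ∈ S, 1 / (p : ℝ) ^ 2 ≤ 2 / w) (hkw : (k : ℝ) ^ 2 ≤ w) (hJ : J.card ≤ k ^ 2)
    (r : ℕ → ι → ℤ) {a c : ℤ} (hac : a ≤ c) (m : ℕ) :
    ∑ n ∈ Ioc a c, (Real.exp (∑ p ∈ S, 2 / (p : ℝ) *
        ∑ j ∈ J, if (p : ℤ) ∣ n - r p j then (1 : ℝ) else 0)) ^ m ≤
      (c - a) * Real.exp (4 * m * Real.exp (2 * m)) +
        Real.exp (2 * m * Real.exp (2 * m) * (k : ℝ) ^ 2 * ∑ p ∈ S, 1 / (p : ℝ)) := by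
  set t : ℝ := 2 * m * Real.exp (2 * m) with ht
  have ht0 : 0 ≤ t := by positivity
  have hJ' : (J.card : ℝ) ≤ (k : ℝ) ^ 2 := by exact_mod_cast hJ
  have hba : (0 : ℝ) ≤ c - a := by
    have : (a : ℝ) ≤ c := by exact_mod_cast hac
    linarith
  have hle : ∀ n : ℤ, (Real.exp (∑ p ∈ S, 2 / (p : ℝ) *
        ∑ j ∈ J, if (p : ℤ) ∣ n - r p j then (1 : ℝ) else 0)) ^ m ≤
      ∏ p ∈ S, (1 + t / p * ∑ j ∈ J, if (p : ℤ) ∣ n - r p j then (1 : ℝ) else 0) := fun n => by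
    rw [Real.exp_sum, ← prod_pow]
    refine prod_le_prod (fun p _ => by positivity) fun p hp => ?_
    set s : ℝ := ∑ j ∈ J, if (p : ℤ) ∣ n - r p j then (1 : ℝ) else 0 with hs
    have hs0 : 0 ≤ s := sum_nonneg fun j _ => by split_ifs <;> norm_num
    have hs1 : s ≤ p := by
      calc s ≤ ∑ j ∈ J, (1 : ℝ) := sum_le_sum fun j _ => by split_ifs <;> norm_num
        _ = J.card := by simp
        _ ≤ p := hJ'.trans (hkw.trans (hSw p hp).le)
    have hp0 : (0 : ℝ) < p := by exact_mod_cast (hS p hp).pos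
    rw [← Real.exp_nat_mul]
    have e : (m : ℝ) * (2 / p * s) = 2 * m * (s / p) := by ring
    have hsp : s / p ≤ 1 := (div_le_one hp0).2 hs1
    refine (exp_le_one_add_mul_exp (B := 2 * m) (by positivity) ?_).trans (le_of_eq ?_)
    · rw [e]
      exact mul_le_of_le_one_right (by positivity) hsp
    · rw [ht]; ring
  refine (sum_le_sum fun n _ => hle n).trans
    ((sum_Ioc_prod_one_add_le hS J r ht0 hac).trans ?_)
  refine add_le_add (mul_le_mul_of_nonneg_left (Real.exp_le_exp.2 ?_) hba) (Real.exp_le_exp.2 ?_)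
  · calc t * J.card * ∑ p ∈ S, 1 / (p : ℝ) ^ 2 ≤ t * w * (2 / w) := by
          gcongr
          exact hJ'.trans hkw
      _ = _ := by rw [ht]; field_simp; ring
  · gcongr

end

/-- A weighted count of congruence conditions over a sparse set, through high moments. -/
theorem exists_sum_weight_mul_exp_le (κ : ℕ) :
    ∃ C t : ℝ, 0 < C ∧ 0 < t ∧ ∀ (w : ℝ) (S S' : Finset ℕ) (k : ℕ) (J : Finset (ℕ × ℕ))
      (r : ℕ → ℕ × ℕ → ℤ) (a c : ℤ) (Q : Finset ℤ) (B : ℝ),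
      (∀ p ∈ S, p.Prime) → (∀ p ∈ S, w < p) → 1 ≤ w → S' ⊆ S →
      ∑ p ∈ S, 1 / (p : ℝ) ^ 2 ≤ 2 / w → 1 ≤ k → (k : ℝ) ^ 2 ≤ w → J.card ≤ k ^ 2 → a ≤ c →
      Q ⊆ Ioc a c → 0 < B →
      ∑ n ∈ Q, (∑ p ∈ S', 2 / (p : ℝ) * ∑ j ∈ J, (if (p : ℤ) ∣ n - r p j then (1 : ℝ) else 0) +
          (k : ℝ) ^ 2 / w) * Real.exp (∑ p ∈ S, 2 / (p : ℝ) *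
            ∑ j ∈ J, if (p : ℤ) ∣ n - r p j then (1 : ℝ) else 0) ≤
        (k : ℝ) ^ 2 / w * (Q.card * B + C * ((c - a) + (S'.card : ℝ) ^ (2 * (κ + 1)) +
          Real.exp (t * (k : ℝ) ^ 2 * ∑ p ∈ S, 1 / (p : ℝ))) / B ^ κ) := by
  set m := 2 * κ + 1 with hm
  have hm2 : 2 * (κ + 1) = m + 1 := by omega
  refine ⟨2 ^ m * (2 ^ (m + 1) * ((m + 1).factorial * Real.exp 4) + 2 ^ (m + 1) + 1) +
    Real.exp (4 * (m + 1 : ℕ) * Real.exp (2 * (m + 1 : ℕ))),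
    2 * (m + 1 : ℕ) * Real.exp (2 * (m + 1 : ℕ)), by positivity, by positivity, ?_⟩
  intro w S S' k J r a c Q B hS hSw hw hS' hsq hk hkw hJ hac hQ hB
  have hk0 : (0 : ℝ) < k := by exact_mod_cast hk
  have hw0 : 0 < w := by linarith
  have hba : (0 : ℝ) ≤ c - a := by
    have : (a : ℝ) ≤ c := by exact_mod_cast hac
    linarith
  set θ : ℝ := (k : ℝ) ^ 2 / w with hθ
  have hθ0 : 0 < θ := by positivity
  set G : ℕ → ℤ → ℝ := fun p n => ∑ j ∈ J, if (p : ℤ) ∣ n - r p j then (1 : ℝ) else 0 with hG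
  have hG0 : ∀ p n, 0 ≤ G p n := fun p n => sum_nonneg fun j _ => by split_ifs <;> norm_num
  set u : ℤ → ℝ := fun n => w / (k : ℝ) ^ 2 * ∑ p ∈ S', 2 / (p : ℝ) * G p n with hu
  set v : ℤ → ℝ := fun n => Real.exp (∑ p ∈ S, 2 / (p : ℝ) * G p n) with hv
  have hu0 : ∀ n, 0 ≤ u n := fun n => mul_nonneg (by positivity)
    (sum_nonneg fun p _ => mul_nonneg (by positivity) (hG0 p n))
  have hv0 : ∀ n, 0 ≤ v n := fun n => (Real.exp_pos _).le
  have hsq' : ∑ p ∈ S', 1 / (p : ℝ) ^ 2 ≤ 2 / w :=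
    (sum_le_sum_of_subset_of_nonneg hS' fun _ _ _ => by positivity).trans hsq
  have hU := sum_Ioc_pow_double_sum_le (fun p hp => hS p (hS' hp)) (fun p hp => hSw p (hS' hp)) hw
    hsq' hk hJ r hac m
  have hV := sum_Ioc_exp_double_sum_le hS hSw hw hsq hkw hJ r hac (m + 1)
  have hterm : ∀ n, (∑ p ∈ S', 2 / (p : ℝ) * G p n + θ) * v n ≤
      θ * (B + ((u n + 1) ^ (m + 1) + v n ^ (m + 1)) / B ^ κ) := fun n => by
    have e : ∑ p ∈ S', 2 / (p : ℝ) * G p n + θ = θ * (u n + 1) := by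
      rw [hu, hθ]; field_simp
    rw [e, mul_assoc, ← hm2]
    exact mul_le_mul_of_nonneg_left
      (mul_le_add_pow_div (by linarith [hu0 n]) (hv0 n) hB κ) hθ0.le
  have hu1 : ∀ n, (u n + 1) ^ (m + 1) ≤ 2 ^ m * (u n ^ (m + 1) + 1) := fun n => by
    have := add_pow_le (hu0 n) zero_le_one (m + 1)
    simpa using this
  have hcard : ((Ioc a c).card : ℝ) = c - a := by
    rw [Int.card_Ioc]
    have : ((c - a).toNat : ℤ) = c - a := Int.toNat_of_nonneg (by omega)
    exact_mod_cast this
  calc ∑ n ∈ Q, (∑ p ∈ S', 2 / (p : ℝ) * G p n + θ) * v n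
      ≤ ∑ n ∈ Q, θ * (B + ((u n + 1) ^ (m + 1) + v n ^ (m + 1)) / B ^ κ) :=
        sum_le_sum fun n _ => hterm n
    _ = θ * (Q.card * B + (∑ n ∈ Q, ((u n + 1) ^ (m + 1) + v n ^ (m + 1))) / B ^ κ) := by
        rw [← mul_sum, sum_add_distrib, sum_const, nsmul_eq_mul, sum_div]
    _ ≤ _ := by
        gcongr
        calc ∑ n ∈ Q, ((u n + 1) ^ (m + 1) + v n ^ (m + 1))
            ≤ ∑ n ∈ Ioc a c, ((u n + 1) ^ (m + 1) + v n ^ (m + 1)) :=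
              sum_le_sum_of_subset_of_nonneg hQ fun n _ _ =>
                add_nonneg (pow_nonneg (by linarith [hu0 n]) _) (pow_nonneg (hv0 n) _)
          _ ≤ ∑ n ∈ Ioc a c, (2 ^ m * (u n ^ (m + 1) + 1) + v n ^ (m + 1)) :=
              sum_le_sum fun n _ => by linarith [hu1 n]
          _ = 2 ^ m * (∑ n ∈ Ioc a c, u n ^ (m + 1) + (c - a)) + ∑ n ∈ Ioc a c, v n ^ (m + 1) := by
              rw [sum_add_distrib, ← mul_sum, sum_add_distrib, sum_const, nsmul_eq_mul, hcard,
                mul_one]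
          _ ≤ 2 ^ m * (2 ^ (m + 1) * ((c - a) * ((m + 1).factorial * Real.exp 4) +
                (S'.card : ℝ) ^ (m + 1)) + (c - a)) +
              ((c - a) * Real.exp (4 * (m + 1 : ℕ) * Real.exp (2 * (m + 1 : ℕ))) +
              Real.exp (2 * (m + 1 : ℕ) * Real.exp (2 * (m + 1 : ℕ)) * (k : ℝ) ^ 2 *
                ∑ p ∈ S, 1 / (p : ℝ))) := by
              gcongr
          _ ≤ _ := by
              rw [hm2]
              generalize hX : Real.exp (2 * (m + 1 : ℕ) * Real.exp (2 * (m + 1 : ℕ)) * (k : ℝ) ^ 2 *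
                ∑ p ∈ S, 1 / (p : ℝ)) = X
              generalize hP : (S'.card : ℝ) ^ (m + 1) = P
              generalize hE : Real.exp (4 * (m + 1 : ℕ) * Real.exp (2 * (m + 1 : ℕ))) = E
              generalize hF : ((m + 1).factorial : ℝ) * Real.exp 4 = Fc
              have hX0 : 0 ≤ X := hX ▸ (Real.exp_pos _).le
              have hP0 : 0 ≤ P := hP ▸ by positivity
              have hE0 : 0 ≤ E := hE ▸ (Real.exp_pos _).le
              have hF0 : 0 ≤ Fc := hF ▸ by positivity
              have h1 : (1 : ℝ) ≤ 2 ^ m := one_le_pow₀ (by norm_num)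
              have h2 : (1 : ℝ) ≤ 2 ^ (m + 1) := one_le_pow₀ (by norm_num)
              generalize (2 : ℝ) ^ m = a₁ at *
              generalize (2 : ℝ) ^ (m + 1) = a₂ at *
              generalize ((c : ℝ) - a) = Y at *
              have e : (a₁ * (a₂ * Fc + a₂ + 1) + E) * (Y + P + X) =
                  (a₁ * (a₂ * (Y * Fc + P) + Y) + (Y * E + X)) + (a₁ * a₂ * Fc * (P + X) +
                  a₁ * a₂ * (Y + X) + a₁ * P + (a₁ - 1) * X + E * (P + X)) := by ring
              rw [e]
              have : 0 ≤ a₁ * a₂ * Fc * (P + X) +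
                  a₁ * a₂ * (Y + X) + a₁ * P + (a₁ - 1) * X + E * (P + X) := by
                have := sub_nonneg.2 h1
                positivity
              linarith

/-- A root of `d * m ≡ e` modulo `p`, when there is one. -/
noncomputable def linRoot (p : ℕ) (d e : ℤ) : ℤ :=
  if h : ∃ m : ℤ, (p : ℤ) ∣ m * d - e then h.choose else 0

theorem dvd_sub_linRoot {p : ℕ} (hp : p.Prime) {d e m : ℤ} (hd : ¬ (p : ℤ) ∣ d)
    (h : (p : ℤ) ∣ m * d - e) : (p : ℤ) ∣ m - linRoot p d e := by
  have hex : ∃ m : ℤ, (p : ℤ) ∣ m * d - e := ⟨m, h⟩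
  have h1 : (p : ℤ) ∣ linRoot p d e * d - e := by
    unfold linRoot
    rw [dif_pos hex]
    exact hex.choose_spec
  have h2 : (p : ℤ) ∣ (m - linRoot p d e) * d := by
    have := dvd_sub h h1
    have e' : m * d - e - (linRoot p d e * d - e) = (m - linRoot p d e) * d := by ring
    rwa [e'] at this
  exact ((Nat.prime_iff_prime_int.1 hp).dvd_or_dvd h2).resolve_right hd

theorem not_dvd_of_mem_Icc_ne {p k h i : ℕ} (hk : k ≤ p) (hh : h ∈ Icc 1 k) (hi : i ∈ Icc 1 k)
    (hne : i ≠ h) : ¬ (p : ℤ) ∣ (i : ℤ) - h := by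
  rw [mem_Icc] at hh hi
  intro hd
  have := Int.eq_zero_of_abs_lt_dvd hd (by rw [abs_lt]; constructor <;> omega)
  omega

/-- The large primes dividing a nonzero integer contribute little to the sum of reciprocals. -/
theorem sum_filter_two_div_le {S : Finset ℕ} (hS : ∀ p ∈ S, p.Prime) {T X w : ℝ} (hw : 0 < w)
    (hT : 2 * w * (Real.log X / Real.log 2) ≤ T) (hT0 : 0 < T) (hSp : ∀ p ∈ S, T < p) {m : ℤ}
    (hm : m ≠ 0) (hmX : (|m| : ℝ) ≤ X) :
    ∑ p ∈ S, 2 / (p : ℝ) * (if (p : ℤ) ∣ m then (1 : ℝ) else 0) ≤ 1 / w := by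
  set D := S.filter fun p : ℕ => (p : ℤ) ∣ m with hD
  have hm0 : 0 < m.natAbs := Int.natAbs_pos.2 hm
  have hprod : 2 ^ D.card ≤ m.natAbs := by
    calc 2 ^ D.card ≤ ∏ p ∈ D, p := by
          rw [← prod_const]
          exact prod_le_prod' fun p hp => (hS p (mem_filter.1 hp).1).two_le
      _ ≤ m.natAbs := by
          refine Nat.le_of_dvd hm0 (prod_primes_dvd _ (fun p hp => (hS p (mem_filter.1 hp).1).prime)
            fun p hp => ?_)
          exact Int.natCast_dvd.1 (mem_filter.1 hp).2
  have h2 : (D.card : ℝ) ≤ Real.log X / Real.log 2 := by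
    rw [le_div_iff₀ (Real.log_pos one_lt_two), ← Real.log_pow]
    refine Real.log_le_log (by positivity) (le_trans ?_ hmX)
    have : ((2 ^ D.card : ℕ) : ℝ) ≤ (m.natAbs : ℝ) := by exact_mod_cast hprod
    rw [Nat.cast_natAbs] at this
    push_cast at this
    exact this
  calc ∑ p ∈ S, 2 / (p : ℝ) * (if (p : ℤ) ∣ m then (1 : ℝ) else 0) = ∑ p ∈ D, 2 / (p : ℝ) := by
        rw [hD, sum_filter]
        refine sum_congr rfl fun p _ => ?_
        split_ifs <;> simp
    _ ≤ D.card • (2 / T) := sum_le_card_nsmul _ _ _ fun p hp => by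
        have := hSp p (mem_filter.1 hp).1
        gcongr
    _ ≤ 1 / w := by
        rw [nsmul_eq_mul, mul_div_assoc', div_le_div_iff₀ hT0 hw]
        nlinarith

theorem prod_one_add_le_exp_sum (S : Finset ℕ) {f : ℕ → ℝ} (hf : ∀ p, 0 ≤ f p) :
    ∏ p ∈ S, (1 + f p) ≤ Real.exp (∑ p ∈ S, f p) := by
  rw [Real.exp_sum]
  exact prod_le_prod (fun p _ => by have := hf p; positivity) fun p _ => by
    linarith [Real.add_one_le_exp (f p)]

/-- The pairs of indices of two progressions through a common point, away from that point. -/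
def offPairs (k h₁ h₂ : ℕ) : Finset (ℕ × ℕ) := (Icc 1 k).erase h₁ ×ˢ (Icc 1 k).erase h₂

theorem card_offPairs_le (k h₁ h₂ : ℕ) : (offPairs k h₁ h₂).card ≤ k ^ 2 := by
  unfold offPairs
  rw [card_product, sq]
  exact Nat.mul_le_mul (card_erase_le.trans (by simp)) (card_erase_le.trans (by simp))

theorem coinc_ap_erase_le {p k q₁ q₂ h₁ h₂ : ℕ} (hp : p.Prime) (hk : k ≤ p) (hq₂ : ¬ p ∣ q₂)
    (hh₂ : h₂ ∈ Icc 1 k) (n : ℤ) :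
    (coinc p (ap k q₁ (n - q₁ * h₁)) ((ap k q₂ (n - q₂ * h₂)).erase n) : ℝ) ≤
      ∑ j ∈ offPairs k h₁ h₂, if (p : ℤ) ∣ (q₁ : ℤ) * ((j.1 : ℤ) - h₁) - q₂ * ((j.2 : ℤ) - h₂)
        then (1 : ℝ) else 0 := by
  have hsub : (ap k q₂ (n - q₂ * h₂)).erase n ⊆
      ((Icc 1 k).erase h₂).image fun h : ℕ => n - (q₂ : ℤ) * h₂ + (q₂ : ℤ) * (h : ℤ) := by
    intro a ha
    rw [mem_erase] at ha
    obtain ⟨i, hi, rfl⟩ := mem_image.1 ha.2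
    refine mem_image.2 ⟨i, mem_erase.2 ⟨?_, hi⟩, rfl⟩
    rintro rfl
    exact ha.1 (by ring)
  have h1 : coinc p (ap k q₁ (n - q₁ * h₁)) ((ap k q₂ (n - q₂ * h₂)).erase n) ≤
      coinc p (ap k q₁ (n - q₁ * h₁)) (((Icc 1 k).erase h₂).image
        fun h : ℕ => n - (q₂ : ℤ) * h₂ + (q₂ : ℤ) * (h : ℤ)) :=
    card_le_card (filter_subset_filter _ (product_subset_product_right hsub))
  have h2 := coinc_image_le p (Icc 1 k) ((Icc 1 k).erase h₂)
    (fun h : ℕ => n - (q₁ : ℤ) * h₁ + (q₁ : ℤ) * (h : ℤ))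
    (fun h : ℕ => n - (q₂ : ℤ) * h₂ + (q₂ : ℤ) * (h : ℤ))
  refine (Nat.cast_le.2 h1).trans (h2.trans ?_)
  have e : ∀ j : ℕ × ℕ, n - (q₁ : ℤ) * h₁ + (q₁ : ℤ) * (j.1 : ℤ) -
      (n - (q₂ : ℤ) * h₂ + (q₂ : ℤ) * (j.2 : ℤ)) =
      (q₁ : ℤ) * ((j.1 : ℤ) - h₁) - q₂ * ((j.2 : ℤ) - h₂) := fun j => by ring
  simp only [e]
  refine le_of_eq (sum_subset ?_ ?_).symm
  · exact product_subset_product_left (erase_subset _ _)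
  · intro j hj hj'
    rw [mem_product] at hj
    rw [if_neg]
    intro hd
    have hj2 := mem_erase.1 hj.2
    have hj1 : j.1 = h₁ := by
      by_contra hne
      exact hj' (mem_product.2 ⟨mem_erase.2 ⟨hne, hj.1⟩, hj.2⟩)
    rw [hj1, sub_self, mul_zero, zero_sub, dvd_neg] at hd
    rcases (Nat.prime_iff_prime_int.1 hp).dvd_or_dvd hd with h3 | h3
    · exact hq₂ (by exact_mod_cast h3)
    · exact not_dvd_of_mem_Icc_ne hk hh₂ hj2.2 hj2.1 h3

/-- The correlation of two progressions through a common point, with different prime steps. -/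
theorem prod_one_add_coinc_erase_le {S : Finset ℕ} (hS : ∀ p ∈ S, p.Prime) {k q₁ q₂ h₁ h₂ : ℕ}
    (hkS : ∀ p ∈ S, k ≤ p) (hq₂ : ∀ p ∈ S, ¬ p ∣ q₂) (hqp₁ : q₁.Prime) (hqp₂ : q₂.Prime)
    (hkq : k < q₂) (hne : q₁ ≠ q₂) {X₀ : ℕ} (hX₁ : q₁ ≤ X₀) (hX₂ : q₂ ≤ X₀) {T w : ℝ}
    (hw : 0 < w) (hT0 : 0 < T) (hk : 1 ≤ k)
    (hT : 2 * w * (Real.log (2 * k * X₀) / Real.log 2) ≤ T)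
    (hh₁ : h₁ ∈ Icc 1 k) (hh₂ : h₂ ∈ Icc 1 k) (n : ℤ) {r : ℕ → ℕ × ℕ → ℤ}
    (hr : r = fun p j => linRoot p ((j.1 : ℤ) - h₁) (q₂ * ((j.2 : ℤ) - h₂))) :
    ∏ p ∈ S, (1 + 2 * (coinc p (ap k q₁ (n - q₁ * h₁)) ((ap k q₂ (n - q₂ * h₂)).erase n) : ℝ) / p)
      ≤ 1 + (∑ p ∈ S.filter (fun p : ℕ => (p : ℝ) ≤ T), 2 / (p : ℝ) * ∑ j ∈ offPairs k h₁ h₂,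
          (if (p : ℤ) ∣ (q₁ : ℤ) - r p j then (1 : ℝ) else 0) + (k : ℝ) ^ 2 / w) *
        Real.exp (∑ p ∈ S, 2 / (p : ℝ) * ∑ j ∈ offPairs k h₁ h₂,
          if (p : ℤ) ∣ (q₁ : ℤ) - r p j then (1 : ℝ) else 0) := by
  set V : ℕ → ℕ × ℕ → ℝ := fun p j =>
    if (p : ℤ) ∣ (q₁ : ℤ) * ((j.1 : ℤ) - h₁) - q₂ * ((j.2 : ℤ) - h₂) then (1 : ℝ) else 0 with hV
  set R : ℕ → ℕ × ℕ → ℝ := fun p j =>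
    if (p : ℤ) ∣ (q₁ : ℤ) - r p j then (1 : ℝ) else 0 with hR
  have hV0 : ∀ p j, 0 ≤ V p j := fun p j => by simp only [hV]; split_ifs <;> norm_num
  have hR0 : ∀ p j, 0 ≤ R p j := fun p j => by simp only [hR]; split_ifs <;> norm_num
  have hVR : ∀ p ∈ S, ∀ j ∈ offPairs k h₁ h₂, V p j ≤ R p j := by
    intro p hp j hj
    have hj1 := mem_erase.1 (mem_product.1 hj).1
    simp only [hV, hR]
    split_ifs with h1 h2
    · exact le_rfl
    · refine absurd ?_ h2
      rw [hr]
      exact dvd_sub_linRoot (hS p hp) (not_dvd_of_mem_Icc_ne (hkS p hp) hh₁ hj1.2 hj1.1) h1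
    · norm_num
    · exact le_rfl
  set W := ∑ p ∈ S, 2 / (p : ℝ) * ∑ j ∈ offPairs k h₁ h₂, V p j with hW
  have hW0 : 0 ≤ W := sum_nonneg fun p _ => mul_nonneg (by positivity) (sum_nonneg fun j _ => hV0 p j)
  have hprod : ∏ p ∈ S, (1 + 2 * (coinc p (ap k q₁ (n - q₁ * h₁))
      ((ap k q₂ (n - q₂ * h₂)).erase n) : ℝ) / p) ≤ Real.exp W := by
    refine le_trans (prod_le_prod (g := fun p : ℕ => 1 + 2 / (p : ℝ) *
      ∑ j ∈ offPairs k h₁ h₂, V p j) (fun p _ => by positivity) fun p hp => ?_)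
      (prod_one_add_le_exp_sum S fun p => mul_nonneg (by positivity) (sum_nonneg fun j _ => hV0 p j))
    have h1 := coinc_ap_erase_le (q₁ := q₁) (h₁ := h₁) (hS p hp) (hkS p hp) (hq₂ p hp) hh₂ n
    rw [mul_div_right_comm]
    gcongr
  have htail : ∑ p ∈ S.filter (fun p : ℕ => ¬ (p : ℝ) ≤ T), 2 / (p : ℝ) *
      ∑ j ∈ offPairs k h₁ h₂, V p j ≤ (k : ℝ) ^ 2 / w := by
    simp_rw [mul_sum]
    rw [sum_comm]
    calc _ ≤ (offPairs k h₁ h₂).card • (1 / w) := by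
          refine sum_le_card_nsmul _ _ _ fun j hj => ?_
          have hj1 := mem_erase.1 (mem_product.1 hj).1
          have hj2 := mem_erase.1 (mem_product.1 hj).2
          have hI1 := mem_Icc.1 hj1.2
          have hI2 := mem_Icc.1 hj2.2
          have hJ1 := mem_Icc.1 hh₁
          have hJ2 := mem_Icc.1 hh₂
          refine sum_filter_two_div_le (fun p hp => hS p (mem_filter.1 hp).1) hw hT hT0
            (fun p hp => not_le.1 (mem_filter.1 hp).2) ?_ ?_
          · intro h0
            have h1 : (q₂ : ℤ) ∣ (q₁ : ℤ) * ((j.1 : ℤ) - h₁) := ⟨_, sub_eq_zero.1 h0⟩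
            rcases (Nat.prime_iff_prime_int.1 hqp₂).dvd_or_dvd h1 with h2 | h2
            · have : q₂ ∣ q₁ := by exact_mod_cast h2
              exact hne ((Nat.prime_dvd_prime_iff_eq hqp₂ hqp₁).1 this).symm
            · exact not_dvd_of_mem_Icc_ne hkq.le hh₁ hj1.2 hj1.1 h2
          · have a1 : |((j.1 : ℤ) - h₁ : ℤ)| ≤ (k : ℤ) := by rw [abs_le]; constructor <;> omega
            have a2 : |((j.2 : ℤ) - h₂ : ℤ)| ≤ (k : ℤ) := by rw [abs_le]; constructor <;> omega
            have a3 : |(q₁ : ℤ) * ((j.1 : ℤ) - h₁) - q₂ * ((j.2 : ℤ) - h₂)| ≤ 2 * k * X₀ := by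
              refine (abs_sub _ _).trans ?_
              rw [abs_mul, abs_mul, Nat.abs_cast, Nat.abs_cast]
              have hx1 : (q₁ : ℤ) ≤ X₀ := by exact_mod_cast hX₁
              have hx2 : (q₂ : ℤ) ≤ X₀ := by exact_mod_cast hX₂
              have b1 := mul_le_mul hx1 a1 (abs_nonneg _) (by positivity)
              have b2 := mul_le_mul hx2 a2 (abs_nonneg _) (by positivity)
              linarith
            exact_mod_cast a3
      _ ≤ (k : ℝ) ^ 2 / w := by
          rw [nsmul_eq_mul, mul_one_div]
          have : ((offPairs k h₁ h₂).card : ℝ) ≤ (k : ℝ) ^ 2 := by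
            exact_mod_cast card_offPairs_le k h₁ h₂
          gcongr
  have hhead : ∑ p ∈ S.filter (fun p : ℕ => (p : ℝ) ≤ T), 2 / (p : ℝ) *
      ∑ j ∈ offPairs k h₁ h₂, V p j ≤ ∑ p ∈ S.filter (fun p : ℕ => (p : ℝ) ≤ T), 2 / (p : ℝ) *
      ∑ j ∈ offPairs k h₁ h₂, R p j := by
    refine sum_le_sum fun p hp => mul_le_mul_of_nonneg_left ?_ (by positivity)
    exact sum_le_sum fun j hj => hVR p (mem_filter.1 hp).1 j hj
  have hWle : W ≤ ∑ p ∈ S, 2 / (p : ℝ) * ∑ j ∈ offPairs k h₁ h₂, R p j := by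
    refine sum_le_sum fun p hp => mul_le_mul_of_nonneg_left ?_ (by positivity)
    exact sum_le_sum fun j hj => hVR p hp j hj
  have hsplit := sum_filter_add_sum_filter_not S (fun p : ℕ => (p : ℝ) ≤ T)
    (fun p => 2 / (p : ℝ) * ∑ j ∈ offPairs k h₁ h₂, V p j)
  have hWht : W ≤ ∑ p ∈ S.filter (fun p : ℕ => (p : ℝ) ≤ T), 2 / (p : ℝ) *
      ∑ j ∈ offPairs k h₁ h₂, R p j + (k : ℝ) ^ 2 / w := by
    rw [hW, ← hsplit]; linarith
  calc _ ≤ Real.exp W := hprod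
    _ ≤ 1 + W * Real.exp W := exp_le_one_add_mul_exp hW0 le_rfl
    _ ≤ _ := by gcongr

/-- Variance, over the shift `b`, of the total weight of the progressions through a fixed point,
when the steps run over a set of primes. -/
theorem exists_avg_oneS_mul_sq_sub_le (κ : ℕ) :
    ∃ C t : ℝ, 0 < C ∧ 0 < t ∧ ∀ (w z : ℝ) (k X₀ : ℕ) (Q : Finset ℕ) (T B : ℝ) (n : ℤ),
      w ≤ z → 1 ≤ k → 4 * (k : ℝ) ^ 2 ≤ w → (∀ q ∈ Q, q.Prime ∧ z < q ∧ k < q ∧ q ≤ X₀) →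
      0 < T → 2 * w * (Real.log (2 * k * X₀) / Real.log 2) ≤ T → 0 < B →
      avg (PP z) (fun b => oneS z b n * (∑ q ∈ Q, ∑ h ∈ Icc 1 k,
        lamSet w z (ap k q (n - (q : ℤ) * (h : ℤ))) b - Q.card * k / sigBetween w z) ^ 2) ≤
      sigUpTo w / sigBetween w z * Q.card * (k : ℝ) ^ 2 * ((k : ℝ) ^ 2 / w * (Q.card * (B + 4) +
        C * (X₀ + T ^ (2 * (κ + 1)) +
          Real.exp (t * (k : ℝ) ^ 2 * ∑ p ∈ primesBetween w z, 1 / (p : ℝ))) / B ^ κ) +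
        Real.exp (2 * (k : ℝ) ^ 2 * ∑ p ∈ primesBetween w z, 1 / (p : ℝ))) := by
  obtain ⟨C, t, hC, ht, hmain⟩ := exists_sum_weight_mul_exp_le κ
  refine ⟨C, t, hC, ht, ?_⟩
  intro w z k X₀ Q T B n hwz hk hkw hQ hT0 hT hB
  have hk1 : (1 : ℝ) ≤ k := by exact_mod_cast hk
  have hw1 : 1 ≤ w := by nlinarith
  have hw0 : 0 < w := by linarith
  set S := primesBetween w z with hSdef
  have hS : ∀ p ∈ S, p.Prime := fun p hp => (mem_primesBetween.1 hp).1
  have h4k : ∀ p ∈ S, 4 * k ≤ p := fun p hp => by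
    have := (mem_primesBetween.1 hp).2.1
    have : (4 : ℝ) * k ≤ p := by nlinarith
    exact_mod_cast this
  have hkp : ∀ p ∈ S, k ≤ p := fun p hp => by have := h4k p hp; omega
  have hdvd : ∀ q ∈ Q, ∀ p ∈ S, ¬ p ∣ q := fun q hq p hp hpq => by
    have h1 := (Nat.prime_dvd_prime_iff_eq (hS p hp) (hQ q hq).1).1 hpq
    have h2 := (mem_primesBetween.1 hp).2.2
    have h3 := (hQ q hq).2.1
    rw [← h1] at h3
    linarith
  have hinc : ∀ q ∈ Q, ∀ m : ℤ, ∀ p ∈ S, ∀ x ∈ ap k q m, ∀ x' ∈ ap k q m,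
      (p : ℤ) ∣ x - x' → x = x' := fun q hq m p hp x hx x' hx' hd =>
    eq_of_dvd_sub_of_mem_ap (hS p hp) (hdvd q hq p hp) (hkp p hp) hx hx' hd
  have hmem : ∀ q : ℕ, ∀ h ∈ Icc 1 k, n ∈ ap k q (n - (q : ℤ) * (h : ℤ)) := fun q h hh =>
    mem_image.2 ⟨h, hh, by ring⟩
  have hσ2 := sigBetween_pos w z
  have hσw := sigUpTo_pos w
  set σ₂ := sigBetween w z with hσ2def
  set σw := sigUpTo w with hσwdef
  set E := Real.exp (2 * (k : ℝ) ^ 2 * ∑ p ∈ S, 1 / (p : ℝ)) with hE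
  set Et := Real.exp (t * (k : ℝ) ^ 2 * ∑ p ∈ S, 1 / (p : ℝ)) with hEt
  set θ := (k : ℝ) ^ 2 / w with hθ
  set R := θ * (Q.card * B + C * (X₀ + T ^ (2 * (κ + 1)) + Et) / B ^ κ) with hR
  set l : ℕ → ℕ → ℤ → ℝ := fun q h b => lamSet w z (ap k q (n - (q : ℤ) * (h : ℤ))) b with hl
  have hF : Function.Periodic (fun b => oneS w b n) (PP w) := oneS_periodic w n
  have hF0 : ∀ b, 0 ≤ oneS w b n := fun b => oneS_nonneg w b n
  have havw : avg (PP w) (fun b => oneS w b n) = σw := avg_oneS hw1 n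
  -- first moment
  have h1 : σw * (1 - 2 * θ) * (Q.card * k) ≤
      avg (PP z) (fun b => oneS z b n * ∑ q ∈ Q, ∑ h ∈ Icc 1 k, l q h b) := by
    simp_rw [mul_sum]
    rw [avg_sum]
    simp_rw [avg_sum]
    have hlow : ∀ q ∈ Q, ∀ h ∈ Icc 1 k, σw * (1 - 2 * θ) ≤
        avg (PP z) (fun b => oneS z b n * l q h b) := by
      intro q hq h hh
      have := le_avg_mul_lamSet hwz hw1 hF hF0 (hinc q hq (n - (q : ℤ) * (h : ℤ)))
        (card_ap_le k q _) hkp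
      rw [havw] at this
      simp only [hl]
      simp_rw [oneS_mul_lamSet hwz (hmem q h hh)]
      refine le_trans (le_of_eq ?_) this
      rw [hθ]; ring
    calc σw * (1 - 2 * θ) * (Q.card * k) = ∑ q ∈ Q, ∑ h ∈ Icc 1 k, σw * (1 - 2 * θ) := by
          simp only [sum_const, Nat.card_Icc, nsmul_eq_mul, Nat.add_sub_cancel]; ring
      _ ≤ _ := sum_le_sum fun q hq => sum_le_sum fun h hh => hlow q hq h hh
  -- second moment
  have hpair : ∀ q₁ ∈ Q, ∀ q₂ ∈ Q, ∀ h₁ ∈ Icc 1 k, ∀ h₂ ∈ Icc 1 k,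
      avg (PP z) (fun b => oneS z b n * (l q₁ h₁ b * l q₂ h₂ b)) ≤
        σ₂⁻¹ * (σw * ∏ p ∈ S, (1 + 2 * (coinc p (ap k q₁ (n - q₁ * h₁))
          ((ap k q₂ (n - q₂ * h₂)).erase n) : ℝ) / p)) := by
    intro q₁ hq₁ q₂ hq₂ h₁ hh₁ h₂ hh₂
    simp only [hl]
    simp_rw [oneS_mul_lamSet_mul_lamSet hwz (hmem q₁ h₁ hh₁) (hmem q₂ h₂ hh₂)]
    rw [avg_const_mul]
    have := avg_mul_lamSet_mul_lamSet_le hwz hF hF0 (hinc q₁ hq₁ (n - (q₁ : ℤ) * (h₁ : ℤ)))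
      (B := (ap k q₂ (n - q₂ * h₂)).erase n)
      (fun p hp x hx x' hx' hd => hinc q₂ hq₂ (n - (q₂ : ℤ) * (h₂ : ℤ)) p hp x (mem_of_mem_erase hx)
        x' (mem_of_mem_erase hx') hd) (card_ap_le k q₁ _)
      (card_erase_le.trans (card_ap_le k q₂ _)) h4k
    rw [havw] at this
    gcongr
  have hdiag : ∀ q₁ q₂ h₁ h₂ : ℕ, ∏ p ∈ S, (1 + 2 * (coinc p (ap k q₁ (n - q₁ * h₁))
      ((ap k q₂ (n - q₂ * h₂)).erase n) : ℝ) / p) ≤ E := by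
    intro q₁ q₂ h₁ h₂
    refine (prod_one_add_le_exp_sum S fun p => by positivity).trans (Real.exp_le_exp.2 ?_)
    rw [mul_sum]
    refine sum_le_sum fun p hp => ?_
    have : coinc p (ap k q₁ (n - q₁ * h₁)) ((ap k q₂ (n - q₂ * h₂)).erase n) ≤ k ^ 2 := by
      unfold coinc
      refine (card_filter_le _ _).trans ?_
      rw [card_product, sq]
      exact Nat.mul_le_mul (card_ap_le k q₁ _) (card_erase_le.trans (card_ap_le k q₂ _))
    have : (coinc p (ap k q₁ (n - q₁ * h₁)) ((ap k q₂ (n - q₂ * h₂)).erase n) : ℝ) ≤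
        (k : ℝ) ^ 2 := by exact_mod_cast this
    rw [mul_one_div]
    gcongr
  have hrow : ∀ q₂ ∈ Q, ∀ h₁ ∈ Icc 1 k, ∀ h₂ ∈ Icc 1 k,
      ∑ q₁ ∈ Q, ∏ p ∈ S, (1 + 2 * (coinc p (ap k q₁ (n - q₁ * h₁))
        ((ap k q₂ (n - q₂ * h₂)).erase n) : ℝ) / p) ≤ Q.card + R + E := by
    intro q₂ hq₂ h₁ hh₁ h₂ hh₂
    set r : ℕ → ℕ × ℕ → ℤ :=
      fun p j => linRoot p ((j.1 : ℤ) - h₁) (q₂ * ((j.2 : ℤ) - h₂)) with hr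
    set g : ℤ → ℝ := fun m => (∑ p ∈ S.filter (fun p : ℕ => (p : ℝ) ≤ T), 2 / (p : ℝ) *
        ∑ j ∈ offPairs k h₁ h₂, (if (p : ℤ) ∣ m - r p j then (1 : ℝ) else 0) +
          (k : ℝ) ^ 2 / w) * Real.exp (∑ p ∈ S, 2 / (p : ℝ) * ∑ j ∈ offPairs k h₁ h₂,
          if (p : ℤ) ∣ m - r p j then (1 : ℝ) else 0) with hg
    have hg0 : ∀ m, 0 ≤ g m := fun m => by
      refine mul_nonneg (add_nonneg (sum_nonneg fun p _ => mul_nonneg (by positivity)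
        (sum_nonneg fun j _ => ?_)) (by positivity)) (Real.exp_pos _).le
      split_ifs <;> norm_num
    have hE0 : 0 ≤ E := (Real.exp_pos _).le
    have hone : ∀ q₁ ∈ Q, ∏ p ∈ S, (1 + 2 * (coinc p (ap k q₁ (n - q₁ * h₁))
        ((ap k q₂ (n - q₂ * h₂)).erase n) : ℝ) / p) ≤ 1 + g q₁ + if q₁ = q₂ then E else 0 := by
      intro q₁ hq₁
      split_ifs with heq
      · linarith [hdiag q₁ q₂ h₁ h₂, hg0 q₁]
      · rw [add_zero]
        exact prod_one_add_coinc_erase_le hS hkp (hdvd q₂ hq₂) (hQ q₁ hq₁).1 (hQ q₂ hq₂).1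
          (hQ q₂ hq₂).2.2.1 heq (hQ q₁ hq₁).2.2.2 (hQ q₂ hq₂).2.2.2 hw0 hT0 hk hT hh₁ hh₂ n hr
    have hgsum : ∑ q₁ ∈ Q, g q₁ ≤ R := by
      have hcard : (Q.image (fun q : ℕ => (q : ℤ))).card = Q.card :=
        card_image_of_injective _ Nat.cast_injective
      have h5 := hmain w S (S.filter (fun p : ℕ => (p : ℝ) ≤ T)) k (offPairs k h₁ h₂) r 0 X₀
        (Q.image (fun q : ℕ => (q : ℤ))) B hS (fun p hp => (mem_primesBetween.1 hp).2.1) hw1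
        (filter_subset _ _) (sum_primesBetween_inv_sq_le hw1) hk (by nlinarith)
        (card_offPairs_le k h₁ h₂) (by positivity) (fun m hm => by
          obtain ⟨q, hq, rfl⟩ := mem_image.1 hm
          have h6 := hQ q hq
          have := h6.1.pos
          have := h6.2.2.2
          rw [mem_Ioc]; constructor <;> exact_mod_cast by assumption) hB
      rw [sum_image (fun a _ b _ h => Nat.cast_injective h), hcard] at h5
      refine h5.trans ?_
      have hS' : ((S.filter (fun p : ℕ => (p : ℝ) ≤ T)).card : ℝ) ≤ T := by
        have : S.filter (fun p : ℕ => (p : ℝ) ≤ T) ⊆ Icc 1 ⌊T⌋₊ := fun p hp => by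
          have h7 := mem_filter.1 hp
          exact mem_Icc.2 ⟨(hS p h7.1).pos, Nat.le_floor h7.2⟩
        have := card_le_card this
        rw [Nat.card_Icc, Nat.add_sub_cancel] at this
        exact (Nat.cast_le.2 this).trans (Nat.floor_le hT0.le)
      rw [hR]
      have : (((X₀ : ℤ) : ℝ) - ((0 : ℤ) : ℝ)) = (X₀ : ℝ) := by push_cast; ring
      rw [this]
      gcongr
    calc _ ≤ ∑ q₁ ∈ Q, (1 + g q₁ + if q₁ = q₂ then E else 0) := sum_le_sum hone
      _ = Q.card + ∑ q₁ ∈ Q, g q₁ + E := by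
          rw [sum_add_distrib, sum_add_distrib, sum_ite_eq', if_pos hq₂]
          simp
      _ ≤ _ := by linarith
  have h2 : avg (PP z) (fun b => oneS z b n * (∑ q ∈ Q, ∑ h ∈ Icc 1 k, l q h b) ^ 2) ≤
      σ₂⁻¹ * σw * (Q.card * (k : ℝ) ^ 2 * (Q.card + R + E)) := by
    have hexp : ∀ b, oneS z b n * (∑ q ∈ Q, ∑ h ∈ Icc 1 k, l q h b) ^ 2 =
        ∑ q₂ ∈ Q, ∑ h₁ ∈ Icc 1 k, ∑ h₂ ∈ Icc 1 k, ∑ q₁ ∈ Q,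
          oneS z b n * (l q₁ h₁ b * l q₂ h₂ b) := by
      intro b
      have e1 : ∑ q ∈ Q, ∑ h ∈ Icc 1 k, l q h b = ∑ h ∈ Icc 1 k, ∑ q ∈ Q, l q h b := sum_comm
      rw [sq]
      have e2 : ∀ q₂, ∑ h₁ ∈ Icc 1 k, ∑ h₂ ∈ Icc 1 k, ∑ q₁ ∈ Q,
          oneS z b n * (l q₁ h₁ b * l q₂ h₂ b) =
          oneS z b n * ((∑ h₁ ∈ Icc 1 k, ∑ q₁ ∈ Q, l q₁ h₁ b) * ∑ h₂ ∈ Icc 1 k, l q₂ h₂ b) := by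
        intro q₂
        simp_rw [← mul_sum, ← sum_mul, ← mul_sum]
        rw [← sum_mul]
      simp_rw [e2]
      rw [← mul_sum, ← mul_sum, ← e1]
    simp_rw [hexp, avg_sum]
    calc _ ≤ ∑ q₂ ∈ Q, ∑ h₁ ∈ Icc 1 k, ∑ h₂ ∈ Icc 1 k, σ₂⁻¹ * σw * (Q.card + R + E) := by
          refine sum_le_sum fun q₂ hq₂ => sum_le_sum fun h₁ hh₁ => sum_le_sum fun h₂ hh₂ => ?_
          refine (sum_le_sum fun q₁ hq₁ => hpair q₁ hq₁ q₂ hq₂ h₁ hh₁ h₂ hh₂).trans ?_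
          rw [← mul_sum, ← mul_sum, ← mul_assoc]
          exact mul_le_mul_of_nonneg_left (hrow q₂ hq₂ h₁ hh₁ h₂ hh₂) (by positivity)
      _ = _ := by
          simp only [sum_const, Nat.card_Icc, nsmul_eq_mul, Nat.add_sub_cancel]; ring
  have hz1 : 1 ≤ z := hw1.trans hwz
  have h0 : avg (PP z) (fun b => oneS z b n) ≤ σw * σ₂ := by
    rw [avg_oneS hz1, sigUpTo_eq_mul hwz]
  have := avg_sq_sub_le (m := PP z) (c := Q.card * k / σ₂) (by positivity) h0 h1 h2
  refine this.trans (le_of_eq ?_)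
  rw [hR]
  field_simp
  ring

theorem oneS_comm (w : ℝ) (b n : ℤ) : oneS w b n = oneS w n b := by
  unfold oneS inS
  simp only [dvd_sub_comm (b := n) (c := b)]

theorem sigBetween_le_one (w z : ℝ) : sigBetween w z ≤ 1 := by
  refine prod_le_one (fun p hp => ?_) fun p hp => ?_
  · exact (one_sub_one_div_pos (mem_primesBetween.1 hp).1.two_le).le
  · have : (0 : ℝ) ≤ 1 / p := by positivity
    linarith

theorem PP_le_exp {w : ℝ} (hw : 0 ≤ w) : (PP w : ℝ) ≤ Real.exp (2 * w) := by
  have h1 : PP w ≤ primorial ⌊w⌋₊ := by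
    unfold PP primorial primesUpTo
    refine prod_le_prod_of_subset_of_one_le' (fun p hp => ?_) fun p hp _ => ?_
    · rw [mem_filter] at hp ⊢
      exact ⟨hp.1, hp.2.1⟩
    · exact (mem_filter.1 hp).2.pos
  have h2 : (PP w : ℝ) ≤ 4 ^ ⌊w⌋₊ := by exact_mod_cast h1.trans (primorial_le_four_pow _)
  refine h2.trans ?_
  have h4 : Real.log 4 ≤ 2 := by
    have : Real.log 4 = 2 * Real.log 2 := by
      rw [show (4 : ℝ) = 2 ^ 2 by norm_num, Real.log_pow]; norm_num
    linarith [Real.log_two_lt_d9]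
  rw [← Real.rpow_natCast, Real.rpow_def_of_pos (by norm_num)]
  refine Real.exp_le_exp.2 ?_
  calc Real.log 4 * (⌊w⌋₊ : ℝ) ≤ 2 * w := by
        gcongr
        exact Nat.floor_le hw
    _ = _ := rfl

theorem sum_Ioc_oneS_le {w : ℝ} (hw : 1 ≤ w) (b : ℤ) (y : ℕ) :
    ∑ n ∈ Ioc (0 : ℤ) y, oneS w b n ≤ sigUpTo w * y + PP w := by
  have hP : (0 : ℝ) < PP w := by exact_mod_cast PP_pos w
  have h1 := sum_Ioc_le_of_periodic (PP_pos w) (oneS_periodic w b) (fun n => oneS_nonneg w n b)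
    (a := 0) (b := y) (by positivity)
  have h2 : ∑ r ∈ range (PP w), oneS w r b = sigUpTo w * PP w := by
    have := avg_oneS hw b
    unfold avg at this
    rwa [div_eq_iff hP.ne'] at this
  have h3 : sigUpTo w ≤ 1 := by
    rw [← avg_oneS hw 0, ← avg_const (PP_pos w) 1]
    exact avg_mono fun b => oneS_le_one w b 0
  simp_rw [oneS_comm w b]
  refine h1.trans ?_
  rw [h2]
  push_cast
  have : ((y : ℝ) - 0) / PP w * (sigUpTo w * PP w) = sigUpTo w * y := by field_simp; ring
  rw [add_mul, this, one_mul]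
  nlinarith

theorem sum_two_div_mul_ite_dvd_le {S : Finset ℕ} (hS : ∀ p ∈ S, p.Prime) {w X : ℝ} (hw : 1 < w)
    (hSp : ∀ p ∈ S, w < p) {m : ℤ} (hm : m ≠ 0) (hmX : (|m| : ℝ) ≤ X) :
    ∑ p ∈ S, 2 / (p : ℝ) * (if (p : ℤ) ∣ m then (1 : ℝ) else 0) ≤
      2 * Real.log X / (w * Real.log w) := by
  set D := S.filter fun p : ℕ => (p : ℤ) ∣ m with hD
  have hm0 : 0 < m.natAbs := Int.natAbs_pos.2 hm
  have hprod : w ^ D.card ≤ (m.natAbs : ℝ) := by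
    calc w ^ D.card ≤ ((∏ p ∈ D, p : ℕ) : ℝ) := by
          rw [← prod_const]
          push_cast
          exact prod_le_prod (fun _ _ => by linarith) fun p hp => (hSp p (mem_filter.1 hp).1).le
      _ ≤ m.natAbs := by
          refine Nat.cast_le.2 (Nat.le_of_dvd hm0 (prod_primes_dvd _
            (fun p hp => (hS p (mem_filter.1 hp).1).prime) fun p hp => ?_))
          exact Int.natCast_dvd.1 (mem_filter.1 hp).2
  have hlw := Real.log_pos hw
  have h2 : (D.card : ℝ) ≤ Real.log X / Real.log w := by
    rw [le_div_iff₀ hlw, ← Real.log_pow]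
    refine Real.log_le_log (by positivity) (le_trans ?_ hmX)
    rw [Nat.cast_natAbs] at hprod
    push_cast at hprod
    exact hprod
  calc ∑ p ∈ S, 2 / (p : ℝ) * (if (p : ℤ) ∣ m then (1 : ℝ) else 0) = ∑ p ∈ D, 2 / (p : ℝ) := by
        rw [hD, sum_filter]
        refine sum_congr rfl fun p _ => ?_
        split_ifs <;> simp
    _ ≤ D.card • (2 / w) := sum_le_card_nsmul _ _ _ fun p hp => by
        have := hSp p (mem_filter.1 hp).1
        gcongr
    _ ≤ Real.log X / Real.log w * (2 / w) := by
        rw [nsmul_eq_mul]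
        gcongr
    _ = _ := by field_simp

/-- Variance of the number of sifted integers in an interval. -/
theorem avg_sq_sum_oneS_sub_le {w z : ℝ} (hw : 4 ≤ w) (hwz : w ≤ z) (y : ℕ) :
    avg (PP z) (fun b => (∑ n ∈ Ioc (0 : ℤ) y, oneS z b n - sigUpTo z * y) ^ 2) ≤
      Real.exp (2 * Real.log y / (w * Real.log w)) * (sigUpTo z * y + PP w) ^ 2 +
        sigUpTo z * y - (sigUpTo z * y) ^ 2 := by
  have hw1 : 1 ≤ w := by linarith
  have hz1 : 1 ≤ z := hw1.trans hwz
  have hσ2 := sigBetween_pos w z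
  have hσw := sigUpTo_pos w
  set S := primesBetween w z with hS
  set σ₂ := sigBetween w z with hσ2def
  set D := Real.exp (2 * Real.log y / (w * Real.log w)) with hD
  have hsum : avg (PP z) (fun b => ∑ n ∈ Ioc (0 : ℤ) y, oneS z b n) = sigUpTo z * y := by
    rw [avg_sum]
    simp_rw [avg_oneS hz1]
    simp [mul_comm]
  have hpair : ∀ n₁ ∈ Ioc (0 : ℤ) y, ∀ n₂ ∈ Ioc (0 : ℤ) y,
      avg (PP z) (fun b => oneS z b n₁ * oneS z b n₂) ≤
        σ₂ ^ 2 * D * avg (PP w) (fun b => oneS w b n₁ * oneS w b n₂) +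
          if n₂ = n₁ then sigUpTo z else 0 := by
    intro n₁ hn₁ n₂ hn₂
    have hnn : 0 ≤ avg (PP w) (fun b => oneS w b n₁ * oneS w b n₂) :=
      avg_nonneg fun b => mul_nonneg (oneS_nonneg _ _ _) (oneS_nonneg _ _ _)
    have hD0 : 0 ≤ D := (Real.exp_pos _).le
    split_ifs with heq
    · have : avg (PP z) (fun b => oneS z b n₁ * oneS z b n₂) ≤ sigUpTo z := by
        rw [← avg_oneS hz1 n₁]
        exact avg_mono fun b => mul_le_of_le_one_right (oneS_nonneg _ _ _) (oneS_le_one _ _ _)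
      have : 0 ≤ σ₂ ^ 2 * D * avg (PP w) (fun b => oneS w b n₁ * oneS w b n₂) := by positivity
      linarith
    · rw [add_zero]
      have e : ∀ b, oneS z b n₁ * oneS z b n₂ = σ₂ ^ 2 * ((oneS w b n₁ * oneS w b n₂) *
          (lamSet w z {n₁} b * lamSet w z {n₂} b)) := fun b => by
        rw [oneS_eq hwz n₁, oneS_eq hwz n₂]; ring
      simp_rw [e]
      rw [avg_const_mul, mul_assoc]
      refine mul_le_mul_of_nonneg_left ?_ (by positivity)
      have hsing : ∀ n : ℤ, ∀ p ∈ S, ∀ a ∈ ({n} : Finset ℤ), ∀ a' ∈ ({n} : Finset ℤ),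
          (p : ℤ) ∣ a - a' → a = a' := fun n p _ a ha a' ha' _ => by
        rw [mem_singleton] at ha ha'
        rw [ha, ha']
      have h1 := avg_mul_lamSet_mul_lamSet_le hwz (F := fun b => oneS w b n₁ * oneS w b n₂)
        (fun b => by
          have h1 := oneS_periodic w n₁ b
          have h2 := oneS_periodic w n₂ b
          simp only at h1 h2 ⊢
          rw [h1, h2])
        (fun b => mul_nonneg (oneS_nonneg _ _ _) (oneS_nonneg _ _ _)) (hsing n₁) (hsing n₂)
        (k := 1) (by simp) (by simp) (fun p hp => by
          have := (mem_primesBetween.1 hp).2.1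
          have : (4 : ℝ) ≤ p := by linarith
          exact_mod_cast this)
      refine h1.trans ?_
      rw [mul_comm]
      refine mul_le_mul_of_nonneg_right ?_ hnn
      refine (prod_one_add_le_exp_sum _ fun p => by positivity).trans (Real.exp_le_exp.2 ?_)
      rw [mem_Ioc] at hn₁ hn₂
      refine le_trans (le_of_eq ?_) (sum_two_div_mul_ite_dvd_le (S := S) (m := n₁ - n₂) (X := y)
        (fun p hp => (mem_primesBetween.1 hp).1) (by linarith : 1 < w)
        (fun p hp => (mem_primesBetween.1 hp).2.1) (by omega) ?_)
      · refine sum_congr rfl fun p _ => ?_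
        have : (coinc p {n₁} {n₂} : ℝ) = if (p : ℤ) ∣ n₁ - n₂ then (1 : ℝ) else 0 := by
          unfold coinc
          rw [singleton_product_singleton, filter_singleton]
          split_ifs <;> simp
        rw [this]; ring
      · have : |n₁ - n₂| ≤ (y : ℤ) := by rw [abs_le]; constructor <;> omega
        exact_mod_cast this
  have h2 : avg (PP z) (fun b => 1 * (∑ n ∈ Ioc (0 : ℤ) y, oneS z b n) ^ 2) ≤
      D * (sigUpTo z * y + PP w) ^ 2 + sigUpTo z * y := by
    simp_rw [one_mul, sq, sum_mul_sum]
    rw [avg_sum]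
    simp_rw [avg_sum]
    calc _ ≤ ∑ n₁ ∈ Ioc (0 : ℤ) y, ∑ n₂ ∈ Ioc (0 : ℤ) y,
          (σ₂ ^ 2 * D * avg (PP w) (fun b => oneS w b n₁ * oneS w b n₂) +
          if n₂ = n₁ then sigUpTo z else 0) :=
          sum_le_sum fun n₁ h₁ => sum_le_sum fun n₂ h₂ => hpair n₁ h₁ n₂ h₂
      _ = σ₂ ^ 2 * D * avg (PP w) (fun b => (∑ n ∈ Ioc (0 : ℤ) y, oneS w b n) ^ 2) +
          sigUpTo z * y := by
          simp_rw [sum_add_distrib, ← mul_sum]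
          congr 1
          · congr 1
            simp_rw [sq, sum_mul_sum]
            rw [avg_sum]
            simp_rw [avg_sum]
          · simp_rw [sum_ite_eq']
            rw [sum_congr rfl fun n hn => if_pos hn]
            simp [mul_comm]
      _ ≤ σ₂ ^ 2 * D * (sigUpTo w * y + PP w) ^ 2 + sigUpTo z * y := by
          have hD0 : 0 ≤ D := (Real.exp_pos _).le
          gcongr
          rw [← avg_const (PP_pos w) ((sigUpTo w * y + PP w) ^ 2)]
          refine avg_mono fun b => ?_
          exact pow_le_pow_left₀ (sum_nonneg fun n _ => oneS_nonneg _ _ _)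
            (sum_Ioc_oneS_le hw1 b y) 2
      _ = D * (sigUpTo z * y + σ₂ * PP w) ^ 2 + sigUpTo z * y := by
          rw [sigUpTo_eq_mul hwz]; ring
      _ ≤ D * (sigUpTo z * y + PP w) ^ 2 + sigUpTo z * y := by
          have hD0 : 0 ≤ D := (Real.exp_pos _).le
          have := sigUpTo_pos z
          have : σ₂ * PP w ≤ PP w := mul_le_of_le_one_left (by positivity) (sigBetween_le_one w z)
          gcongr
      _ = _ := by ring
  have hc : 0 ≤ sigUpTo z * y := mul_nonneg (sigUpTo_pos z).le (by positivity)
  have := avg_sq_sub_le (m := PP z) (G := fun _ => 1) hc (avg_const (PP_pos z) 1).le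
    (E₁ := sigUpTo z * y) (by simp_rw [one_mul]; exact hsum.ge) h2
  simp only [one_mul] at this
  refine this.trans (le_of_eq ?_)
  ring

/-- The total weight of the progressions of step `q` starting in `(-Ky, y]`. -/
noncomputable def totalWeight (w z : ℝ) (k K y q : ℕ) (b : ℤ) : ℝ :=
  ∑ n ∈ Ioc (-((K * y : ℕ) : ℤ)) (y : ℤ), lamSet w z (ap k q n) b

/-- The weight of the progressions through `n` whose step lies in `Q`. -/
noncomputable def throughWeight (w z : ℝ) (k : ℕ) (Q : Finset ℕ) (n b : ℤ) : ℝ :=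
  ∑ q ∈ Q, ∑ h ∈ Icc 1 k, lamSet w z (ap k q (n - (q : ℤ) * (h : ℤ))) b

/-- The steps whose total weight is far from its mean. -/
noncomputable def badSteps (w z τ : ℝ) (k K y : ℕ) (Q : Finset ℕ) (b : ℤ) : Finset ℕ :=
  Q.filter fun q => ((K : ℝ) + 1) * y * τ < |totalWeight w z k K y q b - ((K : ℝ) + 1) * y|

/-- The sifted integers at which the weight through a point is far from its mean, or at which the
bad steps contribute too much. -/
noncomputable def badPoints (w z τ m : ℝ) (k K y : ℕ) (Q : Finset ℕ) (b : ℤ) : Finset ℤ :=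
  (Ioc (0 : ℤ) y).filter fun n => inS z b n ∧ (y * τ < |throughWeight w z k Q n b - m| ∨
    y * τ < throughWeight w z k (badSteps w z τ k K y Q b) n b)

section

variable {w z τ m : ℝ} {k K y : ℕ} {Q : Finset ℕ}

theorem throughWeight_nonneg (n b : ℤ) : 0 ≤ throughWeight w z k Q n b :=
  sum_nonneg fun _ _ => sum_nonneg fun _ _ => lamSet_nonneg _ _ _ _

theorem sum_throughWeight_le (hQ : ∀ q ∈ Q, q * k ≤ K * y) (b : ℤ) :
    ∑ n ∈ Ioc (0 : ℤ) y, throughWeight w z k Q n b ≤ ∑ q ∈ Q, k * totalWeight w z k K y q b := by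
  unfold throughWeight
  rw [sum_comm]
  refine sum_le_sum fun q hq => ?_
  rw [sum_comm]
  have h1 : ∀ h ∈ Icc 1 k, ∑ n ∈ Ioc (0 : ℤ) y, lamSet w z (ap k q (n - (q : ℤ) * (h : ℤ))) b ≤
      totalWeight w z k K y q b := by
    intro h hh
    have hh := mem_Icc.1 hh
    have hle : (q : ℤ) * h ≤ (K * y : ℕ) := by
      exact_mod_cast (Nat.mul_le_mul_left q hh.2).trans (hQ q hq)
    have hpos : (0 : ℤ) ≤ (q : ℤ) * h := by positivity
    calc _ = ∑ n ∈ (Ioc (0 : ℤ) y).image (fun n => n - (q : ℤ) * (h : ℤ)),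
          lamSet w z (ap k q n) b := by
          rw [sum_image]
          intro a _ b _ hab
          simpa using hab
      _ ≤ _ := by
          refine sum_le_sum_of_subset_of_nonneg (fun n hn => ?_) fun _ _ _ => lamSet_nonneg _ _ _ _
          obtain ⟨a, ha, rfl⟩ := mem_image.1 hn
          rw [mem_Ioc] at ha ⊢
          constructor <;> omega
  calc _ ≤ (Icc 1 k).card • totalWeight w z k K y q b := sum_le_card_nsmul _ _ _ h1
    _ = _ := by rw [Nat.card_Icc, Nat.add_sub_cancel, nsmul_eq_mul]

theorem card_badPoints_le (hτ : 0 < τ) (hτ1 : τ ≤ 1) (hy : 0 < y)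
    (hQ : ∀ q ∈ Q, q * k ≤ K * y) (b : ℤ) :
    ((badPoints w z τ m k K y Q b).card : ℝ) ≤
      1 / (y * τ) ^ 2 * ∑ n ∈ Ioc (0 : ℤ) y, oneS z b n * (throughWeight w z k Q n b - m) ^ 2 +
      2 * k / (y * τ * (τ ^ 2 * (((K : ℝ) + 1) * y))) *
        ∑ q ∈ Q, (totalWeight w z k K y q b - ((K : ℝ) + 1) * y) ^ 2 := by
  have hy0 : (0 : ℝ) < y := by exact_mod_cast hy
  set Y : ℝ := ((K : ℝ) + 1) * y with hY
  have hY0 : 0 < Y := by positivity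
  set Bad := badSteps w z τ k K y Q b with hBad
  have hyt : 0 < y * τ := by positivity
  have h1 : ((badPoints w z τ m k K y Q b).card : ℝ) ≤ ∑ n ∈ Ioc (0 : ℤ) y,
      (1 / (y * τ) ^ 2 * (oneS z b n * (throughWeight w z k Q n b - m) ^ 2) +
        1 / (y * τ) * throughWeight w z k Bad n b) := by
    unfold badPoints
    rw [card_filter]
    push_cast
    refine sum_le_sum fun n _ => ?_
    have p1 : 0 ≤ 1 / (y * τ) ^ 2 * (oneS z b n * (throughWeight w z k Q n b - m) ^ 2) :=
      mul_nonneg (by positivity) (mul_nonneg (oneS_nonneg _ _ _) (sq_nonneg _))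
    have p2 : 0 ≤ 1 / (y * τ) * throughWeight w z k Bad n b :=
      mul_nonneg (by positivity) (throughWeight_nonneg _ _)
    split_ifs with h
    · rcases h.2 with h2 | h2
      · have : 1 ≤ 1 / (y * τ) ^ 2 * (oneS z b n * (throughWeight w z k Q n b - m) ^ 2) := by
          rw [oneS, if_pos h.1, one_mul, one_div_mul_eq_div, one_le_div (by positivity), ← sq_abs
            (throughWeight w z k Q n b - m)]
          gcongr
        linarith
      · have : 1 ≤ 1 / (y * τ) * throughWeight w z k Bad n b := by
          rw [one_div_mul_eq_div, one_le_div hyt]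
          exact h2.le
        linarith
    · linarith
  rw [sum_add_distrib, ← mul_sum, ← mul_sum] at h1
  refine h1.trans (add_le_add_right ?_ _)
  have h2 := sum_throughWeight_le (w := w) (z := z) (Q := Bad) (k := k) (K := K) (y := y)
    (fun q hq => hQ q (mem_filter.1 hq).1) b
  have h3 : ∑ q ∈ Bad, k * totalWeight w z k K y q b ≤
      ∑ q ∈ Q, k * (2 / (τ ^ 2 * Y) * (totalWeight w z k K y q b - Y) ^ 2) := by
    refine (sum_le_sum (fun q hq => ?_)).trans (sum_le_sum_of_subset_of_nonneg
      (f := fun q => k * (2 / (τ ^ 2 * Y) * (totalWeight w z k K y q b - Y) ^ 2))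
      (filter_subset _ _) fun q _ _ => by positivity)
    refine mul_le_mul_of_nonneg_left ?_ (by positivity)
    have hb : Y * τ < |totalWeight w z k K y q b - Y| := (mem_filter.1 hq).2
    rw [← sq_abs (totalWeight w z k K y q b - Y), div_mul_eq_mul_div, le_div_iff₀ (by positivity)]
    have hle : totalWeight w z k K y q b ≤ Y + |totalWeight w z k K y q b - Y| := by
      linarith [le_abs_self (totalWeight w z k K y q b - Y)]
    set u := |totalWeight w z k K y q b - Y|
    have e1 : Y * τ * (Y * τ) ≤ u * u := mul_self_le_mul_self (by positivity) hb.le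
    have e2 : u * (τ ^ 2 * Y) ≤ u * u := by
      have : τ ^ 2 * Y ≤ u := by nlinarith [mul_pos hτ hY0]
      exact mul_le_mul_of_nonneg_left this (abs_nonneg _)
    have e3 := mul_le_mul_of_nonneg_right hle (by positivity : 0 ≤ τ ^ 2 * Y)
    nlinarith
  calc 1 / (y * τ) * ∑ n ∈ Ioc (0 : ℤ) y, throughWeight w z k Bad n b
      ≤ 1 / (y * τ) * ∑ q ∈ Q, k * (2 / (τ ^ 2 * Y) * (totalWeight w z k K y q b - Y) ^ 2) := by
        gcongr
        exact h2.trans h3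
    _ = _ := by
        rw [mul_sum, mul_sum]
        refine sum_congr rfl fun q _ => ?_
        field_simp

theorem avg_card_badPoints_le {V₁ V₂ : ℝ} (hτ : 0 < τ) (hτ1 : τ ≤ 1) (hy : 0 < y)
    (hQ : ∀ q ∈ Q, q * k ≤ K * y)
    (hV₁ : ∀ n, avg (PP z) (fun b => oneS z b n * (throughWeight w z k Q n b - m) ^ 2) ≤ V₁)
    (hV₂ : ∀ q ∈ Q, avg (PP z)
      (fun b => (totalWeight w z k K y q b - ((K : ℝ) + 1) * y) ^ 2) ≤ V₂) :
    avg (PP z) (fun b => ((badPoints w z τ m k K y Q b).card : ℝ)) ≤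
      1 / (y * τ) ^ 2 * (y * V₁) +
        2 * k / (y * τ * (τ ^ 2 * (((K : ℝ) + 1) * y))) * (Q.card * V₂) := by
  refine (avg_mono fun b => card_badPoints_le hτ hτ1 hy hQ b).trans ?_
  rw [avg_add, avg_const_mul, avg_const_mul, avg_sum, avg_sum]
  refine add_le_add (mul_le_mul_of_nonneg_left ?_ (by positivity))
    (mul_le_mul_of_nonneg_left ?_ (by positivity))
  · refine (sum_le_card_nsmul _ _ _ fun n _ => hV₁ n).trans (le_of_eq ?_)
    simp
  · refine (sum_le_card_nsmul _ _ _ hV₂).trans (le_of_eq ?_)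
    simp

end

/-- The Markov inequality for the average over residues. -/
theorem card_filter_lt_mul_le {m : ℕ} (hm : 0 < m) {f : ℤ → ℝ} (hf : ∀ b, 0 ≤ f b) (t : ℝ) :
    (((range m).filter fun b : ℕ => t < f b).card : ℝ) * t ≤ m * avg m f := by
  have hm0 : (m : ℝ) ≠ 0 := by exact_mod_cast hm.ne'
  unfold avg
  rw [mul_div_cancel₀ _ hm0]
  calc _ = ((range m).filter fun b : ℕ => t < f b).card • t := by rw [nsmul_eq_mul]
    _ ≤ ∑ b ∈ (range m).filter fun b : ℕ => t < f b, f b :=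
        card_nsmul_le_sum _ _ _ fun b hb => (mem_filter.1 hb).2.le
    _ ≤ _ := sum_le_sum_of_subset_of_nonneg (filter_subset _ _) fun b _ _ => hf b

end SievedGaps

namespace SievedGaps
open Finset Filter

theorem eventually_le_log (A : ℝ) : ∀ᶠ x : ℝ in atTop, A ≤ Real.log x :=
  Real.tendsto_log_atTop.eventually_ge_atTop A

theorem eventually_le_log_log (A : ℝ) : ∀ᶠ x : ℝ in atTop, A ≤ Real.log (Real.log x) :=
  (Real.tendsto_log_atTop.comp Real.tendsto_log_atTop).eventually_ge_atTop A

theorem eventually_mul_log_rpow_le (B A : ℝ) {a : ℝ} (ha : 0 < a) :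
    ∀ᶠ x : ℝ in atTop, B * Real.log x ^ A ≤ x ^ a := by
  have h := (isLittleO_log_rpow_rpow_atTop A ha).def (c := 1 / (|B| + 1)) (by positivity)
  filter_upwards [h, eventually_ge_atTop 1, eventually_le_log 1] with x hx hx1 hL
  have h1 : 0 ≤ Real.log x ^ A := Real.rpow_nonneg (by linarith) _
  have h2 : 0 ≤ x ^ a := Real.rpow_nonneg (by linarith) _
  rw [Real.norm_of_nonneg h1, Real.norm_of_nonneg h2, one_div_mul_eq_div,
    le_div_iff₀ (by positivity)] at hx
  nlinarith [le_abs_self B]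

theorem eventually_mul_log_log_rpow_le (B A : ℝ) {a : ℝ} (ha : 0 < a) :
    ∀ᶠ x : ℝ in atTop, B * Real.log (Real.log x) ^ A ≤ Real.log x ^ a :=
  Real.tendsto_log_atTop.eventually (eventually_mul_log_rpow_le B A ha)

/-- The elementary size relations between `x`, `y` and `z` for large `x`. -/
structure Regime (δ x : ℝ) : Prop where
  log_ge : 16 ≤ Real.log x
  loglog_ge : 2 ≤ Real.log (Real.log x)
  x_ge : 16 ≤ x
  le_y : x * Real.log x ^ δ ≤ yy δ x
  y_le : (yy δ x : ℝ) ≤ 2 * (x * Real.log x ^ δ)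
  x_le_y : x ≤ yy δ x
  y_le_sq : (yy δ x : ℝ) ≤ x ^ (2 : ℝ)
  sqrt_le_z : x ^ (1 / 2 : ℝ) ≤ zz δ x
  z_le_y : zz δ x ≤ yy δ x

theorem eventually_regime {δ : ℝ} (hδ0 : 0 < δ) : ∀ᶠ x in atTop, Regime δ x := by
  filter_upwards [eventually_le_log 16, eventually_le_log_log 2, eventually_ge_atTop 16,
    eventually_mul_log_rpow_le 2 δ one_pos, eventually_mul_log_rpow_le 1 (1 / 2)
      (by norm_num : (0 : ℝ) < 1 / 2), eventually_mul_log_log_rpow_le 1 2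
      (by norm_num : (0 : ℝ) < 1 / 2)] with x hL hLL hx h1 h2 h3
  have hL1 : 1 ≤ Real.log x ^ δ := Real.one_le_rpow (by linarith) hδ0.le
  have hx0 : 0 < x := by linarith
  have hle : x * Real.log x ^ δ ≤ yy δ x := Nat.le_ceil _
  have hlt : (yy δ x : ℝ) < x * Real.log x ^ δ + 1 := Nat.ceil_lt_add_one (by positivity)
  have hxL : x ≤ x * Real.log x ^ δ := le_mul_of_one_le_right hx0.le hL1
  have hy2 : (yy δ x : ℝ) ≤ 2 * (x * Real.log x ^ δ) := by linarith
  have hxy : x ≤ yy δ x := hxL.trans hle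
  have h3' : Real.log (Real.log x) ^ 2 ≤ Real.log x ^ (1 / 2 : ℝ) := by
    rw [one_mul] at h3
    exact_mod_cast h3
  have hr : 0 < Real.log x ^ (1 / 2 : ℝ) := Real.rpow_pos_of_pos (by linarith) _
  refine ⟨hL, hLL, hx, hle, hy2, hxy, ?_, ?_, ?_⟩
  · rw [Real.rpow_one] at h1
    rw [Real.rpow_two]
    calc (yy δ x : ℝ) ≤ x * (2 * Real.log x ^ δ) := by linarith
      _ ≤ x * x := by gcongr
      _ = x ^ 2 := by ring
  · unfold zz
    rw [le_div_iff₀ hr]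
    rw [one_mul] at h2
    calc x ^ (1 / 2 : ℝ) * Real.log x ^ (1 / 2 : ℝ) ≤ x ^ (1 / 2 : ℝ) * x ^ (1 / 2 : ℝ) := by gcongr
      _ = x := by rw [← Real.rpow_add hx0]; norm_num
      _ ≤ yy δ x * 1 := by linarith
      _ ≤ yy δ x * Real.log (Real.log x) ^ 2 := by
          gcongr
          nlinarith
  · unfold zz
    rw [div_le_iff₀ hr]
    gcongr

section

variable {δ x : ℝ}

theorem Regime.x_pos (h : Regime δ x) : 0 < x := by linarith [h.x_ge]

theorem Regime.y_pos (h : Regime δ x) : (0 : ℝ) < yy δ x := by linarith [h.x_ge, h.x_le_y]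

theorem Regime.z_ge (h : Regime δ x) : 4 ≤ zz δ x := by
  refine le_trans ?_ h.sqrt_le_z
  have : (4 : ℝ) = (16 : ℝ) ^ (1 / 2 : ℝ) := by
    rw [show (16 : ℝ) = 4 ^ (2 : ℝ) by norm_num, ← Real.rpow_mul (by norm_num)]
    norm_num
  rw [this]
  exact Real.rpow_le_rpow (by norm_num) h.x_ge (by norm_num)

theorem Regime.log_y_le (h : Regime δ x) : Real.log (yy δ x) ≤ 2 * Real.log x := by
  rw [← Real.log_rpow h.x_pos]
  exact Real.log_le_log h.y_pos h.y_le_sq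

theorem Regime.log_z_le (h : Regime δ x) : Real.log (zz δ x) ≤ 2 * Real.log x :=
  (Real.log_le_log (by linarith [h.z_ge]) h.z_le_y).trans h.log_y_le

theorem Regime.le_log_z (h : Regime δ x) : 1 / 2 * Real.log x ≤ Real.log (zz δ x) := by
  rw [← Real.log_rpow h.x_pos]
  exact Real.log_le_log (Real.rpow_pos_of_pos h.x_pos _) h.sqrt_le_z

theorem Regime.two_log_rpow_le (h : Regime δ x) {H : ℝ} (hH : 2 * (yy δ x : ℝ) / x ≤ H) :
    2 * Real.log x ^ δ ≤ H := by
  refine le_trans ?_ hH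
  rw [le_div_iff₀ h.x_pos]
  linarith [h.le_y]

theorem Regime.y_div_le (h : Regime δ x) {H : ℝ} (hH : 2 * (yy δ x : ℝ) / x ≤ H) :
    (yy δ x : ℝ) / H ≤ x / 2 := by
  have hx := h.x_pos
  have hy := h.y_pos
  have hH0 : 0 < H := lt_of_lt_of_le (by positivity) hH
  rw [div_le_iff₀ hx] at hH
  rw [div_le_div_iff₀ hH0 (by norm_num)]
  linarith

theorem Regime.mul_loglog_sq_le (h : Regime δ x) {ξ H : ℝ} (hξ : 1 < ξ)
    (hH : H ≤ (yy δ x : ℝ) / (ξ * zz δ x)) :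
    ξ * H * Real.log (Real.log x) ^ 2 ≤ Real.log x ^ (1 / 2 : ℝ) := by
  have hz : 0 < zz δ x := by linarith [h.z_ge]
  have hy := h.y_pos
  have hr : 0 < Real.log x ^ (1 / 2 : ℝ) := Real.rpow_pos_of_pos (by linarith [h.log_ge]) _
  rw [le_div_iff₀ (by positivity)] at hH
  unfold zz at hH
  have e : H * (ξ * (yy δ x * Real.log (Real.log x) ^ 2 / Real.log x ^ (1 / 2 : ℝ))) =
      yy δ x * (ξ * H * Real.log (Real.log x) ^ 2 / Real.log x ^ (1 / 2 : ℝ)) := by ring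
  rw [e] at hH
  have := le_of_mul_le_mul_left (hH.trans (le_of_eq (mul_one _).symm)) hy
  rwa [div_le_one hr] at this

theorem Regime.z_lt (h : Regime δ x) {ξ H q : ℝ} (hξ : 1 < ξ) (hH0 : 0 < H)
    (hH : H ≤ (yy δ x : ℝ) / (ξ * zz δ x)) (hq : (yy δ x : ℝ) / (ξ * H) < q) : zz δ x < q := by
  have hz : 0 < zz δ x := by linarith [h.z_ge]
  refine lt_of_le_of_lt ?_ hq
  rw [le_div_iff₀ (by positivity)] at hH ⊢
  linarith

theorem Regime.mul_loglog_sq_le_mul (h : Regime δ x) {ξ H : ℝ} (hξ : 1 < ξ) (hH0 : 0 < H)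
    (hH : H ≤ (yy δ x : ℝ) / (ξ * zz δ x)) :
    H * Real.log (Real.log x) ^ 2 ≤ Real.log x ^ (1 / 2 : ℝ) := by
  refine le_trans ?_ (h.mul_loglog_sq_le hξ hH)
  have : H ≤ ξ * H := le_mul_of_one_le_left hH0.le hξ.le
  gcongr

theorem Regime.H_le (h : Regime δ x) {ξ H : ℝ} (hξ : 1 < ξ) (hH0 : 0 < H)
    (hH : H ≤ (yy δ x : ℝ) / (ξ * zz δ x)) : H ≤ Real.log x ^ (1 / 2 : ℝ) := by
  refine le_trans ?_ (h.mul_loglog_sq_le_mul hξ hH0 hH)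
  have := h.loglog_ge
  have : 1 ≤ Real.log (Real.log x) ^ 2 := by nlinarith
  exact le_mul_of_one_le_right hH0.le this

theorem Regime.H_le_log (h : Regime δ x) {ξ H : ℝ} (hξ : 1 < ξ) (hH0 : 0 < H)
    (hH : H ≤ (yy δ x : ℝ) / (ξ * zz δ x)) : H ≤ Real.log x := by
  refine (h.H_le hξ hH0 hH).trans ?_
  nth_rewrite 2 [← Real.rpow_one (Real.log x)]
  exact Real.rpow_le_rpow_of_exponent_le (by linarith [h.log_ge]) (by norm_num)

end

/-- The size relations available for a scale `H` in the admissible range, when `x` is large. -/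
structure Scale (δ ξ M : ℝ) (K : ℕ) (x H : ℝ) : Prop where
  regime : Regime δ x
  one_lt : 1 < ξ
  lo : 2 * (yy δ x : ℝ) / x ≤ H
  hi : H ≤ (yy δ x : ℝ) / (ξ * zz δ x)
  four_le : 4 ≤ H
  four_mul_le : 4 * (K : ℝ) ^ 2 ≤ H
  rpow_le_z : H ^ M ≤ zz δ x

section

variable {δ ξ M x H : ℝ} {K : ℕ}

theorem eventually_scale (hδ0 : 0 < δ) (hξ : 1 < ξ) (M : ℝ) (hM : 0 ≤ M) (K : ℕ) :
    ∀ᶠ x in atTop, ∀ H, 2 * (yy δ x : ℝ) / x ≤ H → H ≤ (yy δ x : ℝ) / (ξ * zz δ x) →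
      Scale δ ξ M K x H := by
  filter_upwards [eventually_regime hδ0, eventually_mul_log_rpow_le 1 M
    (by norm_num : (0 : ℝ) < 1 / 2), ((tendsto_rpow_atTop hδ0).comp
      Real.tendsto_log_atTop).eventually_ge_atTop (4 + 4 * (K : ℝ) ^ 2)] with x hR h1 h2 H hlo hhi
  have hy := hR.y_pos
  have hx := hR.x_pos
  have hH0 : 0 < H := lt_of_lt_of_le (by positivity) hlo
  simp only [Function.comp] at h2
  have h3 := hR.two_log_rpow_le hlo
  have hK : 0 ≤ (K : ℝ) ^ 2 := by positivity
  refine ⟨hR, hξ, hlo, hhi, by linarith, by linarith, ?_⟩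
  refine le_trans ?_ hR.sqrt_le_z
  rw [one_mul] at h1
  exact (Real.rpow_le_rpow hH0.le (hR.H_le_log hξ hH0 hhi) hM).trans h1

theorem Scale.pos (h : Scale δ ξ M K x H) : 0 < H := by linarith [h.four_le]

theorem Scale.le_log (h : Scale δ ξ M K x H) : H ≤ Real.log x :=
  h.regime.H_le_log h.one_lt h.pos h.hi

theorem Scale.log_pos (h : Scale δ ξ M K x H) : 0 < Real.log x := by linarith [h.regime.log_ge]

theorem Scale.log_rpow_le (h : Scale δ ξ M K x H) : Real.log x ^ δ ≤ H := by
  have h1 := h.regime.two_log_rpow_le h.lo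
  have h2 : 0 ≤ Real.log x ^ δ := Real.rpow_nonneg h.log_pos.le _
  linarith

theorem Scale.mul_sq_pow_le (h : Scale δ ξ M K x H) :
    H ^ 2 * Real.log (Real.log x) ^ 4 ≤ Real.log x := by
  have h1 := h.regime.mul_loglog_sq_le_mul h.one_lt h.pos h.hi
  have h2 : 0 ≤ H * Real.log (Real.log x) ^ 2 := mul_nonneg h.pos.le (sq_nonneg _)
  calc H ^ 2 * Real.log (Real.log x) ^ 4 = (H * Real.log (Real.log x) ^ 2) ^ 2 := by ring
    _ ≤ (Real.log x ^ (1 / 2 : ℝ)) ^ 2 := by gcongr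
    _ = Real.log x := by
        rw [← Real.rpow_natCast, ← Real.rpow_mul h.log_pos.le]
        norm_num

theorem Scale.sq_le_rpow (h : Scale δ ξ M K x H) (hM : 6 < M) :
    H ^ 6 ≤ H ^ M := by
  rw [← Real.rpow_natCast]
  exact Real.rpow_le_rpow_of_exponent_le (by linarith [h.four_le]) (by norm_num; linarith)

theorem Scale.four_le_rpow (h : Scale δ ξ M K x H) (hM : 6 < M) : 4 ≤ H ^ M :=
  (h.four_le.trans (le_self_pow₀ (by linarith [h.four_le]) (by norm_num))).trans (h.sq_le_rpow hM)

theorem Scale.one_le_log_rpow (h : Scale δ ξ M K x H) (hM : 6 < M) : 1 ≤ Real.log (H ^ M) := by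
  rw [Real.le_log_iff_exp_le (by linarith [h.four_le_rpow hM])]
  linarith [Real.exp_one_lt_d9, h.four_le_rpow hM]

theorem Scale.one_le_floor (h : Scale δ ξ M K x H) (hK : 1 ≤ K) : 1 ≤ ⌊(K : ℝ) * H⌋₊ := by
  rw [Nat.one_le_floor_iff]
  have : (1 : ℝ) ≤ K := by exact_mod_cast hK
  nlinarith [h.four_le]

theorem Scale.floor_le (h : Scale δ ξ M K x H) : (⌊(K : ℝ) * H⌋₊ : ℝ) ≤ K * H :=
  Nat.floor_le (mul_nonneg (Nat.cast_nonneg _) h.pos.le)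

theorem Scale.floor_sq_le (h : Scale δ ξ M K x H) :
    (⌊(K : ℝ) * H⌋₊ : ℝ) ^ 2 ≤ (K : ℝ) ^ 2 * H ^ 2 := by
  rw [← mul_pow]
  exact pow_le_pow_left₀ (Nat.cast_nonneg _) h.floor_le 2

theorem Scale.four_mul_floor_sq_le (h : Scale δ ξ M K x H) (hM : 6 < M) :
    4 * (⌊(K : ℝ) * H⌋₊ : ℝ) ^ 2 ≤ H ^ M := by
  refine le_trans ?_ (h.sq_le_rpow hM)
  have hH := h.four_le
  have h1 : (1 : ℝ) ≤ H ^ 3 := one_le_pow₀ (by linarith)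
  calc 4 * (⌊(K : ℝ) * H⌋₊ : ℝ) ^ 2 ≤ 4 * ((K : ℝ) ^ 2 * H ^ 2) := by gcongr; exact h.floor_sq_le
    _ = 4 * (K : ℝ) ^ 2 * H ^ 2 := by ring
    _ ≤ H * H ^ 2 := by gcongr; exact h.four_mul_le
    _ ≤ H * H ^ 2 * H ^ 3 := le_mul_of_one_le_right (by positivity) h1
    _ = H ^ 6 := by ring

theorem Scale.sqrt_le_div (h : Scale δ ξ M K x H) : x ^ (1 / 2 : ℝ) ≤ (yy δ x : ℝ) / H := by
  have hz : 0 < zz δ x := by linarith [h.regime.z_ge]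
  have h1 := h.hi
  have hξ := h.one_lt
  have hH := h.pos
  refine h.regime.sqrt_le_z.trans ?_
  rw [le_div_iff₀ (by positivity)] at h1 ⊢
  calc zz δ x * H ≤ H * (ξ * zz δ x) := by nlinarith [mul_pos hH hz]
    _ ≤ _ := h1

theorem mem_QH {q : ℕ} : q ∈ QH δ ξ x H ↔
    q.Prime ∧ (yy δ x : ℝ) / (ξ * H) < q ∧ (q : ℝ) ≤ (yy δ x : ℝ) / H := by
  unfold QH
  rw [mem_filter, mem_range, and_iff_right_iff_imp]
  exact fun hq => Nat.lt_succ_of_le (Nat.le_floor hq.2.2)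

theorem Scale.z_lt (h : Scale δ ξ M K x H) {q : ℕ} (hq : q ∈ QH δ ξ x H) : zz δ x < q :=
  h.regime.z_lt h.one_lt h.pos h.hi (mem_QH.1 hq).2.1

theorem Scale.floor_lt (h : Scale δ ξ M K x H) (hM : 6 < M) (hK : 1 ≤ K) {q : ℕ}
    (hq : q ∈ QH δ ξ x H) :
    ⌊(K : ℝ) * H⌋₊ < q := by
  have h1 := h.z_lt hq
  have h2 := h.four_mul_floor_sq_le hM
  have h3 := h.rpow_le_z
  have h4 : (1 : ℝ) ≤ ⌊(K : ℝ) * H⌋₊ := by exact_mod_cast h.one_le_floor hK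
  have : (⌊(K : ℝ) * H⌋₊ : ℝ) < q := by nlinarith
  exact_mod_cast this

theorem Scale.mul_floor_le (h : Scale δ ξ M K x H) {q : ℕ} (hq : q ∈ QH δ ξ x H) :
    q * ⌊(K : ℝ) * H⌋₊ ≤ K * yy δ x := by
  have h1 := (mem_QH.1 hq).2.2
  rw [le_div_iff₀ h.pos] at h1
  have h2 := h.floor_le
  have : (q : ℝ) * ⌊(K : ℝ) * H⌋₊ ≤ K * yy δ x := by
    calc (q : ℝ) * ⌊(K : ℝ) * H⌋₊ ≤ q * (K * H) := by gcongr
      _ = K * (q * H) := by ring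
      _ ≤ _ := by gcongr
  exact_mod_cast this

end

theorem exists_primeCounting_le : ∃ C : ℝ, 0 < C ∧ ∀ X : ℝ, 2 ≤ X →
    (Nat.primeCounting ⌊X⌋₊ : ℝ) ≤ C * X / Real.log X := by
  have h := (Chebyshev.eventually_primeCounting_le one_pos)
  obtain ⟨X₀, hX₀⟩ := eventually_atTop.1 h
  have hlog4 : 0 < Real.log 4 := Real.log_pos (by norm_num)
  have hX₀l : 0 ≤ Real.log (|X₀| + 2) := Real.log_nonneg (by linarith [abs_nonneg X₀])
  refine ⟨Real.log 4 + 1 + 2 * Real.log (|X₀| + 2), by linarith, fun X hX => ?_⟩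
  have hl : 0 < Real.log X := Real.log_pos (by linarith)
  rcases le_total X₀ X with h1 | h1
  · refine (hX₀ X h1).trans ?_
    refine div_le_div_of_nonneg_right ?_ hl.le
    nlinarith
  · have h2 : (Nat.primeCounting ⌊X⌋₊ : ℝ) ≤ 2 * X := by
      have h3 := Nat.floor_le (show 0 ≤ X by linarith)
      have h4 : (Nat.primeCounting ⌊X⌋₊ : ℝ) ≤ ⌊X⌋₊ + 1 := by
        exact_mod_cast Nat.count_le _
      linarith
    refine h2.trans ?_
    rw [le_div_iff₀ hl]
    have : Real.log X ≤ Real.log (|X₀| + 2) :=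
      Real.log_le_log (by linarith) (by linarith [le_abs_self X₀])
    nlinarith

theorem exists_card_QH_le : ∃ C : ℝ, 0 < C ∧ ∀ (δ ξ M x H : ℝ) (K : ℕ), Scale δ ξ M K x H →
    ((QH δ ξ x H).card : ℝ) ≤ C * ((yy δ x : ℝ) / H / Real.log x) := by
  obtain ⟨C, hC, hπ⟩ := exists_primeCounting_le
  refine ⟨2 * C, by positivity, fun δ ξ M x H K h => ?_⟩
  set X := (yy δ x : ℝ) / H with hX
  have h1 := h.sqrt_le_div
  have h4 : (4 : ℝ) ≤ x ^ (1 / 2 : ℝ) := by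
    have : (4 : ℝ) = (16 : ℝ) ^ (1 / 2 : ℝ) := by
      rw [show (16 : ℝ) = 4 ^ (2 : ℝ) by norm_num, ← Real.rpow_mul (by norm_num)]
      norm_num
    rw [this]
    exact Real.rpow_le_rpow (by norm_num) h.regime.x_ge (by norm_num)
  have hcard : ((QH δ ξ x H).card : ℝ) ≤ Nat.primeCounting ⌊X⌋₊ := by
    rw [Nat.primeCounting, Nat.primeCounting', Nat.count_eq_card_filter_range]
    norm_cast
    refine card_le_card fun q hq => ?_
    obtain ⟨hp, -, hle⟩ := mem_QH.1 hq
    exact mem_filter.2 ⟨mem_range.2 (Nat.lt_succ_of_le (Nat.le_floor hle)), hp⟩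
  refine (hcard.trans (hπ X (by linarith))).trans ?_
  have hlog : 1 / 2 * Real.log x ≤ Real.log X := by
    rw [← Real.log_rpow h.regime.x_pos]
    exact Real.log_le_log (by linarith) h1
  have hL := h.log_pos
  rw [show 2 * C * (X / Real.log x) = 2 * C * X / Real.log x by ring,
    div_le_div_iff₀ (by linarith) hL]
  have : 0 ≤ C * X := by rw [hX]; have := h.pos; positivity
  nlinarith

theorem eventually_exp_mul_sum_le (s : ℝ) (hs : 0 ≤ s) (K : ℕ) :
    ∀ᶠ x in atTop, ∀ δ ξ M H, Scale δ ξ M K x H → 6 < M →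
      Real.exp (s * (⌊(K : ℝ) * H⌋₊ : ℝ) ^ 2 *
        ∑ p ∈ primesBetween (H ^ M) (zz δ x), 1 / (p : ℝ)) ≤ x ^ (1 / 10 : ℝ) := by
  obtain ⟨C, hC, hsum⟩ := exists_abs_sum_primesBetween_inv_sub_le
  filter_upwards [eventually_le_log_log (10 * (s * (K : ℝ) ^ 2 * (2 + C)))] with x hx δ ξ M H h hM
  have h2 := h.regime.loglog_ge
  have hL := h.log_pos
  set D := Real.log (Real.log x) with hD
  have hlw := h.one_le_log_rpow hM
  have hz : Real.log (Real.log (zz δ x)) ≤ 2 * D := by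
    have hlz := h.regime.log_z_le
    have h0 : 0 < Real.log (zz δ x) := by linarith [h.regime.le_log_z]
    calc Real.log (Real.log (zz δ x)) ≤ Real.log (2 * Real.log x) := Real.log_le_log h0 hlz
      _ = Real.log 2 + D := Real.log_mul (by norm_num) hL.ne'
      _ ≤ 2 * D := by linarith [Real.log_two_lt_d9]
  have hS : ∑ p ∈ primesBetween (H ^ M) (zz δ x), 1 / (p : ℝ) ≤ (2 + C) * D := by
    have h3 := (abs_le.1 (hsum _ _ (by linarith [h.four_le_rpow hM]) h.rpow_le_z)).2
    have h4 : C / Real.log (H ^ M) ≤ C := div_le_self hC.le hlw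
    have h5 : 0 ≤ Real.log (Real.log (H ^ M)) := Real.log_nonneg hlw
    nlinarith
  have hk := h.floor_sq_le
  have hHD := h.mul_sq_pow_le
  rw [Real.rpow_def_of_pos h.regime.x_pos]
  refine Real.exp_le_exp.2 ?_
  calc s * (⌊(K : ℝ) * H⌋₊ : ℝ) ^ 2 * ∑ p ∈ primesBetween (H ^ M) (zz δ x), 1 / (p : ℝ)
      ≤ s * ((K : ℝ) ^ 2 * H ^ 2) * ((2 + C) * D) := by gcongr
    _ = (s * (K : ℝ) ^ 2 * (2 + C)) * (H ^ 2 * D) := by ring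
    _ ≤ (D / 10) * (H ^ 2 * D) := by gcongr; linarith
    _ = (H ^ 2 * D ^ 2) / 10 := by ring
    _ ≤ (H ^ 2 * D ^ 4) / 10 := by
        gcongr ?_ / 10
        have : D ^ 2 ≤ D ^ 4 := pow_le_pow_right₀ (by linarith) (by norm_num)
        gcongr
    _ ≤ Real.log x / 10 := by gcongr
    _ = Real.log x * (1 / 10) := by ring

theorem Scale.rpow_le_log_rpow {δ ξ M x H : ℝ} {K : ℕ} (h : Scale δ ξ M K x H) {a : ℝ}
    (ha : 0 ≤ a) : H ^ a ≤ Real.log x ^ a :=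
  Real.rpow_le_rpow h.pos.le h.le_log ha

theorem eventually_avg_sq_totalWeight_le {M : ℝ} (hM : 6 < M) {K : ℕ} (hK : 2 ≤ K) :
    ∀ᶠ x in atTop, ∀ δ ξ H, Scale δ ξ M K x H → ∀ q ∈ QH δ ξ x H,
      avg (PP (zz δ x)) (fun b => (totalWeight (H ^ M) (zz δ x) ⌊(K : ℝ) * H⌋₊ K (yy δ x) q b -
        ((K : ℝ) + 1) * yy δ x) ^ 2) ≤
        (12 * (K : ℝ) ^ 2 + 1) * (((K : ℝ) + 1) * yy δ x) ^ 2 * H ^ (2 - M) := by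
  filter_upwards [eventually_exp_mul_sum_le 2 (by norm_num) K,
    eventually_mul_log_rpow_le 1 (M - 2) (by norm_num : (0 : ℝ) < 9 / 10)] with
    x hexp hpow δ ξ H h q hq
  have hz := h.z_lt hq
  have hq' : ∀ p ∈ primesBetween (H ^ M) (zz δ x), ¬ p ∣ q := by
    intro p hp hdvd
    obtain ⟨hpp, -, hpz⟩ := mem_primesBetween.1 hp
    have : p = q := (Nat.prime_dvd_prime_iff_eq hpp (mem_QH.1 hq).1).1 hdvd
    rw [this] at hpz
    linarith
  have hac : (-((K * yy δ x : ℕ) : ℤ)) ≤ (yy δ x : ℤ) := by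
    have : (0 : ℤ) ≤ ((K * yy δ x : ℕ) : ℤ) := Int.natCast_nonneg _
    have : (0 : ℤ) ≤ (yy δ x : ℤ) := Int.natCast_nonneg _
    omega
  have key := avg_sq_sum_lamSet_ap_sub_le h.rpow_le_z (h.one_le_floor (by omega))
    (h.four_mul_floor_sq_le hM) hq' hac
  have e : ((yy δ x : ℤ) : ℝ) - ((-((K * yy δ x : ℕ) : ℤ) : ℤ) : ℝ) =
      ((K : ℝ) + 1) * yy δ x := by push_cast; ring
  rw [e] at key
  refine key.trans ?_
  set Y := ((K : ℝ) + 1) * yy δ x with hY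
  have hH := h.pos
  have hYx : x ≤ Y := by
    have := h.regime.x_le_y
    have : (0 : ℝ) ≤ K := Nat.cast_nonneg _
    nlinarith [h.regime.y_pos]
  have hx := h.regime.x_pos
  have hexp' := hexp δ ξ M H h hM
  have e2 : H ^ (2 - M) = H ^ 2 / H ^ M := by
    rw [Real.rpow_sub hH, Real.rpow_two]
  have hw : 0 < H ^ M := Real.rpow_pos_of_pos hH _
  have h1 : 12 * Y ^ 2 * (⌊(K : ℝ) * H⌋₊ : ℝ) ^ 2 / H ^ M ≤
      12 * (K : ℝ) ^ 2 * Y ^ 2 * H ^ (2 - M) := by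
    rw [e2]
    calc 12 * Y ^ 2 * (⌊(K : ℝ) * H⌋₊ : ℝ) ^ 2 / H ^ M
        ≤ 12 * Y ^ 2 * ((K : ℝ) ^ 2 * H ^ 2) / H ^ M := by gcongr; exact h.floor_sq_le
      _ = _ := by ring
  have h2 : x ^ (1 / 10 : ℝ) ≤ Y * H ^ (2 - M) := by
    have e3 : H ^ (2 - M) * H ^ (M - 2) = 1 := by rw [← Real.rpow_add hH]; norm_num
    have h3 : H ^ (M - 2) ≤ x ^ (9 / 10 : ℝ) :=
      (h.rpow_le_log_rpow (by linarith)).trans (by simpa using hpow)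
    have e4 : x ^ (1 / 10 : ℝ) * x ^ (9 / 10 : ℝ) = x := by
      rw [← Real.rpow_add hx]; norm_num
    calc x ^ (1 / 10 : ℝ) = x ^ (1 / 10 : ℝ) * H ^ (M - 2) * H ^ (2 - M) := by
          rw [mul_assoc, mul_comm (H ^ (M - 2)), e3, mul_one]
      _ ≤ x ^ (1 / 10 : ℝ) * x ^ (9 / 10 : ℝ) * H ^ (2 - M) := by gcongr
      _ ≤ Y * H ^ (2 - M) := by rw [e4]; gcongr
  have hY0 : 0 ≤ Y := by linarith
  calc _ ≤ 12 * (K : ℝ) ^ 2 * Y ^ 2 * H ^ (2 - M) + Y * (Y * H ^ (2 - M)) := by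
        refine add_le_add h1 ?_
        gcongr
        exact hexp'.trans h2
    _ = _ := by ring

/-- The mean of the weight through a point. -/
noncomputable def meanThrough (w z : ℝ) (k : ℕ) (Q : Finset ℕ) : ℝ :=
  Q.card * k / sigBetween w z

theorem exists_inv_sigBetween_le : ∃ C : ℝ, 0 < C ∧ ∀ (δ ξ M x H : ℝ) (K : ℕ),
    Scale δ ξ M K x H → 6 < M →
    (sigBetween (H ^ M) (zz δ x))⁻¹ ≤ C * (Real.log x / Real.log (H ^ M)) := by
  obtain ⟨C, hC, h⟩ := exists_inv_sigBetween_bounds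
  refine ⟨2 * C, by positivity, fun δ ξ M x H K hs hM => ?_⟩
  refine (h _ _ (by linarith [hs.four_le_rpow hM]) hs.rpow_le_z).2.trans ?_
  have h1 := hs.one_le_log_rpow hM
  calc C * (Real.log (zz δ x) / Real.log (H ^ M))
      ≤ C * (2 * Real.log x / Real.log (H ^ M)) := by gcongr; exact hs.regime.log_z_le
    _ = _ := by ring

theorem exists_sigUpTo_div_sigBetween_le : ∃ C : ℝ, 0 < C ∧ ∀ (δ ξ M x H : ℝ) (K : ℕ),
    Scale δ ξ M K x H → 6 < M →
    sigUpTo (H ^ M) / sigBetween (H ^ M) (zz δ x) ≤ C * Real.log x := by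
  obtain ⟨C, hC, h⟩ := exists_inv_sigBetween_le
  obtain ⟨c, C', hc, hC', h'⟩ := exists_sigUpTo_bounds
  refine ⟨C' * C, by positivity, fun δ ξ M x H K hs hM => ?_⟩
  have h1 := hs.one_le_log_rpow hM
  have h2 : sigUpTo (H ^ M) ≤ C' :=
    (h' _ (by linarith [hs.four_le_rpow hM])).2.trans (div_le_self hC'.le h1)
  have h3 := h _ _ _ _ _ _ hs hM
  have h4 : (sigBetween (H ^ M) (zz δ x))⁻¹ ≤ C * Real.log x :=
    h3.trans (by gcongr; exact div_le_self hs.log_pos.le h1)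
  rw [div_eq_mul_inv, mul_assoc]
  have := sigBetween_pos (H ^ M) (zz δ x)
  gcongr

theorem exists_eventually_avg_throughWeight_le {δ M : ℝ} (hδ0 : 0 < δ) (hM : 6 < M) {K : ℕ}
    (hK : 2 ≤ K) : ∃ C : ℝ, 0 < C ∧ ∀ᶠ x in atTop, ∀ ξ H, Scale δ ξ M K x H → ∀ n : ℤ,
      avg (PP (zz δ x)) (fun b => oneS (zz δ x) b n *
        (throughWeight (H ^ M) (zz δ x) ⌊(K : ℝ) * H⌋₊ (QH δ ξ x H) n b -
          meanThrough (H ^ M) (zz δ x) ⌊(K : ℝ) * H⌋₊ (QH δ ξ x H)) ^ 2) ≤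
        C * ((yy δ x : ℝ) ^ 2 / Real.log x * H ^ (5 / 2 - M)) := by
  set κ : ℕ := ⌈2 / δ⌉₊ with hκ
  obtain ⟨C₁, t, hC₁, ht, hB⟩ := exists_avg_oneS_mul_sq_sub_le κ
  obtain ⟨C₂, hC₂, hA⟩ := exists_sigUpTo_div_sigBetween_le
  obtain ⟨C₃, hC₃, hcard⟩ := exists_card_QH_le
  have hK1 : (2 : ℝ) ≤ K := by exact_mod_cast hK
  refine ⟨C₂ * C₃ * (K : ℝ) ^ 2 * ((K : ℝ) ^ 2 * (5 * C₃ + 3 * C₁) + 1), by positivity, ?_⟩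
  filter_upwards [eventually_exp_mul_sum_le 2 (by norm_num) K,
    eventually_exp_mul_sum_le t ht.le K, eventually_le_log (Real.log (2 * K)),
    eventually_mul_log_rpow_le 1 ((M + 2) * (2 * (κ + 1))) (by norm_num : (0 : ℝ) < 1 / 2),
    eventually_mul_log_rpow_le 1 (M - 2 + 1) (by norm_num : (0 : ℝ) < 2 / 5)] with
    x hexp2 hexpt hlogK hTx hpow ξ H h n
  set w := H ^ M with hw
  set z := zz δ x with hzdef
  set k := ⌊(K : ℝ) * H⌋₊ with hk
  set Q := QH δ ξ x H with hQ
  set L := Real.log x with hL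
  set X := (yy δ x : ℝ) / H with hX
  have hH := h.pos
  have hy := h.regime.y_pos
  have hx := h.regime.x_pos
  have hL0 : 0 < L := h.log_pos
  have hL16 : 16 ≤ L := h.regime.log_ge
  have hX0 : 0 < X := by positivity
  have hw0 : 0 < w := Real.rpow_pos_of_pos hH _
  have hsX : x ^ (1 / 2 : ℝ) ≤ X := h.sqrt_le_div
  have hQ' : ∀ q ∈ Q, q.Prime ∧ z < q ∧ k < q ∧ q ≤ ⌊X⌋₊ := fun q hq =>
    ⟨(mem_QH.1 hq).1, h.z_lt hq, h.floor_lt hM (by omega) hq, Nat.le_floor (mem_QH.1 hq).2.2⟩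
  have hT : 2 * w * (Real.log (2 * k * ⌊X⌋₊) / Real.log 2) ≤ L ^ (M + 2) := by
    have h1 : (1 : ℝ) ≤ k := by exact_mod_cast h.one_le_floor (by omega)
    have hx1 : (1 : ℝ) ≤ x ^ (1 / 2 : ℝ) := Real.one_le_rpow (by linarith [h.regime.x_ge]) (by norm_num)
    have h2 : (1 : ℝ) ≤ ⌊X⌋₊ := by
      exact_mod_cast (Nat.one_le_floor_iff _).2 (hx1.trans hsX)
    have h3 : Real.log (2 * k * ⌊X⌋₊) ≤ 3 * L := by
      calc Real.log (2 * k * ⌊X⌋₊) ≤ Real.log (2 * K * yy δ x) := by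
            refine Real.log_le_log (by positivity) ?_
            calc (2 * k * ⌊X⌋₊ : ℝ) ≤ 2 * (K * H) * X := by
                  gcongr
                  · exact h.floor_le
                  · exact Nat.floor_le hX0.le
              _ = 2 * K * yy δ x := by rw [hX]; field_simp
        _ = Real.log (2 * K) + Real.log (yy δ x) := Real.log_mul (by positivity) hy.ne'
        _ ≤ 3 * L := by linarith [h.regime.log_y_le]
    have h4 : w ≤ L ^ M := h.rpow_le_log_rpow (by linarith)
    have h5 := Real.log_two_gt_d9
    have h6 : 0 ≤ Real.log (2 * k * ⌊X⌋₊) := Real.log_nonneg (by nlinarith)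
    have h7 : 0 ≤ Real.log (2 * k * ⌊X⌋₊) / Real.log 2 := div_nonneg h6 (by linarith)
    calc 2 * w * (Real.log (2 * k * ⌊X⌋₊) / Real.log 2) ≤ 2 * L ^ M * (3 * L / (1 / 2)) := by
          gcongr
          linarith
      _ = L ^ M * (12 * L) := by ring
      _ ≤ L ^ M * (L * L) := by gcongr; linarith
      _ = L ^ (M + 2) := by rw [Real.rpow_add hL0, Real.rpow_two]; ring
  have hB0 : 0 < H ^ (1 / 2 : ℝ) := Real.rpow_pos_of_pos hH _
  have hB1 : 1 ≤ H ^ (1 / 2 : ℝ) := Real.one_le_rpow (by linarith [h.four_le]) (by norm_num)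
  have key := hB w z k ⌊X⌋₊ Q (L ^ (M + 2)) (H ^ (1 / 2 : ℝ)) n h.rpow_le_z
    (h.one_le_floor (by omega)) (h.four_mul_floor_sq_le hM) hQ'
    (Real.rpow_pos_of_pos hL0 _) hT hB0
  refine key.trans ?_
  have hTx' : (L ^ (M + 2)) ^ (2 * (κ + 1)) ≤ X := by
    refine le_trans ?_ hsX
    rw [← Real.rpow_natCast, ← Real.rpow_mul hL0.le]
    push_cast
    simpa using hTx
  have hE : ∀ s : ℝ, Real.exp (s * (k : ℝ) ^ 2 * ∑ p ∈ primesBetween w z, 1 / (p : ℝ)) ≤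
      x ^ (1 / 10 : ℝ) → Real.exp (s * (k : ℝ) ^ 2 * ∑ p ∈ primesBetween w z, 1 / (p : ℝ)) ≤ X :=
    fun s hs => (hs.trans (Real.rpow_le_rpow_of_exponent_le (by linarith [h.regime.x_ge])
      (by norm_num))).trans hsX
  have hBκ : L ≤ (H ^ (1 / 2 : ℝ)) ^ κ := by
    have h1 : δ * (1 / 2) * κ ≥ 1 := by
      have : 2 / δ ≤ κ := Nat.le_ceil _
      rw [div_le_iff₀ hδ0] at this
      linarith
    calc L = L ^ (1 : ℝ) := (Real.rpow_one _).symm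
      _ ≤ L ^ (δ * (1 / 2) * κ) := Real.rpow_le_rpow_of_exponent_le (by linarith) h1
      _ = ((L ^ δ) ^ (1 / 2 : ℝ)) ^ κ := by
          rw [← Real.rpow_natCast, Real.rpow_mul hL0.le, Real.rpow_mul hL0.le]
      _ ≤ _ := by
          gcongr
          exact h.log_rpow_le
  have hcardQ : (Q.card : ℝ) ≤ C₃ * (X / L) := hcard δ ξ M x H K h
  have e2 : H ^ (2 - M) = H ^ 2 / H ^ M := by
    rw [Real.rpow_sub hH, Real.rpow_two]
  have hkw : (k : ℝ) ^ 2 / w ≤ (K : ℝ) ^ 2 * H ^ (2 - M) := by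
    rw [e2, ← mul_div_assoc]
    gcongr
    exact h.floor_sq_le
  have hE2 : Real.exp (2 * (k : ℝ) ^ 2 * ∑ p ∈ primesBetween w z, 1 / (p : ℝ)) ≤
      X / L * H ^ (2 - M) * H ^ (1 / 2 : ℝ) := by
    have e3 : H ^ (2 - M) * H ^ (M - 2) = 1 := by rw [← Real.rpow_add hH]; norm_num
    have h3 : H ^ (M - 2) * L ≤ x ^ (2 / 5 : ℝ) := by
      rw [one_mul, Real.rpow_add hL0, Real.rpow_one] at hpow
      exact (mul_le_mul_of_nonneg_right (h.rpow_le_log_rpow (by linarith)) hL0.le).trans hpow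
    have e4 : x ^ (1 / 10 : ℝ) * x ^ (2 / 5 : ℝ) = x ^ (1 / 2 : ℝ) := by
      rw [← Real.rpow_add hx]; norm_num
    calc _ ≤ x ^ (1 / 10 : ℝ) := hexp2 δ ξ M H h hM
      _ = x ^ (1 / 10 : ℝ) * (H ^ (M - 2) * L) / L * H ^ (2 - M) := by
          have : x ^ (1 / 10 : ℝ) * (H ^ (M - 2) * L) / L * H ^ (2 - M) =
            x ^ (1 / 10 : ℝ) * (H ^ (2 - M) * H ^ (M - 2)) := by field_simp
          rw [this, e3, mul_one]
      _ ≤ x ^ (1 / 10 : ℝ) * x ^ (2 / 5 : ℝ) / L * H ^ (2 - M) := by gcongr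
      _ ≤ X / L * H ^ (2 - M) * 1 := by rw [e4, mul_one]; gcongr
      _ ≤ _ := by gcongr
  have hinner : (k : ℝ) ^ 2 / w * (Q.card * (H ^ (1 / 2 : ℝ) + 4) +
      C₁ * (⌊X⌋₊ + (L ^ (M + 2)) ^ (2 * (κ + 1)) +
        Real.exp (t * (k : ℝ) ^ 2 * ∑ p ∈ primesBetween w z, 1 / (p : ℝ))) /
          (H ^ (1 / 2 : ℝ)) ^ κ) +
      Real.exp (2 * (k : ℝ) ^ 2 * ∑ p ∈ primesBetween w z, 1 / (p : ℝ)) ≤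
      ((K : ℝ) ^ 2 * (5 * C₃ + 3 * C₁) + 1) * (X / L * H ^ (2 - M) * H ^ (1 / 2 : ℝ)) := by
    have h1 : C₁ * (⌊X⌋₊ + (L ^ (M + 2)) ^ (2 * (κ + 1)) +
        Real.exp (t * (k : ℝ) ^ 2 * ∑ p ∈ primesBetween w z, 1 / (p : ℝ))) /
          (H ^ (1 / 2 : ℝ)) ^ κ ≤ 3 * C₁ * (X / L) * H ^ (1 / 2 : ℝ) := by
      calc _ ≤ C₁ * (X + X + X) / L := by
            gcongr
            · exact Nat.floor_le hX0.le
            · exact hE t (hexpt δ ξ M H h hM)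
        _ = 3 * C₁ * (X / L) * 1 := by ring
        _ ≤ _ := by gcongr
    calc _ ≤ (K : ℝ) ^ 2 * H ^ (2 - M) * (C₃ * (X / L) * (H ^ (1 / 2 : ℝ) + 4 * H ^ (1 / 2 : ℝ)) +
          3 * C₁ * (X / L) * H ^ (1 / 2 : ℝ)) + X / L * H ^ (2 - M) * H ^ (1 / 2 : ℝ) := by
          gcongr
          linarith
      _ = _ := by ring
  have hXH : X * H = yy δ x := by rw [hX]; field_simp
  have e5 : H ^ (5 / 2 - M) = H ^ (2 - M) * H ^ (1 / 2 : ℝ) := by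
    rw [← Real.rpow_add hH]; congr 1; ring
  have hs := sigBetween_pos w z
  have hs' := sigUpTo_pos w
  calc _ ≤ C₂ * L * (C₃ * (X / L)) * ((K : ℝ) ^ 2 * H ^ 2) *
        (((K : ℝ) ^ 2 * (5 * C₃ + 3 * C₁) + 1) * (X / L * H ^ (2 - M) * H ^ (1 / 2 : ℝ))) := by
        gcongr
        · exact hA δ ξ M x H K h hM
        · exact h.floor_sq_le
    _ = C₂ * C₃ * (K : ℝ) ^ 2 * ((K : ℝ) ^ 2 * (5 * C₃ + 3 * C₁) + 1) *
        ((yy δ x : ℝ) ^ 2 / L * H ^ (5 / 2 - M)) := by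
        rw [e5, ← hXH]
        field_simp

/-- The exceptional sifted integers at the scale `H`. -/
noncomputable def scaleBadPoints (δ ξ ε : ℝ) (K : ℕ) (x H : ℝ) (b : ℤ) : Finset ℤ :=
  badPoints (H ^ (6 + 4 * ε)) (zz δ x) (H ^ (-1 - ε))
    (meanThrough (H ^ (6 + 4 * ε)) (zz δ x) ⌊(K : ℝ) * H⌋₊ (QH δ ξ x H))
    ⌊(K : ℝ) * H⌋₊ K (yy δ x) (QH δ ξ x H) b

theorem exists_eventually_avg_scaleBadPoints_le {δ ε : ℝ} (hδ0 : 0 < δ) (hε : 0 < ε) {K : ℕ}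
    (hK : 2 ≤ K) : ∃ C : ℝ, 0 < C ∧ ∀ᶠ x in atTop, ∀ ξ H, Scale δ ξ (6 + 4 * ε) K x H →
      avg (PP (zz δ x)) (fun b => ((scaleBadPoints δ ξ ε K x H b).card : ℝ)) ≤
        C * ((yy δ x : ℝ) / Real.log x * H ^ (-1 - ε)) := by
  have hM : 6 < 6 + 4 * ε := by linarith
  obtain ⟨C₁, hC₁, hV₁⟩ := exists_eventually_avg_throughWeight_le hδ0 hM hK
  obtain ⟨C₃, hC₃, hcard⟩ := exists_card_QH_le
  have hK1 : (2 : ℝ) ≤ K := by exact_mod_cast hK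
  refine ⟨C₁ + 2 * K * C₃ * (12 * (K : ℝ) ^ 2 + 1) * (K + 1), by positivity, ?_⟩
  filter_upwards [hV₁, eventually_avg_sq_totalWeight_le hM hK] with x hV₁ hV₂ ξ H h
  have hH := h.pos
  have hH1 : 1 ≤ H := by linarith [h.four_le]
  have hy := h.regime.y_pos
  have hL := h.log_pos
  have hτ : 0 < H ^ (-1 - ε) := Real.rpow_pos_of_pos hH _
  have hτ1 : H ^ (-1 - ε) ≤ 1 := Real.rpow_le_one_of_one_le_of_nonpos hH1 (by linarith)
  refine (avg_card_badPoints_le hτ hτ1 (by exact_mod_cast hy) (fun q hq => h.mul_floor_le hq)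
    (hV₁ ξ H h) (hV₂ δ ξ H h)).trans ?_
  set τ := H ^ (-1 - ε) with hτdef
  set L := Real.log x
  set Y : ℝ := (yy δ x : ℝ)
  have e1 : H ^ (2 - (6 + 4 * ε)) = τ ^ 4 := by
    rw [hτdef, ← Real.rpow_natCast, ← Real.rpow_mul hH.le]
    congr 1; push_cast; ring
  have e2 : H ^ (5 / 2 - (6 + 4 * ε)) ≤ τ ^ 3 := by
    rw [hτdef, ← Real.rpow_natCast, ← Real.rpow_mul hH.le]
    refine Real.rpow_le_rpow_of_exponent_le hH1 ?_
    push_cast; linarith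
  have hc : ((QH δ ξ x H).card : ℝ) ≤ C₃ * (Y / H / L) := hcard δ ξ _ x H K h
  rw [e1]
  calc _ ≤ 1 / (Y * τ) ^ 2 * (Y * (C₁ * (Y ^ 2 / L * τ ^ 3))) +
        2 * (K * H) / (Y * τ * (τ ^ 2 * ((K + 1) * Y))) * (C₃ * (Y / H / L) *
          ((12 * (K : ℝ) ^ 2 + 1) * ((K + 1) * Y) ^ 2 * τ ^ 4)) := by
        gcongr
        exact h.floor_le
    _ = _ := by field_simp

theorem sum_oneS_eq_countS (z : ℝ) (b : ℤ) (y : ℕ) :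
    ∑ n ∈ Ioc (0 : ℤ) y, oneS z b n = countS z b 1 y := by
  have : Icc (1 : ℤ) y = Ioc (0 : ℤ) y := by ext; simp; omega
  rw [countS, this, card_filter]
  push_cast
  rfl

theorem eventually_card_filter_countS_le {δ : ℝ} (hδ0 : 0 < δ) : ∀ᶠ x in atTop,
    (((range (PP (zz δ x))).filter fun b : ℕ => 2 * sigUpTo (zz δ x) * (yy δ x : ℝ) <
      countS (zz δ x) (b : ℤ) 1 (yy δ x)).card : ℝ) ≤ PP (zz δ x) / 8 := by
  obtain ⟨c, C, hc, hC, hσ⟩ := exists_sigUpTo_bounds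
  filter_upwards [eventually_regime hδ0, eventually_le_log 40, eventually_le_log (10 * Real.exp 4000),
    eventually_mul_log_rpow_le (200 / c) 1 (by norm_num : (0 : ℝ) < 4 / 5),
    eventually_mul_log_rpow_le 1 1 (by norm_num : (0 : ℝ) < 1 / 2)] with x h hL40 hLe hpow hLx
  set z := zz δ x with hz
  set L := Real.log x with hL
  have hL0 : 0 < L := by linarith
  have hx := h.x_pos
  have hy := h.y_pos
  rw [Real.rpow_one] at hpow hLx
  have hwz : L / 10 ≤ z := by linarith [h.sqrt_le_z]
  have key := avg_sq_sum_oneS_sub_le (by linarith : 4 ≤ L / 10) hwz (yy δ x)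
  set s := sigUpTo z * yy δ x with hs
  have hs1 : x * (c / (2 * L)) ≤ s := by
    have h1 := (hσ z (by linarith [h.z_ge])).1
    have h2 : 0 < Real.log z := by linarith [h.le_log_z]
    have h3 : c / (2 * L) ≤ sigUpTo z :=
      le_trans (div_le_div_of_nonneg_left hc.le h2 h.log_z_le) h1
    calc x * (c / (2 * L)) ≤ yy δ x * sigUpTo z := by gcongr; exact h.x_le_y
      _ = s := by rw [hs]; ring
  have hx5 : x ^ (1 / 5 : ℝ) ≤ s / 100 := by
    have e : x = x ^ (1 / 5 : ℝ) * x ^ (4 / 5 : ℝ) := by rw [← Real.rpow_add hx]; norm_num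
    have h1 : x ^ (1 / 5 : ℝ) * (200 / c * L) ≤ x := by
      conv_rhs => rw [e]
      gcongr
    have h2 : x ^ (1 / 5 : ℝ) * (200 / c * L) * (c / (2 * L)) = x ^ (1 / 5 : ℝ) * 100 := by
      field_simp; ring
    have h3 : x ^ (1 / 5 : ℝ) * (200 / c * L) * (c / (2 * L)) ≤ x * (c / (2 * L)) := by gcongr
    linarith
  have hx1 : 1 ≤ x ^ (1 / 5 : ℝ) := Real.one_le_rpow (by linarith [h.x_ge]) (by norm_num)
  have hPP : (PP (L / 10) : ℝ) ≤ s / 100 := by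
    refine (PP_le_exp (by positivity)).trans (le_trans (le_of_eq ?_) hx5)
    rw [Real.rpow_def_of_pos hx]
    congr 1; ring
  have hexp : Real.exp (2 * Real.log (yy δ x) / (L / 10 * Real.log (L / 10))) ≤ 100 / 99 := by
    have h1 : 4000 ≤ Real.log (L / 10) := by
      rw [Real.le_log_iff_exp_le (by positivity)]
      linarith
    have h2 : 2 * Real.log (yy δ x) / (L / 10 * Real.log (L / 10)) ≤ 1 / 100 := by
      rw [div_le_div_iff₀ (by positivity) (by norm_num)]
      nlinarith [h.log_y_le]
    refine (Real.exp_le_exp.2 h2).trans ?_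
    have h3 := Real.add_one_le_exp (-(1 / 100) : ℝ)
    rw [Real.exp_neg, le_inv_comm₀ (by norm_num) (Real.exp_pos _)] at h3
    exact h3.trans (by norm_num)
  have hs0 : 0 < s := by linarith
  have hbound : avg (PP z) (fun b => (∑ n ∈ Ioc (0 : ℤ) (yy δ x), oneS z b n - s) ^ 2) ≤
      s ^ 2 / 8 := by
    refine key.trans ?_
    calc _ ≤ 100 / 99 * (s + s / 100) ^ 2 + s * (s / 100) - s ^ 2 := by
          gcongr
          exact le_mul_of_one_le_right hs0.le (by linarith)
      _ ≤ s ^ 2 / 8 := by nlinarith [sq_nonneg s]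
  have hmk := card_filter_lt_mul_le (PP_pos z)
    (f := fun b => (∑ n ∈ Ioc (0 : ℤ) (yy δ x), oneS z b n - s) ^ 2) (fun b => sq_nonneg _) (s ^ 2)
  have hsub : ((range (PP z)).filter fun b : ℕ => 2 * sigUpTo z * (yy δ x : ℝ) <
      countS z (b : ℤ) 1 (yy δ x)) ⊆ (range (PP z)).filter fun b : ℕ =>
        s ^ 2 < (∑ n ∈ Ioc (0 : ℤ) (yy δ x), oneS z (b : ℤ) n - s) ^ 2 := by
    intro b hb
    rw [mem_filter] at hb ⊢
    refine ⟨hb.1, ?_⟩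
    rw [sum_oneS_eq_countS]
    have h1 : 2 * s < countS z (b : ℤ) 1 (yy δ x) := by
      have := hb.2
      rw [hs]; linarith
    exact pow_lt_pow_left₀ (by linarith) hs0.le (by norm_num)
  have hcard := Nat.cast_le (α := ℝ).2 (card_le_card hsub)
  refine hcard.trans ?_
  have hP : (0 : ℝ) < PP z := by exact_mod_cast PP_pos z
  have h2 := hmk.trans (mul_le_mul_of_nonneg_left hbound hP.le)
  rw [show (PP z : ℝ) * (s ^ 2 / 8) = (PP z / 8) * s ^ 2 by ring] at h2
  exact le_of_mul_le_mul_right h2 (by positivity)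

theorem sum_pow_le_div_one_sub {r a : ℝ} (hr0 : 0 < r) (hr1 : r < 1) (ha : 0 ≤ a) {J : Finset ℕ}
    (hJ : ∀ j ∈ J, r ^ j ≤ a) : ∑ j ∈ J, r ^ j ≤ a / (1 - r) := by
  have h1 : 0 < 1 - r := by linarith
  rcases J.eq_empty_or_nonempty with rfl | hne
  · simpa using div_nonneg ha h1.le
  · calc ∑ j ∈ J, r ^ j ≤ ∑ j ∈ Ico (J.min' hne) (J.max' hne + 1), r ^ j := by
          refine sum_le_sum_of_subset_of_nonneg (fun j hj => ?_) fun _ _ _ => by positivity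
          exact mem_Ico.2 ⟨J.min'_le j hj, Nat.lt_succ_of_le (J.le_max' j hj)⟩
      _ ≤ r ^ (J.min' hne) / (1 - r) := geom_sum_Ico_le_of_lt_one hr0.le hr1
      _ ≤ a / (1 - r) := by gcongr; exact hJ _ (J.min'_mem hne)

theorem exists_sum_rpow_scale_le {ξ ε : ℝ} (hξ : 1 < ξ) (hε : 0 < ε) : ∃ C : ℝ, 0 < C ∧
    ∀ (δ M x : ℝ) (K : ℕ) (J : Finset ℕ), Regime δ x → (∀ j ∈ J, Scale δ ξ M K x (ξ ^ j)) →
      ∑ j ∈ J, (ξ ^ j) ^ (-1 - ε) ≤ C * (2 * (yy δ x : ℝ) / x) ^ (-1 - ε) := by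
  have hξ0 : 0 < ξ := by linarith
  set r := ξ ^ (-1 - ε) with hr
  have hr0 : 0 < r := Real.rpow_pos_of_pos hξ0 _
  have hr1 : r < 1 := Real.rpow_lt_one_of_one_lt_of_neg hξ (by linarith)
  refine ⟨1 / (1 - r), by have : 0 < 1 - r := by linarith
                          positivity, fun δ M x K J hR hJ => ?_⟩
  have hx := hR.x_pos
  have hy := hR.y_pos
  have e : ∀ j : ℕ, (ξ ^ j) ^ (-1 - ε) = r ^ j := fun j => by
    rw [hr, ← Real.rpow_natCast, ← Real.rpow_natCast, ← Real.rpow_mul hξ0.le,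
      ← Real.rpow_mul hξ0.le, mul_comm]
  simp only [e]
  refine (sum_pow_le_div_one_sub (a := (2 * (yy δ x : ℝ) / x) ^ (-1 - ε)) hr0 hr1 (by positivity)
    fun j hj => ?_).trans (le_of_eq (by ring))
  rw [← e]
  exact Real.rpow_le_rpow_of_nonpos (by positivity) (hJ j hj).lo (by linarith)

theorem Regime.two_mul_div_rpow_le {δ x ε : ℝ} (h : Regime δ x) (hε : 0 < ε) :
    (2 * (yy δ x : ℝ) / x) ^ (-1 - ε) ≤ 1 / Real.log x ^ (δ * (1 + ε)) := by
  have hL : 0 < Real.log x := by linarith [h.log_ge]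
  have h1 : Real.log x ^ δ ≤ 2 * (yy δ x : ℝ) / x := by
    have := h.two_log_rpow_le le_rfl
    linarith [Real.rpow_pos_of_pos hL δ]
  calc (2 * (yy δ x : ℝ) / x) ^ (-1 - ε) ≤ (Real.log x ^ δ) ^ (-1 - ε) :=
        Real.rpow_le_rpow_of_nonpos (Real.rpow_pos_of_pos hL _) h1 (by linarith)
    _ = 1 / Real.log x ^ (δ * (1 + ε)) := by
        rw [← Real.rpow_mul hL.le, one_div, ← Real.rpow_neg hL.le]
        congr 1; ring

theorem eventually_card_filter_sum_scaleBadPoints_le {δ ξ ε : ℝ} (hδ0 : 0 < δ) (hξ : 1 < ξ)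
    (hε : 0 < ε) {K : ℕ} (hK : 2 ≤ K) : ∀ᶠ x in atTop, ∀ J : Finset ℕ,
      (∀ j ∈ J, Scale δ ξ (6 + 4 * ε) K x (ξ ^ j)) →
      (((range (PP (zz δ x))).filter fun b : ℕ => x / (10 * Real.log x) <
        ∑ j ∈ J, ((scaleBadPoints δ ξ ε K x (ξ ^ j) (b : ℤ)).card : ℝ)).card : ℝ) ≤
        PP (zz δ x) / 8 := by
  obtain ⟨C₁, hC₁, hbad⟩ := exists_eventually_avg_scaleBadPoints_le hδ0 hε hK
  obtain ⟨C₂, hC₂, hsum⟩ := exists_sum_rpow_scale_le hξ hε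
  filter_upwards [hbad, eventually_regime hδ0,
    ((tendsto_rpow_atTop (by positivity : 0 < δ * ε)).comp
      Real.tendsto_log_atTop).eventually_ge_atTop (40 * (C₁ * C₂))] with x hbad hR hbig J hJ
  have hx := hR.x_pos
  have hy := hR.y_pos
  have hL : 0 < Real.log x := by linarith [hR.log_ge]
  simp only [Function.comp] at hbig
  set f : ℤ → ℝ := fun b => ∑ j ∈ J, ((scaleBadPoints δ ξ ε K x (ξ ^ j) b).card : ℝ) with hf
  have hP : (0 : ℝ) < PP (zz δ x) := by exact_mod_cast PP_pos _
  have h0 : 0 < 2 * (yy δ x : ℝ) / x := by positivity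
  have h1 : (2 * (yy δ x : ℝ) / x) ^ (-ε) ≤ 1 / Real.log x ^ (δ * ε) := by
    have h1 : Real.log x ^ δ ≤ 2 * (yy δ x : ℝ) / x := by
      have := hR.two_log_rpow_le le_rfl
      linarith [Real.rpow_pos_of_pos hL δ]
    calc (2 * (yy δ x : ℝ) / x) ^ (-ε) ≤ (Real.log x ^ δ) ^ (-ε) :=
          Real.rpow_le_rpow_of_nonpos (Real.rpow_pos_of_pos hL _) h1 (by linarith)
      _ = 1 / Real.log x ^ (δ * ε) := by
          rw [← Real.rpow_mul hL.le, one_div, ← Real.rpow_neg hL.le]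
          congr 1; ring
  have havg : avg (PP (zz δ x)) f ≤ x / (10 * Real.log x) / 8 := by
    rw [hf, avg_sum]
    calc _ ≤ ∑ j ∈ J, C₁ * ((yy δ x : ℝ) / Real.log x * (ξ ^ j) ^ (-1 - ε)) :=
          sum_le_sum fun j hj => hbad ξ _ (hJ j hj)
      _ = C₁ * ((yy δ x : ℝ) / Real.log x) * ∑ j ∈ J, (ξ ^ j) ^ (-1 - ε) := by
          rw [mul_sum]; exact sum_congr rfl fun _ _ => by ring
      _ ≤ C₁ * ((yy δ x : ℝ) / Real.log x) * (C₂ * (2 * (yy δ x : ℝ) / x) ^ (-1 - ε)) := by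
          gcongr
          exact hsum δ _ x K J hR hJ
      _ = C₁ * C₂ / 2 * (x / Real.log x) * (2 * (yy δ x : ℝ) / x) ^ (-ε) := by
          rw [show -1 - ε = -ε - 1 by ring, Real.rpow_sub_one h0.ne']
          field_simp
      _ ≤ C₁ * C₂ / 2 * (x / Real.log x) * (1 / Real.log x ^ (δ * ε)) := by gcongr
      _ ≤ C₁ * C₂ / 2 * (x / Real.log x) * (1 / (40 * (C₁ * C₂))) := by gcongr
      _ = x / (10 * Real.log x) / 8 := by field_simp; norm_num
  have hmk := card_filter_lt_mul_le (PP_pos (zz δ x)) (f := f)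
    (fun b => sum_nonneg fun _ _ => Nat.cast_nonneg _) (x / (10 * Real.log x))
  have h2 := hmk.trans (mul_le_mul_of_nonneg_left havg hP.le)
  rw [show (PP (zz δ x) : ℝ) * (x / (10 * Real.log x) / 8) =
    (PP (zz δ x) / 8) * (x / (10 * Real.log x)) by ring] at h2
  exact le_of_mul_le_mul_right h2 (by positivity)

end SievedGaps

namespace SievedGaps
open Finset

theorem exponent_unique {y ξ q : ℝ} {i j : ℕ} (hξ : 1 < ξ) (hy : 0 < y)
    (hi : y / (ξ * ξ ^ i) < q) (hj : q ≤ y / ξ ^ j) : j ≤ i := by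
  have hξ0 : 0 < ξ := by linarith
  have h := hi.trans_le hj
  rw [← pow_succ'] at h
  have h1 : ξ ^ j < ξ ^ (i + 1) := by
    rwa [div_lt_div_iff_of_pos_left hy (by positivity) (by positivity)] at h
  exact Nat.lt_succ_iff.1 ((pow_lt_pow_iff_right₀ hξ).1 h1)

theorem Scale.Hq_eq {δ ξ M x : ℝ} {K j q : ℕ} (h : Scale δ ξ M K x (ξ ^ j))
    (hq : q ∈ QH δ ξ x (ξ ^ j)) : Hq δ ξ x q = ξ ^ j := by
  obtain ⟨-, h1, h2⟩ := mem_QH.1 hq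
  have hex : ∃ H ∈ frakH δ ξ x, (yy δ x : ℝ) / (ξ * H) < (q : ℝ) ∧ (q : ℝ) ≤ (yy δ x : ℝ) / H :=
    ⟨ξ ^ j, ⟨j, rfl, h.lo, h.hi⟩, h1, h2⟩
  rw [Hq, dif_pos hex]
  obtain ⟨⟨i, hi, -⟩, h3, h4⟩ := hex.choose_spec
  rw [hi] at h3 h4 ⊢
  rw [le_antisymm (exponent_unique h.one_lt h.regime.y_pos h1 h4)
    (exponent_unique h.one_lt h.regime.y_pos h3 h2)]

/-- The steps at the scale `H` whose total weight is concentrated. -/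
noncomputable def scaleSteps (δ ξ ε : ℝ) (K : ℕ) (x H : ℝ) (b : ℤ) : Finset ℕ :=
  QH δ ξ x H \ badSteps (H ^ (6 + 4 * ε)) (zz δ x) (H ^ (-1 - ε)) ⌊(K : ℝ) * H⌋₊ K (yy δ x)
    (QH δ ξ x H) b

/-- The residues for which the sieved interval has about the expected size and few of its elements
are exceptional at the scales `ξ ^ j`, `j ∈ J`. -/
def GoodShift (δ ξ ε : ℝ) (K : ℕ) (x : ℝ) (J : Finset ℕ) (b : ℤ) : Prop :=
  (countS (zz δ x) b 1 (yy δ x) : ℝ) ≤ 2 * sigUpTo (zz δ x) * (yy δ x : ℝ) ∧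
    ∑ j ∈ J, ((scaleBadPoints δ ξ ε K x (ξ ^ j) b).card : ℝ) ≤ x / (10 * Real.log x)

section

variable {δ ξ ε x : ℝ} {K : ℕ} {J : Finset ℕ} {b : ℤ}

theorem mem_scaleSteps {H : ℝ} {q : ℕ} : q ∈ scaleSteps δ ξ ε K x H b ↔ q ∈ QH δ ξ x H ∧
    |totalWeight (H ^ (6 + 4 * ε)) (zz δ x) ⌊(K : ℝ) * H⌋₊ K (yy δ x) q b -
      ((K : ℝ) + 1) * yy δ x| ≤ ((K : ℝ) + 1) * yy δ x * H ^ (-1 - ε) := by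
  unfold scaleSteps badSteps
  rw [mem_sdiff, mem_filter]
  constructor
  · rintro ⟨h1, h2⟩
    exact ⟨h1, not_lt.1 fun h => h2 ⟨h1, h⟩⟩
  · rintro ⟨h1, h2⟩
    exact ⟨h1, fun h => not_lt.2 h2 h.2⟩

theorem card_filter_inS_sdiff_le (hJ : GoodShift δ ξ ε K x J b) :
    ((((Icc (1 : ℤ) (yy δ x : ℤ)).filter (inS (zz δ x) b)) \
      ((Icc (1 : ℤ) (yy δ x : ℤ)).filter (inS (zz δ x) b) \
        J.biUnion fun j => scaleBadPoints δ ξ ε K x (ξ ^ j) b)).card : ℝ) ≤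
      x / (10 * Real.log x) := by
  refine le_trans ?_ hJ.2
  norm_cast
  refine le_trans (card_le_card ?_) card_biUnion_le
  intro n hn
  rw [mem_sdiff, mem_sdiff] at hn
  by_contra h
  exact hn.2 ⟨hn.1, h⟩

theorem abs_sum_lam_sub_le (hε : 0 < ε) (hs : ∀ j ∈ J, Scale δ ξ (6 + 4 * ε) K x (ξ ^ j)) {q : ℕ}
    (hq : q ∈ J.biUnion fun j => scaleSteps δ ξ ε K x (ξ ^ j) b) :
    |(∑ n ∈ Ioc (-((K * yy δ x : ℕ) : ℤ)) ((yy δ x : ℤ)),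
        lam (6 + 4 * ε) (zz δ x) K b (Hq δ ξ x q) q n) - ((K : ℝ) + 1) * (yy δ x : ℝ)| ≤
      ((K : ℝ) + 1) * (yy δ x : ℝ) * (1 / Real.log x ^ (δ * (1 + ε))) := by
  obtain ⟨j, hj, hqj⟩ := mem_biUnion.1 hq
  obtain ⟨h1, h2⟩ := mem_scaleSteps.1 hqj
  have h := hs j hj
  rw [h.Hq_eq h1]
  refine h2.trans ?_
  have hy := h.regime.y_pos
  have hx := h.regime.x_pos
  gcongr
  exact (Real.rpow_le_rpow_of_nonpos (by positivity) h.lo (by linarith)).trans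
    (h.regime.two_mul_div_rpow_le hε)

theorem sum_biUnion_scaleSteps (hs : ∀ j ∈ J, Scale δ ξ (6 + 4 * ε) K x (ξ ^ j)) (n : ℤ) :
    ∑ q ∈ J.biUnion fun j => scaleSteps δ ξ ε K x (ξ ^ j) b,
      ∑ h ∈ Icc 1 ⌊(K : ℝ) * Hq δ ξ x q⌋₊,
        lam (6 + 4 * ε) (zz δ x) K b (Hq δ ξ x q) q (n - (q : ℤ) * (h : ℤ)) =
    ∑ j ∈ J, throughWeight ((ξ ^ j) ^ (6 + 4 * ε)) (zz δ x) ⌊(K : ℝ) * ξ ^ j⌋₊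
      (scaleSteps δ ξ ε K x (ξ ^ j) b) n b := by
  rw [sum_biUnion]
  · refine sum_congr rfl fun j hj => sum_congr rfl fun q hq => ?_
    rw [(hs j hj).Hq_eq (mem_scaleSteps.1 hq).1]
    rfl
  · intro i hi j hj hij
    refine disjoint_left.2 fun q hqi hqj => hij ?_
    have h1 := (hs i hi).Hq_eq (mem_scaleSteps.1 hqi).1
    have h2 := (hs j hj).Hq_eq (mem_scaleSteps.1 hqj).1
    rw [h1] at h2
    exact (pow_right_injective₀ (by linarith [(hs i hi).one_lt]) (hs i hi).one_lt.ne') h2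

theorem abs_sum_sum_lam_sub_le (hs : ∀ j ∈ J, Scale δ ξ (6 + 4 * ε) K x (ξ ^ j)) {n : ℤ}
    (hn : n ∈ (Icc (1 : ℤ) (yy δ x : ℤ)).filter (inS (zz δ x) b) \
        J.biUnion fun j => scaleBadPoints δ ξ ε K x (ξ ^ j) b) :
    |(∑ q ∈ J.biUnion fun j => scaleSteps δ ξ ε K x (ξ ^ j) b,
      ∑ h ∈ Icc 1 ⌊(K : ℝ) * Hq δ ξ x q⌋₊,
        lam (6 + 4 * ε) (zz δ x) K b (Hq δ ξ x q) q (n - (q : ℤ) * (h : ℤ))) -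
      ∑ j ∈ J, meanThrough ((ξ ^ j) ^ (6 + 4 * ε)) (zz δ x) ⌊(K : ℝ) * ξ ^ j⌋₊
        (QH δ ξ x (ξ ^ j))| ≤
      2 * (yy δ x : ℝ) * ∑ j ∈ J, (ξ ^ j) ^ (-1 - ε) := by
  rw [sum_biUnion_scaleSteps hs, ← sum_sub_distrib, mul_sum]
  refine (abs_sum_le_sum_abs _ _).trans (sum_le_sum fun j hj => ?_)
  rw [mem_sdiff, mem_filter, mem_biUnion] at hn
  have hn2 : n ∉ scaleBadPoints δ ξ ε K x (ξ ^ j) b := fun h => hn.2 ⟨j, hj, h⟩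
  unfold scaleBadPoints badPoints at hn2
  have hmem : n ∈ Ioc (0 : ℤ) (yy δ x) := by
    have := mem_Icc.1 hn.1.1
    exact mem_Ioc.2 ⟨by omega, this.2⟩
  rw [mem_filter] at hn2
  push Not at hn2
  have h3 := hn2 hmem hn.1.2
  have hsplit : throughWeight ((ξ ^ j) ^ (6 + 4 * ε)) (zz δ x) ⌊(K : ℝ) * ξ ^ j⌋₊
      (scaleSteps δ ξ ε K x (ξ ^ j) b) n b = throughWeight ((ξ ^ j) ^ (6 + 4 * ε)) (zz δ x)
        ⌊(K : ℝ) * ξ ^ j⌋₊ (QH δ ξ x (ξ ^ j)) n b - throughWeight ((ξ ^ j) ^ (6 + 4 * ε)) (zz δ x)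
        ⌊(K : ℝ) * ξ ^ j⌋₊ (badSteps ((ξ ^ j) ^ (6 + 4 * ε)) (zz δ x) ((ξ ^ j) ^ (-1 - ε))
          ⌊(K : ℝ) * ξ ^ j⌋₊ K (yy δ x) (QH δ ξ x (ξ ^ j)) b) n b := by
    unfold throughWeight scaleSteps
    rw [eq_sub_iff_add_eq]
    exact sum_sdiff (filter_subset _ _)
  rw [hsplit]
  have h4 := throughWeight_nonneg (w := (ξ ^ j) ^ (6 + 4 * ε)) (z := zz δ x)
    (k := ⌊(K : ℝ) * ξ ^ j⌋₊) (Q := badSteps ((ξ ^ j) ^ (6 + 4 * ε)) (zz δ x) ((ξ ^ j) ^ (-1 - ε))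
          ⌊(K : ℝ) * ξ ^ j⌋₊ K (yy δ x) (QH δ ξ x (ξ ^ j)) b) n b
  have h5 := abs_le.1 h3.1
  rw [abs_le]
  constructor <;> linarith [h5.1, h5.2, h3.2]

end

end SievedGaps

namespace SievedGaps
open Finset Filter

section

variable {δ ξ ε x : ℝ} {K : ℕ} {J : Finset ℕ} {b : ℤ}

theorem goodShift_add_PP (hs : ∀ j ∈ J, Scale δ ξ (6 + 4 * ε) K x (ξ ^ j)) :
    GoodShift δ ξ ε K x J (b + PP (zz δ x)) ↔ GoodShift δ ξ ε K x J b := by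
  have h1 : inS (zz δ x) (b + PP (zz δ x)) = inS (zz δ x) b :=
    funext fun n => inS_periodic _ _ _
  have hsum : ∑ j ∈ J, ((scaleBadPoints δ ξ ε K x (ξ ^ j) (b + PP (zz δ x))).card : ℝ) =
      ∑ j ∈ J, ((scaleBadPoints δ ξ ε K x (ξ ^ j) b).card : ℝ) := by
    refine sum_congr rfl fun j hj => ?_
    have h2 : ∀ A, lamSet ((ξ ^ j) ^ (6 + 4 * ε)) (zz δ x) A (b + PP (zz δ x)) =
        lamSet ((ξ ^ j) ^ (6 + 4 * ε)) (zz δ x) A b := fun A =>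
      lamSet_periodic (hs j hj).rpow_le_z A b
    unfold scaleBadPoints badPoints badSteps throughWeight totalWeight
    simp only [h1, h2]
  unfold GoodShift countS
  rw [hsum, h1]

theorem eventually_card_not_goodShift_le (hδ0 : 0 < δ) (hξ : 1 < ξ) (hε : 0 < ε) (hK : 2 ≤ K) :
    ∀ᶠ x in atTop, ∀ J : Finset ℕ, (∀ j ∈ J, Scale δ ξ (6 + 4 * ε) K x (ξ ^ j)) →
      (((range (PP (zz δ x))).filter fun b : ℕ => ¬ GoodShift δ ξ ε K x J b).card : ℝ) ≤
        PP (zz δ x) / 4 := by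
  filter_upwards [eventually_card_filter_countS_le hδ0,
    eventually_card_filter_sum_scaleBadPoints_le hδ0 hξ hε hK] with x h1 h2 J hJ
  have h3 : (range (PP (zz δ x))).filter (fun b : ℕ => ¬ GoodShift δ ξ ε K x J b) ⊆
      ((range (PP (zz δ x))).filter fun b : ℕ => 2 * sigUpTo (zz δ x) * (yy δ x : ℝ) <
        countS (zz δ x) (b : ℤ) 1 (yy δ x)) ∪
      ((range (PP (zz δ x))).filter fun b : ℕ => x / (10 * Real.log x) <
        ∑ j ∈ J, ((scaleBadPoints δ ξ ε K x (ξ ^ j) (b : ℤ)).card : ℝ)) := by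
    rw [← filter_or]
    refine monotone_filter_right _ fun b _ hb => ?_
    unfold GoodShift at hb
    rw [not_and_or, not_le, not_le] at hb
    exact hb
  have h4 : (((range (PP (zz δ x))).filter fun b : ℕ => ¬ GoodShift δ ξ ε K x J b).card : ℝ) ≤ _ :=
    Nat.cast_le.2 ((card_le_card h3).trans (card_union_le _ _))
  push_cast at h4
  linarith [h2 J hJ]

theorem eventually_exists_goodShift (hδ0 : 0 < δ) (hξ : 1 < ξ) (hε : 0 < ε) (hK : 2 ≤ K) :
    ∀ᶠ x in atTop, ∀ I J : Finset ℕ, (∀ j ∈ I, Scale δ ξ (6 + 4 * ε) K x (ξ ^ j)) →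
      (∀ j ∈ J, Scale δ ξ (6 + 4 * ε) K x (ξ ^ j)) → ∀ N : ℕ,
      ∃ b : ℤ, GoodShift δ ξ ε K x I b ∧ GoodShift δ ξ ε K x J (N + b) := by
  filter_upwards [eventually_card_not_goodShift_le hδ0 hξ hε hK] with x h I J hI hJ N
  by_contra hno
  push Not at hno
  set P := PP (zz δ x) with hP
  have hP0 : (0 : ℝ) < P := by exact_mod_cast PP_pos _
  have hper : Function.Periodic (fun b : ℕ => ¬ GoodShift δ ξ ε K x J (b : ℤ)) P := by
    intro b
    have := goodShift_add_PP (b := (b : ℤ)) hJ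
    simp only [Nat.cast_add, eq_iff_iff]
    exact not_congr this
  have hshift : ((range P).filter fun b : ℕ => ¬ GoodShift δ ξ ε K x J ((N : ℤ) + b)).card =
      ((range P).filter fun b : ℕ => ¬ GoodShift δ ξ ε K x J (b : ℤ)).card := by
    have h1 := Nat.filter_Ico_card_eq_of_periodic N P _ hper
    rw [Nat.count_eq_card_filter_range] at h1
    rw [← h1]
    refine card_bij (fun b _ => N + b) ?_ ?_ ?_
    · intro b hb
      rw [mem_filter, mem_range] at hb
      rw [mem_filter, mem_Ico]
      exact ⟨⟨by omega, by omega⟩, by push_cast; exact hb.2⟩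
    · intro a _ b _ hab
      omega
    · intro c hc
      rw [mem_filter, mem_Ico] at hc
      refine ⟨c - N, ?_, by omega⟩
      rw [mem_filter, mem_range]
      refine ⟨by omega, ?_⟩
      rw [Nat.cast_sub hc.1.1, add_sub_cancel]
      exact hc.2
  have hcover : range P ⊆ ((range P).filter fun b : ℕ => ¬ GoodShift δ ξ ε K x I b) ∪
      ((range P).filter fun b : ℕ => ¬ GoodShift δ ξ ε K x J ((N : ℤ) + b)) := by
    intro b hb
    rw [mem_union, mem_filter, mem_filter]
    by_cases hbI : GoodShift δ ξ ε K x I b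
    · exact Or.inr ⟨hb, hno b hbI⟩
    · exact Or.inl ⟨hb, hbI⟩
  have hcard := Nat.cast_le (α := ℝ).2 ((card_le_card hcover).trans (card_union_le _ _))
  rw [hshift, card_range] at hcard
  push_cast at hcard
  linarith [h I hI, h J hJ]

end

theorem inS_neg_sub_iff (t : ℝ) (N b n : ℤ) : inS t (-N - b) n ↔ inS t (N + b) (-n) := by
  unfold inS
  have : ∀ p : ℕ, (p : ℤ) ∣ n - (-N - b) ↔ (p : ℤ) ∣ -n - (N + b) := fun p => by
    rw [← dvd_neg, show -(n - (-N - b)) = -n - (N + b) by ring]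
  simp only [this]

theorem inSBetween_neg_sub_iff (w t : ℝ) (N b n : ℤ) :
    inSBetween w t (-N - b) n ↔ inSBetween w t (N + b) (-n) := by
  unfold inSBetween
  have : ∀ p : ℕ, (p : ℤ) ∣ n - (-N - b) ↔ (p : ℤ) ∣ -n - (N + b) := fun p => by
    rw [← dvd_neg, show -(n - (-N - b)) = -n - (N + b) by ring]
  simp only [this]

theorem lamStar_eq_lam (M z : ℝ) (K : ℕ) (N b : ℤ) (H : ℝ) (q : ℕ) (n : ℤ) :
    lamStar M z K N b H q n = lam M z K (N + b) H q (-n) := by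
  have hset : APset M K (N + b) H q (-n) = (APsetStar M K N b H q n).image Neg.neg := by
    ext m
    simp only [APset, APsetStar, mem_filter, mem_image]
    constructor
    · rintro ⟨⟨h, hh, rfl⟩, hm⟩
      refine ⟨n - q * h, ⟨⟨h, hh, rfl⟩, ?_⟩, by ring⟩
      rw [inS_neg_sub_iff, show -(n - (q : ℤ) * h) = -n + q * h by ring]
      exact hm
    · rintro ⟨_, ⟨⟨h, hh, rfl⟩, hm⟩, rfl⟩
      refine ⟨⟨h, hh, by ring⟩, ?_⟩
      rwa [inS_neg_sub_iff] at hm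
  have hcard : (APset M K (N + b) H q (-n)).card = (APsetStar M K N b H q n).card := by
    rw [hset, card_image_of_injective _ neg_injective]
  have hall : (∀ m ∈ APset M K (N + b) H q (-n), inSBetween (H ^ M) z (N + b) m) ↔
      ∀ m ∈ APsetStar M K N b H q n, inSBetween (H ^ M) z (-N - b) m := by
    rw [hset, forall_mem_image]
    simp only [inSBetween_neg_sub_iff]
  unfold lamStar lam
  rw [hcard]
  simp only [hall]

theorem filter_inS_neg_eq_image (t : ℝ) (N b : ℤ) (y : ℤ) :
    (Icc (-y) (-1)).filter (inS t (-N - b)) =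
      ((Icc 1 y).filter (inS t (N + b))).image Neg.neg := by
  ext n
  simp only [mem_filter, mem_image, mem_Icc, inS_neg_sub_iff]
  constructor
  · rintro ⟨⟨h1, h2⟩, h3⟩
    exact ⟨-n, ⟨⟨by omega, by omega⟩, h3⟩, neg_neg n⟩
  · rintro ⟨m, ⟨⟨h1, h2⟩, h3⟩, rfl⟩
    exact ⟨⟨by omega, by omega⟩, by rwa [neg_neg]⟩

theorem countS_neg_sub (t : ℝ) (N b y : ℤ) :
    countS t (-N - b) (-y) (-1) = countS t (N + b) 1 y := by
  unfold countS
  rw [filter_inS_neg_eq_image, card_image_of_injective _ neg_injective]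

theorem sum_lamStar_eq_sum_lam (M z : ℝ) (K : ℕ) (N b : ℤ) (H : ℝ) (q : ℕ) (a c : ℤ) :
    ∑ n ∈ Ico (-c) a, lamStar M z K N b H q n = ∑ n ∈ Ioc (-a) c, lam M z K (N + b) H q n := by
  refine sum_bij' (fun n _ => -n) (fun n _ => -n) ?_ ?_ ?_ ?_ ?_
  · intro n hn; rw [mem_Ico] at hn; rw [mem_Ioc]; omega
  · intro n hn; rw [mem_Ioc] at hn; rw [mem_Ico]; omega
  · intro n _; exact neg_neg n
  · intro n _; exact neg_neg n
  · intro n _; exact lamStar_eq_lam ..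

theorem sum_log_sub_log_div_ge {y : ℝ} {m N : ℕ} (hm : 0 < m) (hmN : m ≤ N) (hNy : (N : ℝ) < y) :
    Real.log (Real.log (y / m)) - Real.log (Real.log (y / N)) ≤
      ∑ n ∈ Ioc m N, (Real.log n - Real.log (n - 1 : ℕ)) * (1 / Real.log (y / n)) := by
  induction N, hmN using Nat.le_induction with
  | base => simp
  | succ k hk ih =>
    have hk0 : (0 : ℝ) < k := by exact_mod_cast hm.trans_le hk
    push_cast at hNy
    have ih := ih (by linarith)
    rw [Finset.sum_Ioc_succ_top (by omega)]
    simp only [Nat.add_sub_cancel]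
    have hy : 0 < y := by linarith
    have hb : 0 < Real.log (y / (k + 1 : ℕ)) := by
      apply Real.log_pos
      rw [one_lt_div (by positivity)]
      push_cast
      exact hNy
    have ha : 0 < Real.log (y / k) := by
      apply Real.log_pos
      rw [one_lt_div hk0]
      linarith
    have e : Real.log ((k + 1 : ℕ) : ℝ) - Real.log k = Real.log (y / k) - Real.log (y / (k + 1 : ℕ)) := by
      rw [Real.log_div hy.ne' hk0.ne', Real.log_div hy.ne' (by positivity)]
      ring
    have h1 := Real.log_le_sub_one_of_pos (div_pos ha hb)
    rw [Real.log_div ha.ne' hb.ne'] at h1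
    have e2 : (Real.log ((k + 1 : ℕ) : ℝ) - Real.log k) * (1 / Real.log (y / (k + 1 : ℕ))) =
        Real.log (y / k) / Real.log (y / (k + 1 : ℕ)) - 1 := by
      rw [e]
      field_simp
    linarith

theorem exists_sum_primeWeight_div_log_ge : ∃ C : ℝ, 0 ≤ C ∧ ∀ (y : ℝ) (m N : ℕ), 0 < m → m ≤ N →
    (N : ℝ) < y → Real.log (Real.log (y / m)) - Real.log (Real.log (y / N)) - C / Real.log (y / N) ≤
      ∑ n ∈ Ioc m N, primeWeight n * (1 / Real.log (y / n)) := by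
  obtain ⟨C, hC0, hC⟩ := exists_abs_sum_primeWeight_sub_log_le
  refine ⟨3 * C, by positivity, fun y m N hm hmN hNy => ?_⟩
  have hpos : ∀ n : ℕ, m < n → n ≤ N → 0 < Real.log (y / n) := fun n h1 h2 => by
    have h3 : (n : ℝ) ≤ N := by exact_mod_cast h2
    have h4 : (0 : ℝ) < n := by exact_mod_cast hm.trans h1
    exact Real.log_pos ((one_lt_div h4).2 (by linarith))
  have hanti : ∀ a b : ℕ, m < a → a ≤ b → b ≤ N → Real.log (y / b) ≤ Real.log (y / a) :=
    fun a b h1 h2 h3 => by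
    have h4 : (0 : ℝ) < a := by exact_mod_cast hm.trans h1
    have h5 : (a : ℝ) ≤ b := by exact_mod_cast h2
    have h6 : (b : ℝ) ≤ N := by exact_mod_cast h3
    have h7 : 0 < y := by linarith
    exact Real.log_le_log (div_pos h7 (by linarith)) (div_le_div_of_nonneg_left h7.le h4 h5)
  have hBpos : 0 < Real.log (y / N) :=
    Real.log_pos ((one_lt_div (by exact_mod_cast hm.trans_le hmN)).2 hNy)
  set E : ℕ → ℂ := fun N => ((∑ n ∈ Ioc 0 N, primeWeight n - Real.log N : ℝ) : ℂ) with hE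
  have h1 := norm_sum_Ioc_sub_mul_le (E := E) (g := fun n => 1 / Real.log (y / n)) (m := m) (N := N)
    (C := C) (B := 1 / Real.log (y / N)) (fun n _ _ => by
      simp only [hE]; rw [Complex.norm_real, Real.norm_eq_abs]; exact hC n) hmN
    (fun n h1 h2 => (one_div_pos.2 (hpos n h1 h2)).le)
    (fun n h1 h2 => one_div_le_one_div_of_le hBpos (hanti n N h1 h2 le_rfl))
    (one_div_pos.2 hBpos).le
    (Or.inl fun n h1 h2 => one_div_le_one_div_of_le (hpos (n + 1) (by omega) (by omega))
      (hanti n (n + 1) h1 (by omega) (by omega)))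
  have h2 : ∑ n ∈ Ioc m N, (E n - E (n - 1)) * ((1 / Real.log (y / n) : ℝ) : ℂ) =
      ((∑ n ∈ Ioc m N, primeWeight n * (1 / Real.log (y / n)) -
        ∑ n ∈ Ioc m N, (Real.log n - Real.log (n - 1 : ℕ)) * (1 / Real.log (y / n)) : ℝ) : ℂ) := by
    rw [← sum_sub_distrib, Complex.ofReal_sum]
    refine sum_congr rfl fun n hn => ?_
    have hn := mem_Ioc.1 hn
    obtain ⟨j, rfl⟩ : ∃ j, n = j + 1 := ⟨n - 1, by omega⟩
    simp only [hE, Nat.add_sub_cancel]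
    rw [Finset.sum_Ioc_succ_top (by omega), ← Complex.ofReal_sub, ← Complex.ofReal_mul]
    congr 1
    ring
  rw [h2, Complex.norm_real, Real.norm_eq_abs, abs_le] at h1
  have h3 := sum_log_sub_log_div_ge hm hmN hNy
  have h4 : 3 * C * (1 / Real.log (y / N)) = 3 * C / Real.log (y / N) := by ring
  linarith [h1.1]

/-- A subfamily of terms in `[0, 1]` whose sum lies in a prescribed interval of length one. -/
theorem exists_subset_sum_mem_Icc {ι : Type*} (s : Finset ι) (f : ι → ℝ) {A : ℝ} (hA : 0 ≤ A)
    (h1 : ∀ i ∈ s, f i ≤ 1) (hs : A ≤ ∑ i ∈ s, f i) :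
    ∃ t ⊆ s, A ≤ ∑ i ∈ t, f i ∧ ∑ i ∈ t, f i ≤ A + 1 := by
  induction s using Finset.induction_on with
  | empty => exact ⟨∅, subset_rfl, hs, by simp; linarith⟩
  | insert a s ha ih =>
    rcases le_or_gt A (∑ i ∈ s, f i) with h | h
    · obtain ⟨t, ht, h2⟩ := ih (fun i hi => h1 i (mem_insert_of_mem hi)) h
      exact ⟨t, ht.trans (subset_insert _ _), h2⟩
    · refine ⟨insert a s, subset_rfl, hs, ?_⟩
      rw [sum_insert ha]
      linarith [h1 a (mem_insert_self _ _)]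

theorem Scale.mul_loglog_le_log {δ ξ M x H : ℝ} {K : ℕ} (h : Scale δ ξ M K x H) :
    δ * Real.log (Real.log x) ≤ Real.log H := by
  rw [← Real.log_rpow h.log_pos]
  exact Real.log_le_log (Real.rpow_pos_of_pos h.log_pos _) h.log_rpow_le

theorem eventually_meanThrough_le {δ M : ℝ} (hδ0 : 0 < δ) (hM : 6 < M) (ξ : ℝ) (K : ℕ) :
    ∀ᶠ x in atTop, ∀ H, Scale δ ξ M K x H →
      meanThrough (H ^ M) (zz δ x) ⌊(K : ℝ) * H⌋₊ (QH δ ξ x H) ≤ ((K : ℝ) + 1) * yy δ x := by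
  obtain ⟨C, hC, hσ⟩ := exists_inv_sigBetween_le
  obtain ⟨C', hC', hQ⟩ := exists_card_QH_le
  filter_upwards [eventually_le_log_log (C * C' / δ)] with x hx H hs
  have hlog := hs.mul_loglog_le_log
  rw [div_le_iff₀ hδ0] at hx
  have hL := hs.log_pos
  have hH := hs.pos
  have hy := hs.regime.y_pos
  have hw : C * C' ≤ Real.log (H ^ M) := by
    rw [Real.log_rpow hH]
    have : 0 < Real.log H := Real.log_pos (by linarith [hs.four_le])
    nlinarith
  have hw1 := hs.one_le_log_rpow hM
  have hσ1 := hσ δ ξ M x H K hs hM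
  have hσ0 : 0 ≤ (sigBetween (H ^ M) (zz δ x))⁻¹ :=
    inv_nonneg.2 (sigBetween_pos (H ^ M) (zz δ x)).le
  unfold meanThrough
  rw [div_eq_mul_inv]
  calc ((QH δ ξ x H).card : ℝ) * (⌊(K : ℝ) * H⌋₊ : ℝ) * (sigBetween (H ^ M) (zz δ x))⁻¹
      ≤ (C' * ((yy δ x : ℝ) / H / Real.log x)) * (K * H) * (C * (Real.log x / Real.log (H ^ M))) := by
        gcongr
        · exact hQ δ ξ M x H K hs
        · exact hs.floor_le
    _ = K * yy δ x * (C * C' / Real.log (H ^ M)) := by field_simp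
    _ ≤ K * yy δ x * 1 := by
        gcongr
        rwa [div_le_one (by linarith)]
    _ ≤ ((K : ℝ) + 1) * yy δ x := by nlinarith

theorem eventually_le_log_zz {δ η : ℝ} (hδ0 : 0 < δ) (hη : 0 < η) :
    ∀ᶠ x in atTop, (1 - η) * Real.log x ≤ Real.log (zz δ x) := by
  filter_upwards [eventually_regime hδ0, eventually_mul_log_rpow_le 1 (1 / 2) hη] with x hR h1
  have hx := hR.x_pos
  rw [← Real.log_rpow hx]
  refine Real.log_le_log (Real.rpow_pos_of_pos hx _) ?_
  have hr : 0 < Real.log x ^ (1 / 2 : ℝ) := Real.rpow_pos_of_pos (by linarith [hR.log_ge]) _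
  unfold zz
  rw [le_div_iff₀ hr, Real.rpow_sub hx, Real.rpow_one, div_mul_eq_mul_div,
    div_le_iff₀ (Real.rpow_pos_of_pos hx _)]
  have h2 := hR.loglog_ge
  have h3 : 1 ≤ Real.log (Real.log x) ^ 2 := by nlinarith
  have h4 := hR.x_le_y
  rw [one_mul] at h1
  have h5 : 0 < x ^ η := Real.rpow_pos_of_pos hx _
  calc x * Real.log x ^ (1 / 2 : ℝ) ≤ x * x ^ η := by gcongr
    _ ≤ (yy δ x * Real.log (Real.log x) ^ 2) * x ^ η := by
        gcongr
        nlinarith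

theorem eventually_meanThrough_ge {δ M η : ℝ} (hδ0 : 0 < δ) (hM : 6 < M) (hη : 0 < η) (hη1 : η < 1)
    (ξ : ℝ) {K : ℕ} (hK : 1 ≤ K) :
    ∀ᶠ x in atTop, ∀ H, Scale δ ξ M K x H →
      (1 - η) ^ 3 * (K / (M * ξ)) * yy δ x *
        ∑ q ∈ QH δ ξ x H, primeWeight q * (1 / Real.log (yy δ x / q)) ≤
      meanThrough (H ^ M) (zz δ x) ⌊(K : ℝ) * H⌋₊ (QH δ ξ x H) := by
  obtain ⟨C, hC, hσ⟩ := exists_inv_sigBetween_bounds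
  filter_upwards [eventually_le_log_zz hδ0 hη, eventually_le_log_log (C / η / δ),
    ((tendsto_rpow_atTop hδ0).comp Real.tendsto_log_atTop).eventually_ge_atTop (1 / η)]
    with x hz hx hL' H hs
  have hlog := hs.mul_loglog_le_log
  rw [div_le_iff₀ hδ0] at hx
  have hL := hs.log_pos
  have hH := hs.pos
  have hH4 := hs.four_le
  have hy := hs.regime.y_pos
  have hξ := hs.one_lt
  have hK1 : (1 : ℝ) ≤ K := by exact_mod_cast hK
  have hlH : 0 < Real.log H := Real.log_pos (by linarith)
  have hlw : Real.log (H ^ M) = M * Real.log H := Real.log_rpow hH M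
  have hw : C / η ≤ Real.log (H ^ M) := by
    rw [hlw]
    nlinarith
  have hw1 := hs.one_le_log_rpow hM
  have hσ1 : (1 - η) ^ 2 * (Real.log x / (M * Real.log H)) ≤ (sigBetween (H ^ M) (zz δ x))⁻¹ := by
    refine le_trans ?_ (hσ _ _ (by linarith [hs.four_le_rpow hM]) hs.rpow_le_z).1
    rw [← hlw]
    have h1 : 1 - η ≤ 1 - C / Real.log (H ^ M) := by
      rw [div_le_iff₀ hη] at hw
      have : C / Real.log (H ^ M) ≤ η := by rw [div_le_iff₀ (by linarith)]; linarith
      linarith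
    have h1' : 0 ≤ 1 - η := by linarith
    calc (1 - η) ^ 2 * (Real.log x / Real.log (H ^ M))
        = (1 - η) * Real.log x / Real.log (H ^ M) * (1 - η) := by ring
      _ ≤ Real.log (zz δ x) / Real.log (H ^ M) * (1 - C / Real.log (H ^ M)) := by
        have : 0 ≤ Real.log (zz δ x) := by nlinarith
        gcongr
  have hk : (1 - η) * (K * H) ≤ (⌊(K : ℝ) * H⌋₊ : ℝ) := by
    have h1 := Nat.lt_floor_add_one ((K : ℝ) * H)
    have h2 : 1 / η ≤ K * H := by
      have := hs.log_rpow_le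
      simp only [Function.comp] at hL'
      nlinarith
    rw [div_le_iff₀ hη] at h2
    linarith
  unfold meanThrough
  rw [mul_sum, mul_div_assoc, div_eq_mul_inv (⌊(K : ℝ) * H⌋₊ : ℝ), ← nsmul_eq_mul]
  refine Finset.sum_le_card_nsmul (QH δ ξ x H) _ _ fun q hq => ?_
  obtain ⟨hqp, hq1, hq2⟩ := mem_QH.1 hq
  have hq0 : (0 : ℝ) < q := by exact_mod_cast hqp.pos
  have hlq : Real.log q ≤ Real.log x := by
    refine Real.log_le_log hq0 ?_
    have := hs.regime.y_div_le hs.lo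
    linarith [hs.regime.x_pos]
  have hlq0 : 0 ≤ Real.log q := Real.log_nonneg (by exact_mod_cast hqp.one_le)
  have hyq : Real.log H ≤ Real.log (yy δ x / q) := by
    refine Real.log_le_log hH ?_
    rw [le_div_iff₀ hq0]
    rw [le_div_iff₀ hH] at hq2
    linarith
  have hHq : yy δ x / (ξ * q) ≤ H := by
    rw [div_le_iff₀ (by positivity)]
    rw [div_lt_iff₀ (by positivity)] at hq1
    linarith
  have hη0 : 0 ≤ 1 - η := by linarith
  have hM0 : 0 < M := by linarith
  have hyq0 : 0 ≤ Real.log q / (M * Real.log (yy δ x / q)) :=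
    div_nonneg hlq0 (mul_nonneg hM0.le (hlH.le.trans hyq))
  unfold primeWeight
  rw [if_pos hqp]
  calc (1 - η) ^ 3 * (K / (M * ξ)) * yy δ x * (Real.log q / q * (1 / Real.log (yy δ x / q)))
      = (1 - η) * (K * (yy δ x / (ξ * q))) *
          ((1 - η) ^ 2 * (Real.log q / (M * Real.log (yy δ x / q)))) := by
        field_simp
    _ ≤ (1 - η) * (K * H) * ((1 - η) ^ 2 * (Real.log x / (M * Real.log H))) := by
        gcongr
    _ ≤ (⌊(K : ℝ) * H⌋₊ : ℝ) * (sigBetween (H ^ M) (zz δ x))⁻¹ := by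
        gcongr

theorem pow_floor_log_bounds {ξ t : ℝ} (hξ : 1 < ξ) (ht : 1 ≤ t) :
    ξ ^ ⌊Real.log t / Real.log ξ⌋₊ ≤ t ∧ t < ξ * ξ ^ ⌊Real.log t / Real.log ξ⌋₊ := by
  have hl : 0 < Real.log ξ := Real.log_pos hξ
  have ht0 : 0 < t := by linarith
  have hξ0 : 0 < ξ := by linarith
  have h0 : 0 ≤ Real.log t / Real.log ξ := div_nonneg (Real.log_nonneg ht) hl.le
  constructor
  · rw [← Real.log_le_log_iff (by positivity) ht0, Real.log_pow, ← le_div_iff₀ hl]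
    exact Nat.floor_le h0
  · rw [← pow_succ', ← Real.log_lt_log_iff ht0 (by positivity), Real.log_pow, ← div_lt_iff₀ hl]
    push_cast
    exact Nat.lt_floor_add_one _

theorem even_floor_log_mul_pow_iff {ξ t : ℝ} (hξ : 1 < ξ) (ht : 1 ≤ t) (s : ℕ) :
    Even ⌊Real.log (t * ξ ^ s) / Real.log ξ⌋ ↔ Even (⌊Real.log t / Real.log ξ⌋₊ + s) := by
  have hl : 0 < Real.log ξ := Real.log_pos hξ
  have h0 : 0 ≤ Real.log t / Real.log ξ := div_nonneg (Real.log_nonneg ht) hl.le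
  rw [Real.log_mul (by linarith) (by positivity), Real.log_pow, add_div, mul_div_cancel_right₀ _ hl.ne',
    Int.floor_add_natCast, ← Int.natCast_floor_eq_floor h0]
  exact_mod_cast Iff.rfl

/-- Primes `q` with `log x ^ α ≤ y / q < log x ^ β` are distributed over admissible scales whose
exponents have a prescribed parity, losing only half of their weight. -/
theorem eventually_exists_scales {δ α β ξ M η : ℝ} (hδ0 : 0 < δ) (hα : δ < α) (hαβ : α < β)
    (hβ : β < 1 / 2) (hξ : 1 < ξ) (hM : 0 ≤ M) (hη : 0 < η) (hη2 : η < 1 / 2) (K s : ℕ) :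
    ∀ᶠ x in atTop, ∃ J : Finset ℕ, (∀ j ∈ J, Even (j + s)) ∧
      (∀ j ∈ J, Scale δ ξ M K x (ξ ^ j)) ∧
      (1 / 2 - η) * (Real.log (β / α) - η) - η ≤
        ∑ j ∈ J, ∑ q ∈ QH δ ξ x (ξ ^ j), primeWeight q * (1 / Real.log (yy δ x / q)) := by
  have hα0 : 0 < α := hδ0.trans hα
  have hβ0 : 0 < β := hα0.trans hαβ
  obtain ⟨C, hC0, hpar⟩ := exists_parity_lower_bound (Real.log_pos hξ) hη
  obtain ⟨C', hC'0, hsum⟩ := exists_sum_primeWeight_div_log_ge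
  filter_upwards [eventually_scale hδ0 hξ M hM K, eventually_regime hδ0,
    eventually_mul_log_rpow_le 2 1 one_pos,
    eventually_le_log_log (C / η / α), eventually_le_log_log ((Real.log 2 + C') / η / α),
    ((tendsto_rpow_atTop (sub_pos.2 hα)).comp Real.tendsto_log_atTop).eventually_ge_atTop (4 * ξ),
    eventually_mul_log_log_rpow_le ξ 2 (sub_pos.2 hβ)]
    with x hscale hR hx1 hD1 hD2 hlo hhi
  set L := Real.log x with hLdef
  set D := Real.log L with hDdef
  set y : ℝ := (yy δ x : ℝ) with hy
  have hy0 : 0 < y := hR.y_pos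
  have hx0 := hR.x_pos
  have hL16 : 16 ≤ L := hR.log_ge
  have hL0 : 0 < L := by linarith
  have hDpos : 0 < D := by linarith [hR.loglog_ge]
  have hxy : x ≤ y := hR.x_le_y
  rw [div_div, div_le_iff₀ (by positivity)] at hD1 hD2
  simp only [Real.rpow_one] at hx1
  simp only [Function.comp] at hlo
  have hrp : ∀ a : ℝ, 0 < L ^ a := fun a => Real.rpow_pos_of_pos hL0 a
  have hLa1 : ∀ a : ℝ, 0 < a → 1 < L ^ a := fun a ha => Real.one_lt_rpow (by linarith) ha
  have hLle : ∀ a : ℝ, a ≤ 1 → 2 ≤ y / L ^ a := fun a ha => by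
    rw [le_div_iff₀ (hrp a)]
    have : L ^ a ≤ L ^ (1 : ℝ) := Real.rpow_le_rpow_of_exponent_le (by linarith) ha
    rw [Real.rpow_one] at this
    linarith
  have h2α := hLle α (by linarith)
  have h2β := hLle β (by linarith)
  set m := ⌊y / L ^ β⌋₊ with hm
  set N := ⌊y / L ^ α⌋₊ with hN
  have hm1 : 1 ≤ m := (Nat.one_le_floor_iff _).2 (by linarith)
  have hLαβ : L ^ α ≤ L ^ β := Real.rpow_le_rpow_of_exponent_le (by linarith) hαβ.le
  have hmN : m ≤ N := Nat.floor_le_floor (div_le_div_of_nonneg_left hy0.le (hrp α) hLαβ)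
  have hNle : (N : ℝ) ≤ y / L ^ α := Nat.floor_le (by linarith)
  have hmle : (m : ℝ) ≤ y / L ^ β := Nat.floor_le (by linarith)
  have hm0 : (0 : ℝ) < m := by exact_mod_cast hm1
  have hN0 : (0 : ℝ) < N := by exact_mod_cast hm1.trans hmN
  have hyN : L ^ α ≤ y / N := by
    rw [le_div_iff₀ hN0]
    rw [le_div_iff₀ (hrp α)] at hNle
    linarith
  have hNy : (N : ℝ) < y := by
    have := (hLa1 α hα0).trans_le hyN
    rwa [one_lt_div hN0] at this
  have hlogN : α * D ≤ Real.log (y / N) := by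
    rw [hDdef, ← Real.log_rpow hL0]
    exact Real.log_le_log (hrp α) hyN
  have hlogN' : Real.log (y / N) ≤ α * D + Real.log 2 := by
    rw [hDdef, ← Real.log_rpow hL0, ← Real.log_mul (hrp α).ne' (by norm_num)]
    refine Real.log_le_log (by positivity) ?_
    rw [div_le_iff₀ hN0]
    have h1 := Nat.lt_floor_add_one (y / L ^ α)
    have h2 : y / L ^ α ≤ 2 * N := by linarith
    rw [div_le_iff₀ (hrp α)] at h2
    linarith
  have hlogm : β * D ≤ Real.log (y / m) := by
    rw [hDdef, ← Real.log_rpow hL0]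
    refine Real.log_le_log (hrp β) ?_
    rw [le_div_iff₀ hm0]
    rw [le_div_iff₀ (hrp β)] at hmle
    linarith
  have hαD : 0 < α * D := by positivity
  have hbound : ∀ n : ℕ, m < n → n ≤ N → (0 : ℝ) < n ∧ L ^ α ≤ y / n ∧ y / n < L ^ β := by
    intro n h1 h2
    have hn0 : (0 : ℝ) < n := by exact_mod_cast (by omega : 0 < n)
    refine ⟨hn0, ?_, ?_⟩
    · refine hyN.trans (div_le_div_of_nonneg_left hy0.le hn0 (by exact_mod_cast h2))
    · rw [div_lt_iff₀ hn0]
      have := (Nat.floor_lt (by linarith)).1 h1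
      rw [div_lt_iff₀ (hrp β)] at this
      linarith
  have hanti : ∀ a b : ℕ, m < a → a ≤ b → b ≤ N → Real.log (y / b) ≤ Real.log (y / a) :=
    fun a b h1 h2 h3 => Real.log_le_log (div_pos hy0 (hbound b (by omega) h3).1)
      (div_le_div_of_nonneg_left hy0.le (hbound a h1 (by omega)).1 (by exact_mod_cast h2))
  have hlpos : ∀ n : ℕ, m < n → n ≤ N → 0 < Real.log (y / n) := fun n h1 h2 =>
    Real.log_pos ((hLa1 α hα0).trans_le (hbound n h1 h2).2.1)
  have hp := hpar (y * ξ ^ s) (by positivity) m N (fun n => 1 / Real.log (y / n))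
    (1 / Real.log (y / N)) hmN (one_div_pos.2 (hαD.trans_le hlogN)).le
    (fun n h1 h2 => (one_div_pos.2 (hlpos n h1 h2)).le)
    (fun n h1 h2 => one_div_le_one_div_of_le (hαD.trans_le hlogN) (hanti n N h1 h2 le_rfl))
    (fun n h1 h2 => one_div_le_one_div_of_le (hlpos (n + 1) (by omega) (by omega))
      (hanti n (n + 1) h1 (by omega) (by omega)))
  have hS := hsum y m N hm1 hmN hNy
  have hlow : Real.log (β / α) - η ≤ ∑ n ∈ Ioc m N, primeWeight n * (1 / Real.log (y / n)) := by
    refine le_trans ?_ hS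
    have h1 : Real.log (β * D) ≤ Real.log (Real.log (y / m)) := Real.log_le_log (by positivity) hlogm
    have h2 : Real.log (Real.log (y / N)) ≤ Real.log (α * D) + Real.log 2 / (α * D) := by
      refine (Real.log_le_log (by linarith) hlogN').trans ?_
      have e : α * D + Real.log 2 = α * D * (1 + Real.log 2 / (α * D)) := by field_simp
      have h3 : 0 < Real.log 2 / (α * D) := div_pos (Real.log_pos (by norm_num)) hαD
      rw [e, Real.log_mul hαD.ne' (by linarith)]
      have := Real.log_le_sub_one_of_pos (show 0 < 1 + Real.log 2 / (α * D) by linarith)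
      linarith
    have h3 : C' / Real.log (y / N) ≤ C' / (α * D) :=
      div_le_div_of_nonneg_left hC'0 hαD hlogN
    have h4 : Real.log 2 / (α * D) + C' / (α * D) ≤ η := by
      rw [← add_div, div_le_iff₀ hαD]
      linarith
    rw [Real.log_mul hβ0.ne' hDpos.ne'] at h1
    rw [Real.log_mul hα0.ne' hDpos.ne'] at h2
    rw [Real.log_div hβ0.ne' hα0.ne']
    linarith
  have hCB : C * (1 / Real.log (y / N)) ≤ η := by
    rw [mul_one_div, div_le_iff₀ (hαD.trans_le hlogN)]
    nlinarith
  set φ : ℕ → ℕ := fun n => ⌊Real.log (y / n) / Real.log ξ⌋₊ with hφ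
  set A := (Ioc m N).filter fun n : ℕ => n.Prime ∧ Even (φ n + s) with hA
  have hAmem : ∀ n ∈ A, n.Prime ∧ Even (φ n + s) ∧ (0 : ℝ) < n ∧ L ^ α ≤ y / n ∧ y / n < L ^ β := by
    intro n hn
    obtain ⟨h1, h2⟩ := mem_filter.1 hn
    have h3 := mem_Ioc.1 h1
    exact ⟨h2.1, h2.2, hbound n h3.1 h3.2⟩
  have hφb : ∀ n ∈ A, ξ ^ φ n ≤ y / n ∧ y / n < ξ * ξ ^ φ n := fun n hn =>
    pow_floor_log_bounds hξ ((hLa1 α hα0).le.trans (hAmem n hn).2.2.2.1)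
  refine ⟨A.image φ, ?_, ?_, ?_⟩
  · intro j hj
    obtain ⟨n, hn, rfl⟩ := mem_image.1 hj
    exact (hAmem n hn).2.1
  · intro j hj
    obtain ⟨n, hn, rfl⟩ := mem_image.1 hj
    obtain ⟨-, -, hn0, h1, h2⟩ := hAmem n hn
    obtain ⟨h3, h4⟩ := hφb n hn
    refine hscale _ ?_ ?_
    · have h5 : 4 * ξ * L ^ δ ≤ L ^ α := by
        calc 4 * ξ * L ^ δ ≤ L ^ (α - δ) * L ^ δ := by gcongr
          _ = L ^ α := by rw [← Real.rpow_add hL0, sub_add_cancel]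
      have h6 : 2 * y / x ≤ 4 * L ^ δ := by
        rw [div_le_iff₀ hx0]
        linarith [hR.y_le]
      have h7 : ξ * (4 * L ^ δ) < ξ * ξ ^ φ n := by linarith
      exact h6.trans (lt_of_mul_lt_mul_left h7 (by linarith)).le
    · have hz0 : 0 < zz δ x := by linarith [hR.z_ge]
      have h5 : L ^ β * (ξ * D ^ (2 : ℝ)) ≤ L ^ (1 / 2 : ℝ) := by
        calc L ^ β * (ξ * D ^ (2 : ℝ)) ≤ L ^ β * L ^ (1 / 2 - β) := by gcongr
          _ = L ^ (1 / 2 : ℝ) := by rw [← Real.rpow_add hL0, add_sub_cancel]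
      rw [Real.rpow_two] at h5
      rw [le_div_iff₀ (by positivity)]
      have e : zz δ x = y * D ^ 2 / L ^ (1 / 2 : ℝ) := rfl
      rw [e]
      calc ξ ^ φ n * (ξ * (y * D ^ 2 / L ^ (1 / 2 : ℝ)))
          ≤ L ^ β * (ξ * (y * D ^ 2 / L ^ (1 / 2 : ℝ))) := by
            have := hrp (1 / 2)
            gcongr
            linarith
        _ = y * (L ^ β * (ξ * D ^ 2) / L ^ (1 / 2 : ℝ)) := by ring
        _ ≤ y * 1 := by
            gcongr
            rwa [div_le_one (hrp _)]
        _ = y := mul_one y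
  · have hmain : ∑ n ∈ Ioc m N, primeWeight n * (1 / Real.log (y / n)) *
        (if Even ⌊Real.log (y * ξ ^ s / n) / Real.log ξ⌋ then (1 : ℝ) else 0) =
        ∑ n ∈ A, primeWeight n * (1 / Real.log (y / n)) := by
      rw [hA, sum_filter]
      refine sum_congr rfl fun n hn => ?_
      have h3 := mem_Ioc.1 hn
      have h4 := even_floor_log_mul_pow_iff hξ
        ((hLa1 α hα0).le.trans (hbound n h3.1 h3.2).2.1) s
      rw [mul_div_right_comm]
      by_cases hnp : n.Prime
      · by_cases he : Even (φ n + s)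
        · rw [if_pos (h4.2 he), if_pos ⟨hnp, he⟩, mul_one]
        · rw [if_neg (fun h => he (h4.1 h)), if_neg (fun h => he h.2), mul_zero]
      · rw [if_neg (fun h : n.Prime ∧ _ => hnp h.1)]
        simp [primeWeight, hnp]
    have hfib : ∑ n ∈ A, primeWeight n * (1 / Real.log (y / n)) ≤
        ∑ j ∈ A.image φ, ∑ q ∈ QH δ ξ x (ξ ^ j), primeWeight q * (1 / Real.log (y / q)) := by
      rw [← sum_fiberwise_of_maps_to (fun n hn => mem_image_of_mem φ hn)]
      refine sum_le_sum fun j hj => sum_le_sum_of_subset_of_nonneg ?_ ?_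
      · intro n hn
        obtain ⟨hnA, rfl⟩ := mem_filter.1 hn
        obtain ⟨hnp, -, hn0, -⟩ := hAmem n hnA
        obtain ⟨h3, h4⟩ := hφb n hnA
        refine mem_QH.2 ⟨hnp, ?_, ?_⟩
        · rw [div_lt_iff₀ (by positivity)]
          rw [div_lt_iff₀ hn0] at h4
          linarith
        · rw [le_div_iff₀ (by positivity)]
          rw [le_div_iff₀ hn0] at h3
          linarith
      · intro q hq _
        refine mul_nonneg (primeWeight_nonneg q) (one_div_nonneg.2 ?_)
        obtain ⟨hqp, -, hq2⟩ := mem_QH.1 hq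
        have hq0 : (0 : ℝ) < q := by exact_mod_cast hqp.pos
        refine Real.log_nonneg ?_
        rw [le_div_iff₀ (by positivity)] at hq2
        rw [one_le_div hq0]
        exact le_trans (le_mul_of_one_le_right hq0.le (one_le_pow₀ hξ.le)) hq2
    have h1 : (1 / 2 - η) * (Real.log (β / α) - η) ≤
        (1 / 2 - η) * ∑ n ∈ Ioc m N, primeWeight n * (1 / Real.log (y / n)) :=
      mul_le_mul_of_nonneg_left hlow (by linarith)
    linarith [hp, hmain, hfib]

theorem exists_parameters {δ A : ℝ} (hδ0 : 0 < δ) (hδ1 : δ < 1 / 2)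
    (hδ : 12 * A < Real.log (1 / (2 * δ))) :
    ∃ t : ℝ, 0 < t ∧ t < 1 / 2 ∧ δ * (1 + t) < (1 - t) / 2 ∧
      A < (1 - t) ^ 4 / ((6 + 4 * t) * (1 + t)) *
        ((1 / 2 - t) * (Real.log ((1 - t) / 2 / (δ * (1 + t))) - t) - t) := by
  have hd : δ * (1 + 0) ≠ 0 := by simpa using hδ0.ne'
  have hd' : (1 - 0) / 2 / (δ * (1 + 0)) ≠ 0 := by
    rw [add_zero, mul_one]
    positivity
  have hc : ContinuousAt (fun t : ℝ => (1 - t) ^ 4 / ((6 + 4 * t) * (1 + t)) *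
      ((1 / 2 - t) * (Real.log ((1 - t) / 2 / (δ * (1 + t))) - t) - t)) 0 := by
    have h1 : ContinuousAt (fun t : ℝ => Real.log ((1 - t) / 2 / (δ * (1 + t)))) 0 :=
      ContinuousAt.log (ContinuousAt.div (by fun_prop) (by fun_prop) hd) hd'
    refine ContinuousAt.mul (ContinuousAt.div (by fun_prop) (by fun_prop) (by norm_num)) ?_
    exact ((by fun_prop : ContinuousAt (fun t : ℝ => 1 / 2 - t) 0).mul
      (h1.sub continuousAt_id)).sub continuousAt_id
  have hc2 : ContinuousAt (fun t : ℝ => (1 - t) / 2 - δ * (1 + t)) 0 := by fun_prop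
  have e1 := hc.eventually_const_lt (u := A) (by
    have e : (1 - 0) / 2 / (δ * (1 + 0)) = 1 / (2 * δ) := by field_simp; ring
    beta_reduce
    rw [e]
    norm_num
    norm_num at hδ
    linarith)
  have e2 := hc2.eventually_const_lt (u := 0) (by norm_num; linarith)
  have e3 : ∀ᶠ t : ℝ in nhds 0, t < 1 / 2 := gt_mem_nhds (by norm_num)
  obtain ⟨t, ht⟩ := (((e1.and (e2.and e3)).filter_mono nhdsWithin_le_nhds).and
    (self_mem_nhdsWithin : Set.Ioi (0 : ℝ) ∈ nhdsWithin 0 (Set.Ioi 0))).exists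
  exact ⟨t, ht.2, ht.1.2.2, by linarith [ht.1.2.1], ht.1.1⟩

theorem exists_scales_with_prescribed_mean {δ A : ℝ} (hδ0 : 0 < δ) (hδ1 : δ < 1 / 2) (hA : 0 ≤ A)
    (hδ : 12 * A < Real.log (1 / (2 * δ))) :
    ∃ ξ ε : ℝ, ∃ K : ℕ, 1 < ξ ∧ 0 < ε ∧ 2 ≤ K ∧ ∀ s : ℕ, ∀ᶠ x in atTop, ∃ J : Finset ℕ,
      (∀ j ∈ J, Even (j + s)) ∧ (∀ j ∈ J, Scale δ ξ (6 + 4 * ε) K x (ξ ^ j)) ∧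
      A ≤ (∑ j ∈ J, meanThrough ((ξ ^ j) ^ (6 + 4 * ε)) (zz δ x) ⌊(K : ℝ) * ξ ^ j⌋₊
        (QH δ ξ x (ξ ^ j))) / (((K : ℝ) + 1) * yy δ x) ∧
      (∑ j ∈ J, meanThrough ((ξ ^ j) ^ (6 + 4 * ε)) (zz δ x) ⌊(K : ℝ) * ξ ^ j⌋₊
        (QH δ ξ x (ξ ^ j))) / (((K : ℝ) + 1) * yy δ x) ≤ A + 1 := by
  obtain ⟨t, ht0, ht2, hαβ, hmain⟩ := exists_parameters hδ0 hδ1 hδ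
  obtain ⟨K, hK⟩ := exists_nat_ge (1 / t)
  rw [div_le_iff₀ ht0] at hK
  have hK2 : 2 ≤ K := by
    have : (1 : ℝ) < K := by nlinarith
    exact_mod_cast this
  have hK0 : (0 : ℝ) < K := by exact_mod_cast (by omega : 0 < K)
  refine ⟨1 + t, t, K, by linarith, ht0, hK2, fun s => ?_⟩
  filter_upwards [eventually_exists_scales (M := 6 + 4 * t) (α := δ * (1 + t)) (β := (1 - t) / 2)
      (ξ := 1 + t) (η := t) hδ0 (by nlinarith) hαβ (by linarith) (by linarith) (by linarith) ht0 ht2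
      K s,
    eventually_meanThrough_le hδ0 (show 6 < 6 + 4 * t by linarith) (1 + t) K,
    eventually_meanThrough_ge hδ0 (show 6 < 6 + 4 * t by linarith) ht0 (by linarith) (1 + t)
      (show 1 ≤ K by omega), eventually_regime hδ0]
    with x ⟨J, hJs, hJ, hsum⟩ hup hlow hR
  have hy := hR.y_pos
  have hY : 0 < ((K : ℝ) + 1) * yy δ x := by positivity
  set B := (1 / 2 - t) * (Real.log ((1 - t) / 2 / (δ * (1 + t))) - t) - t with hB
  set f : ℕ → ℝ := fun j => meanThrough (((1 + t) ^ j) ^ (6 + 4 * t)) (zz δ x)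
    ⌊(K : ℝ) * (1 + t) ^ j⌋₊ (QH δ (1 + t) x ((1 + t) ^ j)) / (((K : ℝ) + 1) * yy δ x) with hf
  have hB0 : 0 < B := by
    have h1 := hA.trans_lt hmain
    have h2 : 0 < 1 - t := by linarith
    exact pos_of_mul_pos_right h1 (by positivity)
  have htot : A ≤ ∑ j ∈ J, f j := by
    have h2 : 0 < 1 - t := by linarith
    have h3 : 1 - t ≤ (K : ℝ) / (K + 1) := by
      rw [le_div_iff₀ (by positivity)]
      linarith
    calc A ≤ (1 - t) ^ 4 / ((6 + 4 * t) * (1 + t)) * B := hmain.le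
      _ = (1 - t) ^ 3 / ((6 + 4 * t) * (1 + t)) * (1 - t) * B := by ring
      _ ≤ (1 - t) ^ 3 / ((6 + 4 * t) * (1 + t)) * (K / (K + 1)) *
          ∑ j ∈ J, ∑ q ∈ QH δ (1 + t) x ((1 + t) ^ j),
            primeWeight q * (1 / Real.log (yy δ x / q)) := by gcongr
      _ = ∑ j ∈ J, (1 - t) ^ 3 * (K / ((6 + 4 * t) * (1 + t))) * yy δ x *
          (∑ q ∈ QH δ (1 + t) x ((1 + t) ^ j), primeWeight q * (1 / Real.log (yy δ x / q))) /
            (((K : ℝ) + 1) * yy δ x) := by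
          rw [mul_sum]
          refine sum_congr rfl fun j _ => ?_
          field_simp
      _ ≤ ∑ j ∈ J, f j := by
          refine sum_le_sum fun j hj => ?_
          exact div_le_div_of_nonneg_right (hlow _ (hJ j hj)) hY.le
  obtain ⟨I, hIJ, h1, h2⟩ := exists_subset_sum_mem_Icc J f hA
    (fun j hj => (div_le_one hY).2 (hup _ (hJ j hj))) htot
  refine ⟨I, fun j hj => hJs j (hIJ hj), fun j hj => hJ j (hIJ hj), ?_, ?_⟩
  · rwa [sum_div]
  · rwa [sum_div]

end SievedGaps

namespace SievedGaps
open Finset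

theorem abs_sum_sum_lam_sub_mul_le {δ ξ ε x C : ℝ} {K : ℕ} {J : Finset ℕ} {b : ℤ} (hR : Regime δ x)
    (hε : 0 < ε) (hs : ∀ j ∈ J, Scale δ ξ (6 + 4 * ε) K x (ξ ^ j)) (hC : 0 < C)
    (hτ : ∑ j ∈ J, (ξ ^ j) ^ (-1 - ε) ≤ C * (2 * (yy δ x : ℝ) / x) ^ (-1 - ε)) {n : ℤ}
    (hn : n ∈ (Icc (1 : ℤ) (yy δ x : ℤ)).filter (inS (zz δ x) b) \
        J.biUnion fun j => scaleBadPoints δ ξ ε K x (ξ ^ j) b) :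
    |(∑ q ∈ J.biUnion fun j => scaleSteps δ ξ ε K x (ξ ^ j) b,
      ∑ h ∈ Icc 1 ⌊(K : ℝ) * Hq δ ξ x q⌋₊,
        lam (6 + 4 * ε) (zz δ x) K b (Hq δ ξ x q) q (n - (q : ℤ) * (h : ℤ))) -
      (∑ j ∈ J, meanThrough ((ξ ^ j) ^ (6 + 4 * ε)) (zz δ x) ⌊(K : ℝ) * ξ ^ j⌋₊
        (QH δ ξ x (ξ ^ j))) / (((K : ℝ) + 1) * yy δ x) * (((K : ℝ) + 1) * yy δ x)| ≤
      (2 * C + 1) * (((K : ℝ) + 1) * (yy δ x : ℝ)) / Real.log x ^ (δ * (1 + ε)) := by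
  have hy := hR.y_pos
  have hL : 0 < Real.log x := by linarith [hR.log_ge]
  have hr : 0 < Real.log x ^ (δ * (1 + ε)) := Real.rpow_pos_of_pos hL _
  rw [div_mul_cancel₀ _ (by positivity)]
  refine (abs_sum_sum_lam_sub_le hs hn).trans ?_
  calc 2 * (yy δ x : ℝ) * ∑ j ∈ J, (ξ ^ j) ^ (-1 - ε)
      ≤ 2 * (yy δ x : ℝ) * (C * (1 / Real.log x ^ (δ * (1 + ε)))) := by
        gcongr
        refine hτ.trans ?_
        gcongr
        exact hR.two_mul_div_rpow_le hε
    _ = 2 * C * (1 * (yy δ x : ℝ)) / Real.log x ^ (δ * (1 + ε)) := by ring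
    _ ≤ (2 * C + 1) * (((K : ℝ) + 1) * (yy δ x : ℝ)) / Real.log x ^ (δ * (1 + ε)) := by
        gcongr
        · linarith
        · linarith [(Nat.cast_nonneg K : (0 : ℝ) ≤ K)]

theorem abs_sum_lam_sub_mul_le {δ ξ ε x C : ℝ} {K : ℕ} {J : Finset ℕ} {b : ℤ} (hR : Regime δ x)
    (hε : 0 < ε) (hs : ∀ j ∈ J, Scale δ ξ (6 + 4 * ε) K x (ξ ^ j)) (hC : 1 ≤ C) {q : ℕ}
    (hq : q ∈ J.biUnion fun j => scaleSteps δ ξ ε K x (ξ ^ j) b) :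
    |(∑ n ∈ Ioc (-((K * yy δ x : ℕ) : ℤ)) ((yy δ x : ℤ)),
        lam (6 + 4 * ε) (zz δ x) K b (Hq δ ξ x q) q n) - ((K : ℝ) + 1) * (yy δ x : ℝ)| ≤
      C * (((K : ℝ) + 1) * (yy δ x : ℝ)) / Real.log x ^ (δ * (1 + ε)) := by
  refine (abs_sum_lam_sub_le hε hs hq).trans ?_
  have hL : 0 < Real.log x := by linarith [hR.log_ge]
  have hr : 0 < Real.log x ^ (δ * (1 + ε)) := Real.rpow_pos_of_pos hL _
  rw [mul_one_div]
  exact div_le_div_of_nonneg_right (le_mul_of_one_le_left (by positivity) hC) hr.le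

end SievedGaps

open SievedGaps

theorem stmt7 (δ : ℝ) (hδ0 : 0 < δ) (hδ1 : δ < 1/2)
    (hδ : 12 * (10 : ℝ) ^ (2 * δ) < Real.log (1 / (2 * δ)))
    (hδ' : Real.log (1 / (2 * δ)) ≤ 1000) :
    ∃ M ξ ε : ℝ, ∃ K : ℕ, 6 < M ∧ 1 < ξ ∧ 0 < ε ∧ 2 ≤ K ∧
    ∃ C : ℝ, 0 < C ∧ ∃ x₀ : ℝ, ∀ x ≥ x₀, ∀ N : ℕ, 0 < N →
    ∃ b : ℤ, ∃ U' V' : Finset ℕ, ∃ Nset NstarSet : Finset ℤ, ∃ C₂ C₃ : ℝ,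
      (∀ q ∈ U', ∃ H ∈ frakH1 δ ξ x, q ∈ QH δ ξ x H) ∧
      (∀ q ∈ V', ∃ H ∈ frakH2 δ ξ x, q ∈ QH δ ξ x H) ∧
      Nset ⊆ (Finset.Icc (1 : ℤ) (yy δ x : ℤ)).filter (inS (zz δ x) b) ∧
      NstarSet ⊆ (Finset.Icc (-(yy δ x : ℤ)) (-1)).filter (inS (zz δ x) (-(N : ℤ) - b)) ∧
      (10 : ℝ) ^ (2 * δ) ≤ C₂ ∧ C₂ ≤ 100 ∧ (10 : ℝ) ^ (2 * δ) ≤ C₃ ∧ C₃ ≤ 100 ∧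
      -- (i)
      (countS (zz δ x) b 1 (yy δ x) : ℝ) ≤ 2 * sigUpTo (zz δ x) * (yy δ x : ℝ) ∧
      (countS (zz δ x) (-(N : ℤ) - b) (-(yy δ x : ℤ)) (-1) : ℝ) ≤
        2 * sigUpTo (zz δ x) * (yy δ x : ℝ) ∧
      -- (ii)
      (∀ q ∈ U',
        |(∑ n ∈ Finset.Ioc (-((K * yy δ x : ℕ) : ℤ)) ((yy δ x : ℤ)),
            lam M (zz δ x) K b (Hq δ ξ x q) q n) - ((K : ℝ) + 1) * (yy δ x : ℝ)| ≤
          C * (((K : ℝ) + 1) * (yy δ x : ℝ)) / Real.log x ^ (δ * (1 + ε))) ∧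
      -- (iii)
      (∀ q ∈ V',
        |(∑ n ∈ Finset.Ico (-(yy δ x : ℤ)) ((K * yy δ x : ℕ) : ℤ),
            lamStar M (zz δ x) K (N : ℤ) b (Hq δ ξ x q) q n) - ((K : ℝ) + 1) * (yy δ x : ℝ)| ≤
          C * (((K : ℝ) + 1) * (yy δ x : ℝ)) / Real.log x ^ (δ * (1 + ε))) ∧
      -- (iv)
      ((((Finset.Icc (1 : ℤ) (yy δ x : ℤ)).filter (inS (zz δ x) b) \ Nset).card : ℝ) ≤
        x / (10 * Real.log x)) ∧
      (∀ n ∈ Nset,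
        |(∑ q ∈ U', ∑ h ∈ Finset.Icc 1 ⌊(K : ℝ) * Hq δ ξ x q⌋₊,
            lam M (zz δ x) K b (Hq δ ξ x q) q (n - (q : ℤ) * (h : ℤ))) -
          C₂ * (((K : ℝ) + 1) * (yy δ x : ℝ))| ≤
          C * (((K : ℝ) + 1) * (yy δ x : ℝ)) / Real.log x ^ (δ * (1 + ε))) ∧
      -- (v)
      ((((Finset.Icc (-(yy δ x : ℤ)) (-1)).filter (inS (zz δ x) (-(N : ℤ) - b)) \
          NstarSet).card : ℝ) ≤ x / (10 * Real.log x)) ∧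
      (∀ n ∈ NstarSet,
        |(∑ q ∈ V', ∑ h ∈ Finset.Icc 1 ⌊(K : ℝ) * Hq δ ξ x q⌋₊,
            lamStar M (zz δ x) K (N : ℤ) b (Hq δ ξ x q) q (n + (q : ℤ) * (h : ℤ))) -
          C₃ * (((K : ℝ) + 1) * (yy δ x : ℝ))| ≤
          C * (((K : ℝ) + 1) * (yy δ x : ℝ)) / Real.log x ^ (δ * (1 + ε))) := by
  have hA0 : (0 : ℝ) ≤ 10 ^ (2 * δ) := by positivity
  have hA10 : (10 : ℝ) ^ (2 * δ) ≤ 10 := by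
    calc (10 : ℝ) ^ (2 * δ) ≤ 10 ^ (1 : ℝ) :=
          Real.rpow_le_rpow_of_exponent_le (by norm_num) (by linarith)
      _ = 10 := Real.rpow_one _
  obtain ⟨ξ, ε, K, hξ, hε, hK, hJ⟩ := exists_scales_with_prescribed_mean hδ0 hδ1 hA0 hδ
  obtain ⟨C, hC, hτ⟩ := exists_sum_rpow_scale_le hξ hε
  refine ⟨6 + 4 * ε, ξ, ε, K, by linarith, hξ, hε, hK, 2 * C + 1, by linarith, ?_⟩
  obtain ⟨x₀, hx₀⟩ := Filter.eventually_atTop.1 ((hJ 0).and ((hJ 1).and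
    ((eventually_exists_goodShift hδ0 hξ hε hK).and (eventually_regime hδ0))))
  refine ⟨x₀, fun x hx N _ => ?_⟩
  obtain ⟨⟨I, hI0, hI, hI1, hI2⟩, ⟨J, hJ0, hJs, hJ1, hJ2⟩, hb, hR⟩ := hx₀ x hx
  obtain ⟨b, hbI, hbJ⟩ := hb I J hI hJs N
  refine ⟨b, I.biUnion fun j => scaleSteps δ ξ ε K x (ξ ^ j) b,
    J.biUnion fun j => scaleSteps δ ξ ε K x (ξ ^ j) (N + b),
    (Finset.Icc (1 : ℤ) (yy δ x : ℤ)).filter (inS (zz δ x) b) \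
      I.biUnion fun j => scaleBadPoints δ ξ ε K x (ξ ^ j) b,
    ((Finset.Icc (1 : ℤ) (yy δ x : ℤ)).filter (inS (zz δ x) (N + b)) \
      J.biUnion fun j => scaleBadPoints δ ξ ε K x (ξ ^ j) (N + b)).image Neg.neg,
    _, _, ?_, ?_, Finset.sdiff_subset, ?_, hI1, by linarith, hJ1, by linarith, hbI.1, ?_, ?_, ?_,
    card_filter_inS_sdiff_le hbI, ?_, ?_, ?_⟩
  · intro q hq
    obtain ⟨j, hj, hqj⟩ := Finset.mem_biUnion.1 hq
    exact ⟨ξ ^ j, ⟨j, hI0 j hj, rfl, (hI j hj).lo, (hI j hj).hi⟩, (mem_scaleSteps.1 hqj).1⟩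
  · intro q hq
    obtain ⟨j, hj, hqj⟩ := Finset.mem_biUnion.1 hq
    exact ⟨ξ ^ j, ⟨j, by simpa [Nat.even_add_one] using hJ0 j hj, rfl, (hJs j hj).lo,
      (hJs j hj).hi⟩, (mem_scaleSteps.1 hqj).1⟩
  · rw [filter_inS_neg_eq_image]
    exact Finset.image_subset_image Finset.sdiff_subset
  · rw [countS_neg_sub]
    exact hbJ.1
  · exact fun q hq => abs_sum_lam_sub_mul_le hR hε hI (by linarith) hq
  · intro q hq
    rw [sum_lamStar_eq_sum_lam]
    exact abs_sum_lam_sub_mul_le hR hε hJs (by linarith) hq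
  · exact fun n hn => abs_sum_sum_lam_sub_mul_le hR hε hI hC (hτ δ _ x K I hR hI) hn
  · rw [filter_inS_neg_eq_image, ← Finset.image_sdiff _ _ neg_injective,
      Finset.card_image_of_injective _ neg_injective]
    exact card_filter_inS_sdiff_le hbJ
  · intro n hn
    obtain ⟨m, hm, rfl⟩ := Finset.mem_image.1 hn
    simp only [lamStar_eq_lam, neg_add, neg_neg, ← sub_eq_add_neg]
    exact abs_sum_sum_lam_sub_mul_le hR hε hJs hC (hτ δ _ x K J hR hJs) hm
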